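/- There exist a smooth odd function f : ℝ → ℝ and a bounded smooth function u : ℝ² → ℝ such that: −Δu = f(u) in ℝ²; ∇u is bounded on ℝ²; ∇u(x) ≠ 0 for every x ∈ ℝ²; inf_{x ∈ ℝ²} |∇u(x)| = 0; and u is not one-dimensional, i.e. there do not exist a unit vector e ∈ ℝ² and a function g : ℝ → ℝ with u(x) = g(x·e) for all x ∈ ℝ². -/

import Mathlib

open MeasureTheory
/-- Partial derivative of `u : ℝ² → ℝ` in the first coordinate. -/
noncomputable def pd1 (u : ℝ × ℝ → ℝ) (p : ℝ × ℝ) : ℝ := fderiv ℝ u p (1, 0)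

/-- Partial derivative of `u : ℝ² → ℝ` in the second coordinate. -/
noncomputable def pd2 (u : ℝ × ℝ → ℝ) (p : ℝ × ℝ) : ℝ := fderiv ℝ u p (0, 1)

/-- Laplacian of `u : ℝ² → ℝ`. -/
noncomputable def lap2 (u : ℝ × ℝ → ℝ) (p : ℝ × ℝ) : ℝ :=
  fderiv ℝ (pd1 u) p (1, 0) + fderiv ℝ (pd2 u) p (0, 1)

/-- Gradient of `u : ℝ² → ℝ`. -/
noncomputable def grad2 (u : ℝ × ℝ → ℝ) (p : ℝ × ℝ) : ℝ × ℝ := (pd1 u p, pd2 u p)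

open Real Set Filter Topology

/-- Product of Lebesgue measure on `ℝ` with Lebesgue measure on one period. -/
noncomputable def cylMeasure : Measure (ℝ × ℝ) :=
  (volume : Measure ℝ).prod ((volume : Measure ℝ).restrict (Ioc (-π) π))

/-- The function whose reciprocal governs the Green kernel of the cylinder. -/
noncomputable def cylDen (q : ℝ × ℝ) : ℝ := cosh q.1 - cos q.2

/-- `4π` times the mean-zero Green kernel of `-Δ` on the cylinder. -/
noncomputable def kerG (q : ℝ × ℝ) : ℝ := log (cosh q.1) - log (cylDen q)

/-- First partial derivative of `kerG`. -/
noncomputable def kerX (q : ℝ × ℝ) : ℝ := -(sinh q.1 * cos q.2) / (cosh q.1 * cylDen q)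

/-- Second partial derivative of `kerG`. -/
noncomputable def kerY (q : ℝ × ℝ) : ℝ := -sin q.2 / cylDen q

lemma cylDen_eq (s t : ℝ) : cylDen (s, t) = 2 * (sinh (s / 2) ^ 2 + sin (t / 2) ^ 2) := by
  have h1 : cosh s = 2 * sinh (s / 2) ^ 2 + 1 := by
    have := cosh_two_mul (s / 2)
    rw [mul_div_cancel₀ s two_ne_zero] at this
    rw [this, cosh_sq]; ring
  have h2 : cos t = 1 - 2 * sin (t / 2) ^ 2 := by
    have := cos_two_mul (t / 2)
    rw [mul_div_cancel₀ t two_ne_zero] at this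
    rw [this, cos_sq']; ring
  simp only [cylDen, h1, h2]; ring

lemma cylDen_pos {s : ℝ} (hs : s ≠ 0) (t : ℝ) : 0 < cylDen (s, t) := by
  have : 1 < cosh s := one_lt_cosh.2 hs
  have := cos_le_one t
  simp only [cylDen]; linarith

lemma cylDen_pos' (s : ℝ) {t : ℝ} (ht : sin (t / 2) ≠ 0) : 0 < cylDen (s, t) := by
  rw [cylDen_eq]; positivity

/-- The separated majorant of the kernels. -/
noncomputable def kerBd (q : ℝ × ℝ) : ℝ := (√|sinh (q.1 / 2)|)⁻¹ * (√|sin (q.2 / 2)|)⁻¹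

lemma div_sq_add_sq_le {a b : ℝ} (ha : 0 < a) (hb : 0 < b) :
    a / (a ^ 2 + b ^ 2) ≤ (√a)⁻¹ * (√b)⁻¹ := by
  obtain ⟨c, hc, rfl⟩ : ∃ c, 0 < c ∧ a = c ^ 2 := ⟨√a, sqrt_pos.2 ha, (sq_sqrt ha.le).symm⟩
  obtain ⟨d, hd, rfl⟩ : ∃ d, 0 < d ∧ b = d ^ 2 := ⟨√b, sqrt_pos.2 hb, (sq_sqrt hb.le).symm⟩
  rw [sqrt_sq hc.le, sqrt_sq hd.le, ← mul_inv, div_le_iff₀ (by positivity), inv_mul_eq_div,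
    le_div_iff₀ (by positivity)]
  nlinarith [sq_nonneg (c ^ 2 - d ^ 2), sq_nonneg (c ^ 2 - c * d), sq_nonneg (c * d), sq_nonneg (c-d),
    mul_pos hc hd, sq_nonneg (d^2 - c*d)]

lemma abs_sinh_le_mul_cosh (s : ℝ) : |sinh s| ≤ 2 * |sinh (s / 2)| * cosh s := by
  have h := sinh_two_mul (s / 2)
  rw [mul_div_cancel₀ s two_ne_zero] at h
  rw [h, abs_mul, abs_mul, abs_two, abs_of_pos (cosh_pos _)]
  have : cosh (s / 2) ≤ cosh s := by
    rw [cosh_le_cosh, abs_div, abs_two]; linarith [abs_nonneg s]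
  exact mul_le_mul_of_nonneg_left this (by positivity)

lemma abs_kerX_le' (s t : ℝ) :
    |kerX (s, t)| ≤ |sinh (s / 2)| / (|sinh (s / 2)| ^ 2 + |sin (t / 2)| ^ 2) := by
  rcases eq_or_ne s 0 with rfl | hs
  · simp [kerX]
  have hd := cylDen_pos hs t
  have hc := cosh_pos s
  simp only [kerX, abs_div, abs_neg, abs_mul, abs_of_pos hd, abs_of_pos hc, sq_abs]
  have h0 : 0 < sinh (s / 2) ^ 2 + sin (t / 2) ^ 2 := by
    rw [cylDen_eq] at hd; linarith
  rw [div_le_div_iff₀ (by positivity) h0, cylDen_eq]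
  have h1 := abs_sinh_le_mul_cosh s
  have h2 := abs_cos_le_one t
  have h3 : |sinh s| * |cos t| ≤ 2 * |sinh (s / 2)| * cosh s :=
    (mul_le_of_le_one_right (abs_nonneg _) h2).trans h1
  nlinarith

lemma abs_kerX_le {s t : ℝ} (hs : s ≠ 0) (ht : sin (t / 2) ≠ 0) :
    |kerX (s, t)| ≤ kerBd (s, t) := by
  refine (abs_kerX_le' s t).trans (div_sq_add_sq_le ?_ (by positivity))
  have : sinh (s / 2) ≠ 0 := by rw [ne_eq, sinh_eq_zero]; simpa using hs
  positivity

lemma abs_kerY_le {s t : ℝ} (hs : s ≠ 0) (ht : sin (t / 2) ≠ 0) :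
    |kerY (s, t)| ≤ kerBd (s, t) := by
  have h1 : sinh (s / 2) ≠ 0 := by rw [ne_eq, sinh_eq_zero]; simpa using hs
  have key := div_sq_add_sq_le (a := |sin (t / 2)|) (b := |sinh (s / 2)|) (by positivity)
    (by positivity)
  rw [mul_comm] at key
  refine le_trans ?_ key
  have hd := cylDen_pos hs t
  simp only [kerY, abs_div, abs_neg, abs_of_pos hd, sq_abs]
  rw [div_le_div_iff₀ (by positivity) (by positivity), cylDen_eq]
  have h := sin_two_mul (t / 2)
  rw [mul_div_cancel₀ t two_ne_zero] at h
  rw [h, abs_mul, abs_mul, abs_two]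
  have h2 := abs_cos_le_one (t / 2)
  have h3 : 2 * |sin (t / 2)| * |cos (t / 2)| ≤ 2 * |sin (t / 2)| :=
    mul_le_of_le_one_right (by positivity) h2
  have : 0 < sinh (s / 2) ^ 2 + sin (t / 2) ^ 2 := by positivity
  nlinarith

lemma abs_log_le_div_sqrt {w : ℝ} (hw : 0 < w) : |log w| ≤ 2 * |w - 1| / √w := by
  obtain ⟨c, hc, rfl⟩ : ∃ c, 0 < c ∧ w = c ^ 2 := ⟨√w, sqrt_pos.2 hw, (sq_sqrt hw.le).symm⟩
  rw [sqrt_sq hc.le, log_pow, abs_mul, mul_div_assoc]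
  simp only [Nat.cast_ofNat, abs_two]
  gcongr
  rw [le_div_iff₀ hc]
  have e : c ^ 2 - 1 = (c - 1) * (c + 1) := by ring
  rw [e, abs_mul, abs_of_pos (by linarith : 0 < c + 1)]
  rcases le_total 1 c with h | h
  · rw [abs_of_nonneg (log_nonneg h), abs_of_nonneg (by linarith)]
    have := log_le_sub_one_of_pos hc
    nlinarith
  · rw [abs_of_nonpos (log_nonpos hc.le h), abs_of_nonpos (by linarith)]
    have := log_le_sub_one_of_pos (inv_pos.2 hc)
    rw [log_inv] at this
    have h2 : -log c * c ≤ (c⁻¹ - 1) * c := by gcongr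
    rw [sub_mul, inv_mul_cancel₀ hc.ne'] at h2
    nlinarith

lemma abs_kerG_le {s t : ℝ} (hs : s ≠ 0) (ht : sin (t / 2) ≠ 0) :
    |kerG (s, t)| ≤ kerBd (s, t) := by
  have h1 : sinh (s / 2) ≠ 0 := by rw [ne_eq, sinh_eq_zero]; simpa using hs
  have hd := cylDen_pos hs t
  have hc := cosh_pos s
  have e : kerG (s, t) = - log (cylDen (s, t) / cosh s) := by
    rw [log_div hd.ne' hc.ne']; simp [kerG]
  have e2 : cylDen (s, t) / cosh s - 1 = - (cos t / cosh s) := by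
    simp only [cylDen]; field_simp; ring
  rw [e, abs_neg]
  refine (abs_log_le_div_sqrt (by positivity)).trans ?_
  have h3 : |cylDen (s, t) / cosh s - 1| ≤ (cosh s)⁻¹ := by
    rw [e2, abs_neg, abs_div, abs_of_pos hc, div_eq_mul_inv]
    exact mul_le_of_le_one_left (by positivity) (abs_cos_le_one t)
  have h4 : (cosh s)⁻¹ ≤ (√(cosh s))⁻¹ := by
    apply inv_anti₀ (by positivity)
    rw [sqrt_le_left (by positivity)]
    nlinarith [one_le_cosh s]
  have h5 : 2 * √(|sinh (s / 2)| * |sin (t / 2)|) ≤ √(cylDen (s, t)) := by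
    apply le_sqrt_of_sq_le
    rw [mul_pow, sq_sqrt (by positivity), cylDen_eq]
    nlinarith [sq_nonneg (|sinh (s / 2)| - |sin (t / 2)|), sq_abs (sinh (s / 2)),
      sq_abs (sin (t / 2))]
  have h6 : 0 < √(|sinh (s / 2)| * |sin (t / 2)|) := by positivity
  calc 2 * |cylDen (s, t) / cosh s - 1| / √(cylDen (s, t) / cosh s)
      ≤ 2 * (√(cosh s))⁻¹ / √(cylDen (s, t) / cosh s) := by
        gcongr; exact h3.trans h4
    _ = 2 / √(cylDen (s, t)) := by
        rw [sqrt_div hd.le]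
        have : 0 < √(cosh s) := by positivity
        have : 0 < √(cylDen (s, t)) := by positivity
        field_simp
    _ ≤ 2 / (2 * √(|sinh (s / 2)| * |sin (t / 2)|)) := by gcongr
    _ = kerBd (s, t) := by
        rw [kerBd, ← mul_inv, ← sqrt_mul (abs_nonneg _)]
        field_simp

lemma integrable_of_even {g : ℝ → ℝ} (he : ∀ x, g (-x) = g x) (h : IntegrableOn g (Ioi 0)) :
    Integrable g := by
  have h2 : IntegrableOn g (Iic 0) := by
    have h3 := h.comp_neg
    simp only [neg_Ioi, neg_zero, he] at h3
    exact (integrableOn_Iic_iff_integrableOn_Iio).2 h3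
  have := h2.union h
  rwa [Iic_union_Ioi, integrableOn_univ] at this

lemma pow_four_le_sinh {x : ℝ} (hx : 0 ≤ x) : x ^ 4 / 32 ≤ sinh x := by
  have dbl : ∀ y : ℝ, 0 ≤ y → 2 * sinh (y / 2) ^ 2 ≤ sinh y := fun y hy => by
    have h := sinh_two_mul (y / 2)
    rw [mul_div_cancel₀ y two_ne_zero] at h
    have h1 : 0 ≤ sinh (y / 2) := sinh_nonneg_iff.2 (by linarith)
    have h2 := sinh_lt_cosh (y / 2)
    nlinarith
  have h1 := dbl x hx
  have h2 := dbl (x / 2) (by linarith)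
  have h3 : x / 2 / 2 ≤ sinh (x / 2 / 2) := self_le_sinh_iff.2 (by linarith)
  have h4 : (x / 2 / 2) ^ 2 ≤ sinh (x / 2 / 2) ^ 2 := by gcongr
  have h5 : x ^ 2 / 8 ≤ sinh (x / 2) := by nlinarith
  have h6 : (x ^ 2 / 8) ^ 2 ≤ sinh (x / 2) ^ 2 := by gcongr
  nlinarith

lemma integrable_inv_sqrt_sinh : Integrable (fun s : ℝ => (√|sinh (s / 2)|)⁻¹) := by
  have hm : Measurable (fun s : ℝ => (√|sinh (s / 2)|)⁻¹) := by fun_prop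
  refine integrable_of_even (fun x => by rw [neg_div, sinh_neg, abs_neg]) ?_
  rw [← Ioc_union_Ioi_eq_Ioi zero_le_one]
  refine IntegrableOn.union ?_ ?_
  · have h : IntegrableOn (fun s : ℝ => √2 * s ^ (-(1 / 2) : ℝ)) (Ioc 0 1) :=
      ((intervalIntegrable_iff_integrableOn_Ioc_of_le zero_le_one).1
        (intervalIntegral.intervalIntegrable_rpow' (by norm_num))).const_mul _
    refine h.mono' hm.aestronglyMeasurable ((ae_restrict_iff' measurableSet_Ioc).2
      (ae_of_all _ fun s hs => ?_))
    have h0 : 0 < s := hs.1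
    have h1 : s / 2 ≤ sinh (s / 2) := self_le_sinh_iff.2 (by linarith)
    rw [norm_of_nonneg (by positivity), abs_of_pos (by linarith), rpow_neg h0.le,
      ← sqrt_eq_rpow, ← div_eq_mul_inv, inv_le_comm₀ (by apply sqrt_pos.2; linarith)
      (by positivity), inv_div, ← sqrt_div h0.le]
    exact sqrt_le_sqrt h1
  · have h : IntegrableOn (fun s : ℝ => √512 * s ^ (-2 : ℝ)) (Ioi 1) :=
      (integrableOn_Ioi_rpow_of_lt (by norm_num) one_pos).const_mul _
    refine h.mono' hm.aestronglyMeasurable ((ae_restrict_iff' measurableSet_Ioi).2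
      (ae_of_all _ fun s hs => ?_))
    have h0 : 0 < s := one_pos.trans hs
    have h1 : (s / 2) ^ 4 / 32 ≤ sinh (s / 2) := pow_four_le_sinh (by linarith)
    have h2 : 0 < (s / 2) ^ 4 / 32 := by positivity
    rw [norm_of_nonneg (by positivity), abs_of_pos (by linarith), rpow_neg h0.le,
      ← div_eq_mul_inv, inv_le_comm₀ (by apply sqrt_pos.2; linarith)
      (by positivity), inv_div]
    have h3 : s ^ (2 : ℝ) / √512 = √((s / 2) ^ 4 / 32) := by
      rw [eq_comm, sqrt_eq_iff_mul_self_eq (by positivity) (by positivity), rpow_two,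
        div_mul_div_comm, mul_self_sqrt (by norm_num)]
      ring
    rw [h3]
    exact sqrt_le_sqrt h1

lemma integrableOn_inv_sqrt_sin :
    IntegrableOn (fun t : ℝ => (√|sin (t / 2)|)⁻¹) (Ioc (-π) π) := by
  have hm : Measurable (fun t : ℝ => (√|sin (t / 2)|)⁻¹) := by fun_prop
  have key : IntegrableOn (fun t : ℝ => (√|sin (t / 2)|)⁻¹) (Ioc 0 π) := by
    have h : IntegrableOn (fun s : ℝ => √π * s ^ (-(1 / 2) : ℝ)) (Ioc 0 π) :=
      ((intervalIntegrable_iff_integrableOn_Ioc_of_le pi_pos.le).1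
        (intervalIntegral.intervalIntegrable_rpow' (by norm_num))).const_mul _
    refine h.mono' hm.aestronglyMeasurable ((ae_restrict_iff' measurableSet_Ioc).2
      (ae_of_all _ fun s hs => ?_))
    have h0 : 0 < s := hs.1
    have h1 : 2 / π * (s / 2) ≤ sin (s / 2) := mul_le_sin (by linarith) (by linarith [hs.2])
    have e : 2 / π * (s / 2) = s / π := by ring
    rw [e] at h1
    have h2 : 0 < s / π := by positivity
    rw [norm_of_nonneg (by positivity), abs_of_pos (by linarith), rpow_neg h0.le,
      ← sqrt_eq_rpow, ← div_eq_mul_inv, inv_le_comm₀ (by apply sqrt_pos.2; linarith)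
      (by positivity), inv_div, ← sqrt_div h0.le]
    exact sqrt_le_sqrt h1
  have key' : IntegrableOn (fun t : ℝ => (√|sin (t / 2)|)⁻¹) (Ico (-π) 0) := by
    have h := key.comp_neg
    simp only [neg_Ioc, neg_zero, neg_div, sin_neg, abs_neg] at h
    exact h
  rw [← Ioc_union_Ioc_eq_Ioc (neg_nonpos.2 pi_pos.le) pi_pos.le]
  exact (key'.congr_set_ae Ico_ae_eq_Ioc.symm).union key

lemma integrable_kerBd : Integrable kerBd cylMeasure :=
  integrable_inv_sqrt_sinh.mul_prod integrableOn_inv_sqrt_sin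

lemma ae_sin_half : ∀ᵐ t ∂(volume : Measure ℝ).restrict (Ioc (-π) π), sin (t / 2) ≠ 0 := by
  have h : ∀ᵐ t : ℝ, t ≠ 0 := by simp [ae_iff]
  filter_upwards [ae_restrict_of_ae h, ae_restrict_mem measurableSet_Ioc] with t h0 ht
  rw [ne_eq, sin_eq_zero_iff_of_lt_of_lt (by linarith [ht.1, pi_pos]) (by linarith [ht.2, pi_pos])]
  simpa using h0

lemma ae_cyl : ∀ᵐ q ∂cylMeasure, q.1 ≠ 0 ∧ sin (q.2 / 2) ≠ 0 := by
  have h : ∀ᵐ t : ℝ, t ≠ 0 := by simp [ae_iff]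
  have h1 : ∀ᵐ q ∂cylMeasure, q.1 ≠ 0 := Measure.quasiMeasurePreserving_fst.ae h
  have h2 : ∀ᵐ q ∂cylMeasure, sin (q.2 / 2) ≠ 0 :=
    Measure.quasiMeasurePreserving_snd.ae ae_sin_half
  exact h1.and h2

lemma measurable_cylDen : Measurable cylDen := by unfold cylDen; fun_prop

lemma integrable_kerG : Integrable kerG cylMeasure := by
  have hm : Measurable kerG := by
    have := measurable_cylDen
    unfold kerG; fun_prop
  refine integrable_kerBd.mono' hm.aestronglyMeasurable ?_
  filter_upwards [ae_cyl] with q hq using abs_kerG_le hq.1 hq.2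

lemma integrable_kerX : Integrable kerX cylMeasure := by
  have hm : Measurable kerX := by
    have := measurable_cylDen
    unfold kerX; fun_prop
  refine integrable_kerBd.mono' hm.aestronglyMeasurable ?_
  filter_upwards [ae_cyl] with q hq using abs_kerX_le hq.1 hq.2

lemma integrable_kerY : Integrable kerY cylMeasure := by
  have hm : Measurable kerY := by
    have := measurable_cylDen
    unfold kerY; fun_prop
  refine integrable_kerBd.mono' hm.aestronglyMeasurable ?_
  filter_upwards [ae_cyl] with q hq using abs_kerY_le hq.1 hq.2

lemma hasDerivAt_kerG_fst {s t : ℝ} (h : 0 < cylDen (s, t)) :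
    HasDerivAt (fun s => kerG (s, t)) (kerX (s, t)) s := by
  have h1 := (hasDerivAt_cosh s).log (cosh_pos s).ne'
  have h2 : HasDerivAt (fun s => cylDen (s, t)) (sinh s) s :=
    (hasDerivAt_cosh s).sub_const (cos t)
  refine (h1.sub (h2.log h.ne')).congr_deriv ?_
  have hc := cosh_pos s
  simp only [kerX]
  rw [div_sub_div _ _ hc.ne' h.ne']
  congr 1
  simp only [cylDen]; ring

lemma hasDerivAt_kerG_snd {s t : ℝ} (h : 0 < cylDen (s, t)) :
    HasDerivAt (fun t => kerG (s, t)) (kerY (s, t)) t := by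
  have h2 : HasDerivAt (fun t => cylDen (s, t)) (sin t) t :=
    ((hasDerivAt_cos t).const_sub (cosh s)).congr_deriv (by ring)
  exact ((h2.log h.ne').const_sub (log (cosh s))).congr_deriv (by simp only [kerY]; ring)

/-- Continuous bounded functions on the plane, `2π`-periodic in the second variable. -/
structure Reg0 (h : ℝ × ℝ → ℝ) : Prop where
  cont : Continuous h
  bdd : ∃ M, ∀ p, |h p| ≤ M
  per : ∀ x y, h (x, y + 2 * π) = h (x, y)

/-- `g₁` and `g₂` are the partial derivatives of `h`. -/
def Partials (h g₁ g₂ : ℝ × ℝ → ℝ) : Prop :=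
  ∀ x y, HasDerivAt (fun s => h (s, y)) (g₁ (x, y)) x ∧ HasDerivAt (fun t => h (x, t)) (g₂ (x, y)) y

/-- Convolution with a kernel on the cylinder. -/
noncomputable def cylConv (k h : ℝ × ℝ → ℝ) (p : ℝ × ℝ) : ℝ :=
  (4 * π)⁻¹ * ∫ q, k q * h (p - q) ∂cylMeasure

/-- The operator norm bound for convolution with `k` on bounded functions. -/
noncomputable def kerNorm (k : ℝ × ℝ → ℝ) : ℝ := (4 * π)⁻¹ * ∫ q, |k q| ∂cylMeasure

lemma kerNorm_nonneg (k : ℝ × ℝ → ℝ) : 0 ≤ kerNorm k :=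
  mul_nonneg (by positivity) (integral_nonneg fun _ => abs_nonneg _)

section
variable {k h : ℝ × ℝ → ℝ}

lemma integrable_ker_mul (hk : Integrable k cylMeasure) (hc : Continuous h) {M : ℝ}
    (hM : ∀ p, |h p| ≤ M) (p : ℝ × ℝ) : Integrable (fun q => k q * h (p - q)) cylMeasure := by
  refine (hk.abs.mul_const M).mono' (hk.1.mul (by fun_prop)) (ae_of_all _ fun q => ?_)
  rw [norm_mul, norm_eq_abs, norm_eq_abs]
  exact mul_le_mul_of_nonneg_left (hM _) (abs_nonneg _)

lemma Reg0.integrable (hh : Reg0 h) (hk : Integrable k cylMeasure) (p : ℝ × ℝ) :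
    Integrable (fun q => k q * h (p - q)) cylMeasure :=
  let ⟨_, hM⟩ := hh.bdd
  integrable_ker_mul hk hh.cont hM p

lemma abs_cylConv_le (hk : Integrable k cylMeasure) {M : ℝ}
    (hM : ∀ p, |h p| ≤ M) (p : ℝ × ℝ) : |cylConv k h p| ≤ kerNorm k * M := by
  rw [cylConv, kerNorm, abs_mul, abs_of_pos (by positivity), mul_assoc]
  gcongr
  rw [← integral_mul_const, ← norm_eq_abs]
  refine norm_integral_le_of_norm_le (hk.abs.mul_const M) (ae_of_all _ fun q => ?_)
  rw [norm_mul, norm_eq_abs, norm_eq_abs]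
  exact mul_le_mul_of_nonneg_left (hM _) (abs_nonneg _)

lemma tendsto_cylConv (hk : Integrable k cylMeasure) {H : ℕ → ℝ × ℝ → ℝ} {M : ℝ}
    (hc : ∀ n, Continuous (H n)) (hM : ∀ n p, |H n p| ≤ M) {P : ℕ → ℝ × ℝ} {p : ℝ × ℝ}
    (hl : ∀ q, Tendsto (fun n => H n (P n - q)) atTop (𝓝 (h (p - q)))) :
    Tendsto (fun n => cylConv k (H n) (P n)) atTop (𝓝 (cylConv k h p)) := by
  refine Tendsto.const_mul _ ?_
  refine tendsto_integral_of_dominated_convergence (fun q => |k q| * M)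
    (fun n => hk.1.mul (by have := hc n; fun_prop)) (hk.abs.mul_const M)
    (fun n => ae_of_all _ fun q => ?_) (ae_of_all _ fun q => (hl q).const_mul _)
  rw [norm_mul, norm_eq_abs, norm_eq_abs]
  exact mul_le_mul_of_nonneg_left (hM _ _) (abs_nonneg _)

lemma Reg0.cylConv (hh : Reg0 h) (hk : Integrable k cylMeasure) : Reg0 (cylConv k h) := by
  obtain ⟨M, hM⟩ := hh.bdd
  have hc := hh.cont
  refine ⟨?_, ⟨_, abs_cylConv_le hk hM⟩, fun x y => ?_⟩
  · unfold _root_.cylConv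
    refine continuous_const.mul (continuous_of_dominated (bound := fun q => |k q| * M)
      (fun p => hk.1.mul (by fun_prop)) (fun p => ae_of_all _ fun q => ?_) (hk.abs.mul_const M)
      (ae_of_all _ fun q => by fun_prop))
    rw [norm_mul, norm_eq_abs, norm_eq_abs]
    exact mul_le_mul_of_nonneg_left (hM _) (abs_nonneg _)
  · unfold _root_.cylConv
    congr 2 with q
    congr 1
    have := hh.per (x - q.1) (y - q.2)
    change h (x - q.1, y + 2 * π - q.2) = h (x - q.1, y - q.2)
    rw [← this]
    congr 2; ring

lemma cylConv_translate (v p : ℝ × ℝ) :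
    cylConv k (fun q => h (q + v)) p = cylConv k h (p + v) := by
  unfold cylConv
  congr 2 with q
  simp only [sub_add_eq_add_sub]

lemma cylConv_sub {g : ℝ × ℝ → ℝ} (hk : Integrable k cylMeasure) (hh : Reg0 h) (hg : Reg0 g)
    (p : ℝ × ℝ) : cylConv k (fun q => h q - g q) p = cylConv k h p - cylConv k g p := by
  unfold cylConv
  rw [← mul_sub, ← integral_sub (hh.integrable hk p) (hg.integrable hk p)]
  congr 2 with q
  ring

lemma cylConv_eq (hk : Integrable k cylMeasure) (hh : Reg0 h) (x y : ℝ) :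
    cylConv k h (x, y) = (4 * π)⁻¹ * ∫ s, ∫ t in (-π)..π, k (s, t) * h (x - s, y - t) := by
  have := hh.integrable hk (x, y)
  unfold cylConv
  rw [cylMeasure, integral_prod _ this]
  congr 2 with s
  rw [intervalIntegral.integral_of_le (by linarith [pi_pos])]
  simp

lemma integrable_inner (hk : Integrable k cylMeasure) (hh : Reg0 h) (x y : ℝ) :
    Integrable (fun s => ∫ t in (-π)..π, k (s, t) * h (x - s, y - t)) := by
  have := (hh.integrable hk (x, y)).integral_prod_left
  refine this.congr (ae_of_all _ fun s => ?_)
  simp only []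
  rw [intervalIntegral.integral_of_le (by linarith [pi_pos])]
  simp

lemma cylConv_odd (hk : Integrable k cylMeasure) (hh : Reg0 h)
    (hke : ∀ s t, k (s, -t) = k (s, t)) (ho : ∀ x y, h (x, -y) = -h (x, y)) (x y : ℝ) :
    cylConv k h (x, -y) = -cylConv k h (x, y) := by
  rw [cylConv_eq hk hh, cylConv_eq hk hh, ← mul_neg, ← integral_neg]
  congr 2 with s
  have := intervalIntegral.integral_comp_neg (a := -π) (b := π)
    (fun t => k (s, t) * h (x - s, -y - t))
  rw [neg_neg] at this
  rw [← this, ← intervalIntegral.integral_neg]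
  congr 1 with t
  rw [hke, show -y - -t = -(y - t) by ring, ho]; ring

lemma integral_ker_shift (hkp : ∀ s t, k (s, t + 2 * π) = k (s, t)) (hh : Reg0 h) (x y s : ℝ) :
    ∫ t in (-π)..π, k (s, t) * h (x - s, y - t) = ∫ t in (-π)..π, k (s, y - t) * h (x - s, t) := by
  have e := intervalIntegral.integral_comp_sub_left (a := -π) (b := π)
    (fun t => k (s, y - t) * h (x - s, t)) y
  simp only [sub_sub_cancel] at e
  rw [e]
  have hp : Function.Periodic (fun t => k (s, y - t) * h (x - s, t)) (2 * π) := fun t => by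
    simp only [hh.per]
    rw [← hkp s (y - (t + 2 * π))]
    congr 3; ring
  have := hp.intervalIntegral_add_eq (y - π) (-π)
  rw [show y - π + 2 * π = y - -π by ring, show -π + 2 * π = π by ring] at this
  exact this

/-- The folded form of the inner integral, for data odd in the second variable. -/
lemma integral_ker_fold (hkp : ∀ s t, k (s, t + 2 * π) = k (s, t)) (hh : Reg0 h)
    (ho : ∀ x y, h (x, -y) = -h (x, y)) {s : ℝ} (hkc : Continuous fun t => k (s, t)) (x y : ℝ) :
    ∫ t in (-π)..π, k (s, t) * h (x - s, y - t) =
      ∫ t in (0)..π, (k (s, y - t) - k (s, y + t)) * h (x - s, t) := by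
  have hc := hh.cont
  have hkc' : ∀ g : ℝ → ℝ, Continuous g → Continuous fun t => k (s, g t) :=
    fun g hg => hkc.comp hg
  have c1 : Continuous fun t => k (s, y - t) * h (x - s, t) :=
    (hkc' _ (by fun_prop)).mul (by fun_prop)
  have c2 : Continuous fun t => k (s, y + t) * h (x - s, t) :=
    (hkc' _ (by fun_prop)).mul (by fun_prop)
  rw [integral_ker_shift hkp hh, ← intervalIntegral.integral_add_adjacent_intervals
    (c1.intervalIntegrable (-π) 0) (c1.intervalIntegrable 0 π)]
  have := intervalIntegral.integral_comp_neg (a := 0) (b := π)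
    (fun t => k (s, y - t) * h (x - s, t))
  rw [neg_zero] at this
  rw [← this, ← intervalIntegral.integral_add (by
    apply Continuous.intervalIntegrable
    exact c1.comp continuous_neg) (c1.intervalIntegrable _ _)]
  congr 1 with t
  rw [ho]; ring_nf

lemma cylConv_fold (hk : Integrable k cylMeasure) (hkp : ∀ s t, k (s, t + 2 * π) = k (s, t))
    (hkc : ∀ s, s ≠ 0 → Continuous fun t => k (s, t)) (hh : Reg0 h)
    (ho : ∀ x y, h (x, -y) = -h (x, y)) (x y : ℝ) :
    Integrable (fun s => ∫ t in (0)..π, (k (s, y - t) - k (s, y + t)) * h (x - s, t)) ∧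
    cylConv k h (x, y) = (4 * π)⁻¹ *
      ∫ s, ∫ t in (0)..π, (k (s, y - t) - k (s, y + t)) * h (x - s, t) := by
  have h0 : ∀ᵐ s : ℝ, s ≠ 0 := by simp [ae_iff]
  have e : (fun s => ∫ t in (-π)..π, k (s, t) * h (x - s, y - t)) =ᵐ[volume]
      fun s => ∫ t in (0)..π, (k (s, y - t) - k (s, y + t)) * h (x - s, t) := by
    filter_upwards [h0] with s hs
    exact integral_ker_fold hkp hh ho (hkc s hs) x y
  exact ⟨(integrable_inner hk hh x y).congr e, by rw [cylConv_eq hk hh, integral_congr_ae e]⟩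

lemma cylConv_nonneg_of_fold (hk : Integrable k cylMeasure)
    (hkp : ∀ s t, k (s, t + 2 * π) = k (s, t))
    (hkc : ∀ s, s ≠ 0 → Continuous fun t => k (s, t)) (hh : Reg0 h)
    (ho : ∀ x y, h (x, -y) = -h (x, y)) (hpos : ∀ x, ∀ y ∈ Icc 0 π, 0 ≤ h (x, y)) (x y : ℝ)
    (hD : ∀ s, s ≠ 0 → ∀ t ∈ Icc 0 π, 0 ≤ k (s, y - t) - k (s, y + t)) :
    0 ≤ cylConv k h (x, y) := by
  rw [(cylConv_fold hk hkp hkc hh ho x y).2]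
  refine mul_nonneg (by positivity) (integral_nonneg_of_ae ?_)
  have h0 : ∀ᵐ s : ℝ, s ≠ 0 := by simp [ae_iff]
  filter_upwards [h0] with s hs
  exact intervalIntegral.integral_nonneg pi_pos.le fun t ht =>
    mul_nonneg (hD s hs t ht) (hpos _ t ht)

lemma cylConv_pos_of_fold (hk : Integrable k cylMeasure)
    (hkp : ∀ s t, k (s, t + 2 * π) = k (s, t))
    (hkc : ∀ s, s ≠ 0 → Continuous fun t => k (s, t)) (hh : Reg0 h)
    (ho : ∀ x y, h (x, -y) = -h (x, y)) (hpos : ∀ x, ∀ y ∈ Icc 0 π, 0 ≤ h (x, y)) (x y : ℝ)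
    (hD : ∀ s, s ≠ 0 → ∀ t ∈ Ioo 0 π, 0 < k (s, y - t) - k (s, y + t))
    {x₀ y₀ : ℝ} (hy₀ : y₀ ∈ Ioo 0 π) (h₀ : 0 < h (x₀, y₀)) :
    0 < cylConv k h (x, y) := by
  obtain ⟨hi, he⟩ := cylConv_fold hk hkp hkc hh ho x y
  have hc := hh.cont
  have hcD : ∀ s, s ≠ 0 → Continuous fun t => (k (s, y - t) - k (s, y + t)) * h (x - s, t) := by
    intro s hs
    have := hkc s hs
    exact ((this.comp (by fun_prop : Continuous fun t => y - t)).sub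
      (this.comp (by fun_prop : Continuous fun t => y + t))).mul (by fun_prop)
  have hDc : ∀ s, s ≠ 0 → ∀ t ∈ Icc 0 π, 0 ≤ k (s, y - t) - k (s, y + t) := by
    intro s hs t ht
    have hcl : Icc (0 : ℝ) π = closure (Ioo 0 π) := (closure_Ioo pi_pos.ne).symm
    rw [hcl] at ht
    have := hkc s hs
    have hcc : Continuous fun t => k (s, y - t) - k (s, y + t) :=
      (this.comp (by fun_prop : Continuous fun t => y - t)).sub
      (this.comp (by fun_prop : Continuous fun t => y + t))
    exact closure_minimal (fun t ht => (hD s hs t ht).le) (isClosed_Ici.preimage hcc) ht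
  have h0 : ∀ᵐ s : ℝ, s ≠ 0 := by simp [ae_iff]
  rw [he]
  refine mul_pos (by positivity) ((integral_pos_iff_support_of_nonneg_ae ?_ hi).2 ?_)
  · filter_upwards [h0] with s hs
    exact intervalIntegral.integral_nonneg pi_pos.le fun t ht =>
      mul_nonneg (hDc s hs t ht) (hpos _ t ht)
  · have hopen : IsOpen ({s | 0 < h (x - s, y₀)} ∩ {0}ᶜ) := by
      refine IsOpen.inter ?_ isOpen_compl_singleton
      exact isOpen_lt continuous_const (by fun_prop)
    have hne : ({s | 0 < h (x - s, y₀)} ∩ {0}ᶜ).Nonempty := by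
      have ho : IsOpen {s | 0 < h (x - s, y₀)} := isOpen_lt continuous_const (by fun_prop)
      have hd : Dense ({0}ᶜ : Set ℝ) := dense_compl_singleton 0
      exact hd.inter_open_nonempty _ ho ⟨x - x₀, by simpa using h₀⟩
    refine (hopen.measure_pos volume hne).trans_le (measure_mono ?_)
    rintro s ⟨hs1, hs2⟩
    have hs2 : s ≠ 0 := hs2
    refine (intervalIntegral.integral_pos pi_pos (hcD s hs2).continuousOn (fun t ht =>
      mul_nonneg (hDc s hs2 t ⟨ht.1.le, ht.2⟩) (hpos _ t ⟨ht.1.le, ht.2⟩))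
      ⟨y₀, ⟨hy₀.1.le, hy₀.2.le⟩, mul_pos (hD s hs2 _ hy₀) hs1⟩).ne'

end

lemma cylDen_periodic (s t : ℝ) : cylDen (s, t + 2 * π) = cylDen (s, t) := by simp [cylDen]

lemma kerG_periodic (s t : ℝ) : kerG (s, t + 2 * π) = kerG (s, t) := by
  simp [kerG, cylDen_periodic]

lemma kerY_periodic (s t : ℝ) : kerY (s, t + 2 * π) = kerY (s, t) := by
  simp [kerY, cylDen_periodic]

lemma kerG_even (s t : ℝ) : kerG (s, -t) = kerG (s, t) := by simp [kerG, cylDen]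

lemma continuous_cylDen_snd (s : ℝ) : Continuous fun t => cylDen (s, t) := by
  unfold cylDen; fun_prop

lemma continuous_kerG_snd {s : ℝ} (hs : s ≠ 0) : Continuous fun t => kerG (s, t) :=
  (continuous_const (y := log (cosh s))).sub
    ((continuous_cylDen_snd s).log fun t => (cylDen_pos hs t).ne')

lemma continuous_kerY_snd {s : ℝ} (hs : s ≠ 0) : Continuous fun t => kerY (s, t) :=
  Continuous.div (by fun_prop) (continuous_cylDen_snd s) fun t => (cylDen_pos hs t).ne'

lemma kerG_fold_nonneg {y : ℝ} (hy : y ∈ Icc 0 π) (s : ℝ) (hs : s ≠ 0) (t : ℝ)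
    (ht : t ∈ Icc 0 π) : 0 ≤ kerG (s, y - t) - kerG (s, y + t) := by
  simp only [kerG, sub_sub_sub_cancel_left, sub_nonneg]
  refine log_le_log (cylDen_pos hs _) ?_
  simp only [cylDen, cos_sub, cos_add]
  nlinarith [mul_nonneg (sin_nonneg_of_mem_Icc hy) (sin_nonneg_of_mem_Icc ht)]

lemma kerG_fold_pos {y : ℝ} (hy : y ∈ Ioo 0 π) (s : ℝ) (hs : s ≠ 0) (t : ℝ)
    (ht : t ∈ Ioo 0 π) : 0 < kerG (s, y - t) - kerG (s, y + t) := by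
  simp only [kerG, sub_sub_sub_cancel_left, sub_pos]
  refine log_lt_log (cylDen_pos hs _) ?_
  simp only [cylDen, cos_sub, cos_add]
  nlinarith [mul_pos (sin_pos_of_mem_Ioo hy) (sin_pos_of_mem_Ioo ht)]

lemma kerY_fold_pos_zero (s : ℝ) (hs : s ≠ 0) (t : ℝ) (ht : t ∈ Ioo 0 π) :
    0 < kerY (s, 0 - t) - kerY (s, 0 + t) := by
  have h1 := cylDen_pos hs t
  have h2 : cylDen (s, -t) = cylDen (s, t) := by simp [cylDen]
  simp only [kerY, zero_sub, zero_add, h2, sin_neg, neg_neg]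
  have := sin_pos_of_mem_Ioo ht
  rw [← sub_div]
  exact div_pos (by linarith) h1

lemma kerY_fold_neg_pi (s : ℝ) (hs : s ≠ 0) (t : ℝ) (ht : t ∈ Ioo 0 π) :
    0 < -kerY (s, π - t) - -kerY (s, π + t) := by
  have h1 := cylDen_pos hs (π - t)
  have h2 : cylDen (s, π + t) = cylDen (s, π - t) := by
    simp [cylDen, cos_add, cos_sub]
  simp only [kerY, h2, sin_pi_sub, sin_add, sin_pi, cos_pi]
  have := sin_pos_of_mem_Ioo ht
  rw [neg_sub_neg, ← sub_div]
  exact div_pos (by linarith) h1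

section
variable {h : ℝ × ℝ → ℝ}

lemma cylConv_kerG_nonneg (hh : Reg0 h) (ho : ∀ x y, h (x, -y) = -h (x, y))
    (hpos : ∀ x, ∀ y ∈ Icc 0 π, 0 ≤ h (x, y)) (x : ℝ) {y : ℝ} (hy : y ∈ Icc 0 π) :
    0 ≤ cylConv kerG h (x, y) :=
  cylConv_nonneg_of_fold integrable_kerG kerG_periodic (fun _ => continuous_kerG_snd) hh ho hpos x y
    (kerG_fold_nonneg hy)

lemma cylConv_kerG_pos (hh : Reg0 h) (ho : ∀ x y, h (x, -y) = -h (x, y))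
    (hpos : ∀ x, ∀ y ∈ Icc 0 π, 0 ≤ h (x, y)) {x₀ y₀ : ℝ} (hy₀ : y₀ ∈ Ioo 0 π)
    (h₀ : 0 < h (x₀, y₀)) (x : ℝ) {y : ℝ} (hy : y ∈ Ioo 0 π) :
    0 < cylConv kerG h (x, y) :=
  cylConv_pos_of_fold integrable_kerG kerG_periodic (fun _ => continuous_kerG_snd) hh ho hpos x y
    (kerG_fold_pos hy) hy₀ h₀

lemma cylConv_kerY_zero_pos (hh : Reg0 h) (ho : ∀ x y, h (x, -y) = -h (x, y))
    (hpos : ∀ x, ∀ y ∈ Icc 0 π, 0 ≤ h (x, y)) {x₀ y₀ : ℝ} (hy₀ : y₀ ∈ Ioo 0 π)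
    (h₀ : 0 < h (x₀, y₀)) (x : ℝ) : 0 < cylConv kerY h (x, 0) :=
  cylConv_pos_of_fold integrable_kerY kerY_periodic (fun _ => continuous_kerY_snd) hh ho hpos x 0
    kerY_fold_pos_zero hy₀ h₀

lemma cylConv_kerY_pi_neg (hh : Reg0 h) (ho : ∀ x y, h (x, -y) = -h (x, y))
    (hpos : ∀ x, ∀ y ∈ Icc 0 π, 0 ≤ h (x, y)) {x₀ y₀ : ℝ} (hy₀ : y₀ ∈ Ioo 0 π)
    (h₀ : 0 < h (x₀, y₀)) (x : ℝ) : cylConv kerY h (x, π) < 0 := by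
  have := cylConv_pos_of_fold (k := fun q => -kerY q) integrable_kerY.neg
    (fun s t => by simp only [kerY_periodic]) (fun _ hs => (continuous_kerY_snd hs).neg) hh ho hpos
    x π kerY_fold_neg_pi hy₀ h₀
  have e : cylConv (fun q => -kerY q) h (x, π) = -cylConv kerY h (x, π) := by
    simp only [cylConv, neg_mul, integral_neg, mul_neg]
  linarith

end

lemma hasDerivAt_cylConv_fst {k h g : ℝ × ℝ → ℝ} (hk : Integrable k cylMeasure) (hh : Reg0 h)
    (hg : Reg0 g) (hd : ∀ x y, HasDerivAt (fun s => h (s, y)) (g (x, y)) x) (x y : ℝ) :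
    HasDerivAt (fun s => cylConv k h (s, y)) (cylConv k g (x, y)) x := by
  obtain ⟨M, hM⟩ := hg.bdd
  have hc := hh.cont
  have hc' := hg.cont
  refine HasDerivAt.const_mul _ (hasDerivAt_integral_of_dominated_loc_of_deriv_le (μ := cylMeasure)
    (F := fun s q => k q * h ((s, y) - q)) (F' := fun s q => k q * g ((s, y) - q))
    (bound := fun q => |k q| * M) (s := univ) univ_mem
    (Eventually.of_forall fun s => hk.1.mul (by fun_prop)) (hh.integrable hk _)
    (hk.1.mul (by fun_prop)) (ae_of_all _ fun q s _ => ?_) (hk.abs.mul_const M)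
    (ae_of_all _ fun q s _ => ?_)).2
  · rw [norm_mul, norm_eq_abs, norm_eq_abs]
    exact mul_le_mul_of_nonneg_left (hM _) (abs_nonneg _)
  · exact ((hd (s - q.1) (y - q.2)).comp_sub_const s q.1).const_mul _

lemma hasDerivAt_cylConv_snd {k h g : ℝ × ℝ → ℝ} (hk : Integrable k cylMeasure) (hh : Reg0 h)
    (hg : Reg0 g) (hd : ∀ x y, HasDerivAt (fun t => h (x, t)) (g (x, y)) y) (x y : ℝ) :
    HasDerivAt (fun t => cylConv k h (x, t)) (cylConv k g (x, y)) y := by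
  obtain ⟨M, hM⟩ := hg.bdd
  have hc := hh.cont
  have hc' := hg.cont
  refine HasDerivAt.const_mul _ (hasDerivAt_integral_of_dominated_loc_of_deriv_le (μ := cylMeasure)
    (F := fun t q => k q * h ((x, t) - q)) (F' := fun t q => k q * g ((x, t) - q))
    (bound := fun q => |k q| * M) (s := univ) univ_mem
    (Eventually.of_forall fun s => hk.1.mul (by fun_prop)) (hh.integrable hk _)
    (hk.1.mul (by fun_prop)) (ae_of_all _ fun q t _ => ?_) (hk.abs.mul_const M)
    (ae_of_all _ fun q t _ => ?_)).2
  · rw [norm_mul, norm_eq_abs, norm_eq_abs]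
    exact mul_le_mul_of_nonneg_left (hM _) (abs_nonneg _)
  · exact ((hd (x - q.1) (t - q.2)).comp_sub_const t q.2).const_mul _

lemma cylConv_kerG_fst {h g : ℝ × ℝ → ℝ} (hh : Reg0 h)
    (hg : Reg0 g) (hd : ∀ x y, HasDerivAt (fun s => h (s, y)) (g (x, y)) x) (p : ℝ × ℝ) :
    cylConv kerG g p = cylConv kerX h p := by
  obtain ⟨x, y⟩ := p
  have i1 := hg.integrable integrable_kerG (x, y)
  have i2 := hh.integrable integrable_kerX (x, y)
  have i3 := hh.integrable integrable_kerG (x, y)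
  unfold cylConv cylMeasure
  rw [integral_prod_symm _ i1, integral_prod_symm _ i2]
  congr 1
  apply integral_congr_ae
  filter_upwards [i1.prod_left_ae, i2.prod_left_ae, i3.prod_left_ae, ae_sin_half] with t h1 h2 h3 ht
  have := integral_mul_deriv_eq_deriv_mul_of_integrable (u := fun s => kerG (s, t))
    (u' := fun s => kerX (s, t)) (v := fun s => h (x - s, y - t)) (v' := fun s => -g (x - s, y - t))
    (fun s _ => hasDerivAt_kerG_fst (cylDen_pos' s ht))
    (fun s _ => by simpa using (hd (x - s) (y - t)).comp_const_sub x s)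
    (h1.neg.congr (ae_of_all _ fun s => by simp)) h2 h3
  simp only [mul_neg, integral_neg, neg_inj] at this
  exact this

lemma cylConv_kerG_snd {h g : ℝ × ℝ → ℝ} (hh : Reg0 h)
    (hg : Reg0 g) (hd : ∀ x y, HasDerivAt (fun t => h (x, t)) (g (x, y)) y) (p : ℝ × ℝ) :
    cylConv kerG g p = cylConv kerY h p := by
  obtain ⟨x, y⟩ := p
  rw [cylConv_eq integrable_kerG hg, cylConv_eq integrable_kerY hh]
  congr 1
  apply integral_congr_ae
  have h0 : ∀ᵐ s : ℝ, s ≠ 0 := by simp [ae_iff]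
  filter_upwards [h0] with s hs
  have hc := hg.cont
  have := intervalIntegral.integral_mul_deriv_eq_deriv_mul (a := -π) (b := π)
    (u := fun t => kerG (s, t)) (u' := fun t => kerY (s, t)) (v := fun t => h (x - s, y - t))
    (v' := fun t => -g (x - s, y - t))
    (fun t _ => hasDerivAt_kerG_snd (cylDen_pos hs t))
    (fun t _ => by simpa using (hd (x - s) (y - t)).comp_const_sub y t)
    ((continuous_kerY_snd hs).intervalIntegrable _ _)
    (by apply Continuous.intervalIntegrable; fun_prop)
  have e : h (x - s, y - -π) = h (x - s, y - π) := by
    rw [← hh.per (x - s) (y - π)]; congr 2; ring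
  rw [kerG_even, e, sub_self, zero_sub] at this
  simp only [mul_neg, intervalIntegral.integral_neg, neg_inj] at this
  exact this

lemma hasDerivAt_steklov {φ : ℝ → ℝ} (hφ : Continuous φ) {ε : ℝ} (hε : ε ≠ 0) (x : ℝ) :
    HasDerivAt (fun x => ∫ a in (0)..1, φ (x + ε * a)) (ε⁻¹ * (φ (x + ε) - φ x)) x := by
  have e : (fun x => ∫ a in (0)..1, φ (x + ε * a)) =
      fun x => ε⁻¹ * ((∫ s in (0)..(x + ε), φ s) - ∫ s in (0)..x, φ s) := by
    ext x
    rw [intervalIntegral.integral_comp_add_mul _ hε, mul_zero, mul_one, add_zero,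
      intervalIntegral.integral_interval_sub_left (hφ.intervalIntegrable _ _)
      (hφ.intervalIntegrable _ _), smul_eq_mul]
  rw [e]
  have h1 := (hφ.integral_hasStrictDerivAt 0 (x + ε)).hasDerivAt.comp_add_const x ε
  have h2 := (hφ.integral_hasStrictDerivAt 0 x).hasDerivAt
  exact (h1.sub h2).const_mul _

lemma hasDerivAt_of_tendsto_bounded {F G : ℕ → ℝ → ℝ} {f g : ℝ → ℝ} {M : ℝ}
    (hF : ∀ n x, HasDerivAt (F n) (G n x) x) (hG : ∀ n, Continuous (G n))
    (hM : ∀ n x, |G n x| ≤ M) (hf : ∀ x, Tendsto (fun n => F n x) atTop (𝓝 (f x)))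
    (hg : ∀ x, Tendsto (fun n => G n x) atTop (𝓝 (g x))) (hgc : Continuous g) (x : ℝ) :
    HasDerivAt f (g x) x := by
  have e : ∀ y, f y = f 0 + ∫ s in (0)..y, g s := by
    intro y
    have h1 : ∀ n, F n y = F n 0 + ∫ s in (0)..y, G n s := fun n => by
      rw [intervalIntegral.integral_eq_sub_of_hasDerivAt (fun s _ => hF n s)
        ((hG n).intervalIntegrable _ _)]
      ring
    have h2 : Tendsto (fun n => ∫ s in (0)..y, G n s) atTop (𝓝 (∫ s in (0)..y, g s)) :=
      intervalIntegral.tendsto_integral_filter_of_dominated_convergence (fun _ => M)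
        (Eventually.of_forall fun n => (hG n).aestronglyMeasurable)
        (Eventually.of_forall fun n => ae_of_all _ fun s _ => hM n s) (by simp)
        (ae_of_all _ fun s _ => hg s)
    refine tendsto_nhds_unique (hf y) ?_
    simp only [h1 _]
    exact (hf 0).add h2
  rw [funext e]
  exact (hgc.integral_hasStrictDerivAt 0 x).hasDerivAt.const_add _

/-- Averages of `h` over segments in the direction `v`. -/
noncomputable def segAvg (h : ℝ × ℝ → ℝ) (v : ℝ × ℝ) (n : ℕ) (p : ℝ × ℝ) : ℝ :=
  ∫ a in (0)..1, h (p + (((n : ℝ) + 1)⁻¹ * a) • v)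

section
variable {h : ℝ × ℝ → ℝ}

lemma Reg0.segAvg (hh : Reg0 h) (v : ℝ × ℝ) (n : ℕ) : Reg0 (segAvg h v n) := by
  have hc := hh.cont
  refine ⟨?_, ?_, fun x y => ?_⟩
  · unfold _root_.segAvg
    apply intervalIntegral.continuous_parametric_intervalIntegral_of_continuous'
    fun_prop
  · obtain ⟨M, hM⟩ := hh.bdd
    refine ⟨M, fun p => ?_⟩
    have := intervalIntegral.norm_integral_le_of_norm_le_const (a := 0) (b := 1)
      (f := fun a => h (p + (((n : ℝ) + 1)⁻¹ * a) • v)) (C := M) (fun a _ => hM _)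
    simpa [_root_.segAvg] using this
  · unfold _root_.segAvg
    congr 1 with a
    simp only [Prod.smul_def, Prod.mk_add_mk]
    rw [← hh.per _ (y + _)]
    congr 2; ring

lemma abs_segAvg_le {M : ℝ} (hM : ∀ p, |h p| ≤ M) (v : ℝ × ℝ) (n : ℕ) (p : ℝ × ℝ) :
    |segAvg h v n p| ≤ M := by
  have := intervalIntegral.norm_integral_le_of_norm_le_const (a := 0) (b := 1)
    (f := fun a => h (p + (((n : ℝ) + 1)⁻¹ * a) • v)) (C := M) (fun a _ => hM _)
  simpa [segAvg] using this

lemma tendsto_segAvg (hh : Reg0 h) (v p : ℝ × ℝ) :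
    Tendsto (fun n => segAvg h v n p) atTop (𝓝 (h p)) := by
  have hc := hh.cont
  have c : Continuous fun ε : ℝ => ∫ a in (0)..1, h (p + (ε * a) • v) := by
    apply intervalIntegral.continuous_parametric_intervalIntegral_of_continuous'
    fun_prop
  have l : Tendsto (fun n : ℕ => ((n : ℝ) + 1)⁻¹) atTop (𝓝 0) := by
    simpa [one_div] using tendsto_one_div_add_atTop_nhds_zero_nat (𝕜 := ℝ)
  have := (c.tendsto 0).comp l
  simpa [segAvg, Function.comp_def] using this

lemma hasDerivAt_segAvg_fst (hh : Reg0 h) (n : ℕ) (x y : ℝ) :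
    HasDerivAt (fun s => segAvg h (1, 0) n (s, y))
      (((n : ℝ) + 1)⁻¹⁻¹ * (h (x + ((n : ℝ) + 1)⁻¹, y) - h (x, y))) x := by
  have hc := hh.cont
  have := hasDerivAt_steklov (φ := fun s => h (s, y)) (by fun_prop)
    (ε := ((n : ℝ) + 1)⁻¹) (by positivity) x
  simpa [segAvg, Prod.smul_def] using this

lemma hasDerivAt_segAvg_snd (hh : Reg0 h) (n : ℕ) (x y : ℝ) :
    HasDerivAt (fun t => segAvg h (0, 1) n (x, t))
      (((n : ℝ) + 1)⁻¹⁻¹ * (h (x, y + ((n : ℝ) + 1)⁻¹) - h (x, y))) y := by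
  have hc := hh.cont
  have := hasDerivAt_steklov (φ := fun t => h (x, t)) (by fun_prop)
    (ε := ((n : ℝ) + 1)⁻¹) (by positivity) y
  simpa [segAvg, Prod.smul_def] using this

lemma Reg0.sub_shift (hh : Reg0 h) (v : ℝ × ℝ) (c : ℝ) : Reg0 fun p => c * (h (p + v) - h p) := by
  have hc := hh.cont
  obtain ⟨M, hM⟩ := hh.bdd
  refine ⟨by fun_prop, ⟨|c| * (M + M), fun p => ?_⟩, fun x y => ?_⟩
  · rw [abs_mul]
    exact mul_le_mul_of_nonneg_left ((abs_sub _ _).trans (add_le_add (hM _) (hM _))) (abs_nonneg _)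
  · have : h ((x, y + 2 * π) + v) = h ((x, y) + v) := by
      simp only [Prod.add_def]
      rw [← hh.per _ (y + _)]
      congr 2; ring
    rw [this, hh.per]

theorem partials_cylConv_kerG (hh : Reg0 h) :
    Partials (cylConv kerG h) (cylConv kerX h) (cylConv kerY h) := by
  obtain ⟨M, hM⟩ := hh.bdd
  refine fun x y => ⟨?_, ?_⟩
  · have hr := fun n => hh.segAvg (1, 0) n
    have hs := fun n : ℕ => hh.sub_shift (((n : ℝ) + 1)⁻¹, 0) ((n : ℝ) + 1)⁻¹⁻¹
    have hd := fun (n : ℕ) (x y : ℝ) => (hasDerivAt_segAvg_fst hh n x y).congr_deriv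
      (show _ = (fun p : ℝ × ℝ => ((n : ℝ) + 1)⁻¹⁻¹ * (h (p + (((n : ℝ) + 1)⁻¹, 0)) - h p)) (x, y)
        by simp)
    refine hasDerivAt_of_tendsto_bounded (F := fun n s => cylConv kerG (segAvg h (1, 0) n) (s, y))
      (G := fun n s => cylConv kerX (segAvg h (1, 0) n) (s, y)) (M := kerNorm kerX * M)
      (g := fun s => cylConv kerX h (s, y))
      (fun n s => ?_) (fun n => ?_) (fun n s => ?_) (fun s => ?_) (fun s => ?_) ?_ x
    · rw [← cylConv_kerG_fst (hr n) (hs n) (hd n)]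
      exact hasDerivAt_cylConv_fst integrable_kerG (hr n) (hs n) (hd n) s y
    · have := ((hr n).cylConv integrable_kerX).cont
      fun_prop
    · exact abs_cylConv_le integrable_kerX (abs_segAvg_le hM _ n) _
    · exact tendsto_cylConv integrable_kerG (fun n => (hr n).cont) (abs_segAvg_le hM _)
        fun q => tendsto_segAvg hh _ _
    · exact tendsto_cylConv integrable_kerX (fun n => (hr n).cont) (abs_segAvg_le hM _)
        fun q => tendsto_segAvg hh _ _
    · have := (hh.cylConv integrable_kerX).cont
      fun_prop
  · have hr := fun n => hh.segAvg (0, 1) n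
    have hs := fun n : ℕ => hh.sub_shift (0, ((n : ℝ) + 1)⁻¹) ((n : ℝ) + 1)⁻¹⁻¹
    have hd := fun (n : ℕ) (x y : ℝ) => (hasDerivAt_segAvg_snd hh n x y).congr_deriv
      (show _ = (fun p : ℝ × ℝ => ((n : ℝ) + 1)⁻¹⁻¹ * (h (p + (0, ((n : ℝ) + 1)⁻¹)) - h p)) (x, y)
        by simp)
    refine hasDerivAt_of_tendsto_bounded (F := fun n s => cylConv kerG (segAvg h (0, 1) n) (x, s))
      (G := fun n s => cylConv kerY (segAvg h (0, 1) n) (x, s)) (M := kerNorm kerY * M)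
      (g := fun s => cylConv kerY h (x, s))
      (fun n s => ?_) (fun n => ?_) (fun n s => ?_) (fun s => ?_) (fun s => ?_) ?_ y
    · rw [← cylConv_kerG_snd (hr n) (hs n) (hd n)]
      exact hasDerivAt_cylConv_snd integrable_kerG (hr n) (hs n) (hd n) x s
    · have := ((hr n).cylConv integrable_kerY).cont
      fun_prop
    · exact abs_cylConv_le integrable_kerY (abs_segAvg_le hM _ n) _
    · exact tendsto_cylConv integrable_kerG (fun n => (hr n).cont) (abs_segAvg_le hM _)
        fun q => tendsto_segAvg hh _ _
    · exact tendsto_cylConv integrable_kerY (fun n => (hr n).cont) (abs_segAvg_le hM _)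
        fun q => tendsto_segAvg hh _ _
    · have := (hh.cylConv integrable_kerY).cont
      fun_prop

end

/-- `n` times differentiable in the sense of iterated partial derivatives in `Reg0`. -/
def Reg : ℕ → (ℝ × ℝ → ℝ) → Prop
  | 0, h => Reg0 h
  | n + 1, h => Reg0 h ∧ ∃ h₁ h₂, Reg n h₁ ∧ Reg n h₂ ∧ Partials h h₁ h₂

lemma Reg.reg0 {n : ℕ} {h : ℝ × ℝ → ℝ} (hh : Reg n h) : Reg0 h := by
  cases n with
  | zero => exact hh
  | succ n => exact hh.1

lemma Reg.of_succ {n : ℕ} {h : ℝ × ℝ → ℝ} (hh : Reg (n + 1) h) : Reg n h := by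
  induction n generalizing h with
  | zero => exact hh.1
  | succ n ih =>
    obtain ⟨h0, h1, h2, r1, r2, hp⟩ := hh
    exact ⟨h0, h1, h2, ih r1, ih r2, hp⟩

lemma Reg0.const (c : ℝ) : Reg0 fun _ => c :=
  ⟨continuous_const, ⟨|c|, fun _ => le_rfl⟩, fun _ _ => rfl⟩

lemma Reg0.add {h g : ℝ × ℝ → ℝ} (hh : Reg0 h) (hg : Reg0 g) : Reg0 fun p => h p + g p := by
  obtain ⟨M, hM⟩ := hh.bdd
  obtain ⟨N, hN⟩ := hg.bdd
  refine ⟨hh.cont.add hg.cont, ⟨M + N, fun p => (abs_add_le _ _).trans (add_le_add (hM p) (hN p))⟩,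
    fun x y => by rw [hh.per, hg.per]⟩

lemma Reg0.mul {h g : ℝ × ℝ → ℝ} (hh : Reg0 h) (hg : Reg0 g) : Reg0 fun p => h p * g p := by
  obtain ⟨M, hM⟩ := hh.bdd
  obtain ⟨N, hN⟩ := hg.bdd
  refine ⟨hh.cont.mul hg.cont, ⟨M * N, fun p => ?_⟩, fun x y => by rw [hh.per, hg.per]⟩
  rw [abs_mul]
  exact mul_le_mul (hM p) (hN p) (abs_nonneg _) ((abs_nonneg _).trans (hM p))

lemma Reg0.neg {h : ℝ × ℝ → ℝ} (hh : Reg0 h) : Reg0 fun p => -h p := by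
  simpa using (Reg0.const (-1)).mul hh

lemma Reg0.sub {h g : ℝ × ℝ → ℝ} (hh : Reg0 h) (hg : Reg0 g) : Reg0 fun p => h p - g p := by
  simpa [sub_eq_add_neg] using hh.add hg.neg

lemma Reg0.comp {h : ℝ × ℝ → ℝ} (hh : Reg0 h) {φ : ℝ → ℝ} (hφ : Continuous φ) :
    Reg0 fun p => φ (h p) := by
  obtain ⟨M, hM⟩ := hh.bdd
  obtain ⟨C, hC⟩ := (isCompact_Icc (a := -M) (b := M)).exists_bound_of_continuousOn hφ.continuousOn
  exact ⟨hφ.comp hh.cont, ⟨C, fun p => hC _ (abs_le.1 (hM p))⟩, fun x y => by rw [hh.per]⟩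

lemma Reg.add {n : ℕ} {h g : ℝ × ℝ → ℝ} (hh : Reg n h) (hg : Reg n g) :
    Reg n fun p => h p + g p := by
  induction n generalizing h g with
  | zero => exact Reg0.add hh hg
  | succ n ih =>
    obtain ⟨h0, h1, h2, r1, r2, hp⟩ := hh
    obtain ⟨g0, g1, g2, s1, s2, gp⟩ := hg
    exact ⟨h0.add g0, _, _, ih r1 s1, ih r2 s2, fun x y =>
      ⟨(hp x y).1.add (gp x y).1, (hp x y).2.add (gp x y).2⟩⟩

lemma Reg.mul {n : ℕ} {h g : ℝ × ℝ → ℝ} (hh : Reg n h) (hg : Reg n g) :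
    Reg n fun p => h p * g p := by
  induction n generalizing h g with
  | zero => exact Reg0.mul hh hg
  | succ n ih =>
    have hh' := hh.of_succ
    have hg' := hg.of_succ
    obtain ⟨h0, h1, h2, r1, r2, hp⟩ := hh
    obtain ⟨g0, g1, g2, s1, s2, gp⟩ := hg
    exact ⟨h0.mul g0, _, _, (ih r1 hg').add (ih hh' s1), (ih r2 hg').add (ih hh' s2), fun x y =>
      ⟨(hp x y).1.mul (gp x y).1, (hp x y).2.mul (gp x y).2⟩⟩

lemma Reg.comp {n : ℕ} {h : ℝ × ℝ → ℝ} (hh : Reg n h) {φ : ℝ → ℝ}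
    (hφ : ContDiff ℝ (⊤ : ℕ∞) φ) : Reg n fun p => φ (h p) := by
  induction n generalizing h φ with
  | zero => exact Reg0.comp hh hφ.continuous
  | succ n ih =>
    have hh' := hh.of_succ
    obtain ⟨h0, h1, h2, r1, r2, hp⟩ := hh
    have hd : ContDiff ℝ (⊤ : ℕ∞) (deriv φ) := (contDiff_infty_iff_deriv.1 hφ).2
    have hd' := (contDiff_infty_iff_deriv.1 hφ).1
    exact ⟨h0.comp hφ.continuous, _, _, (ih hh' hd).mul r1, (ih hh' hd).mul r2, fun x y =>
      ⟨(hd' _).hasDerivAt.comp x (hp x y).1, (hd' _).hasDerivAt.comp y (hp x y).2⟩⟩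

lemma Reg.cylConv {n : ℕ} {k h : ℝ × ℝ → ℝ} (hk : Integrable k cylMeasure) (hh : Reg n h) :
    Reg n (cylConv k h) := by
  induction n generalizing h with
  | zero => exact Reg0.cylConv hh hk
  | succ n ih =>
    obtain ⟨h0, h1, h2, r1, r2, hp⟩ := hh
    exact ⟨h0.cylConv hk, _, _, ih r1, ih r2, fun x y =>
      ⟨hasDerivAt_cylConv_fst hk h0 r1.reg0 (fun x y => (hp x y).1) x y,
        hasDerivAt_cylConv_snd hk h0 r2.reg0 (fun x y => (hp x y).2) x y⟩⟩

lemma Reg.cylConv_kerG {n : ℕ} {h : ℝ × ℝ → ℝ} (hh : Reg n h) :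
    Reg (n + 1) (_root_.cylConv kerG h) :=
  ⟨hh.reg0.cylConv integrable_kerG, _, _, hh.cylConv integrable_kerX, hh.cylConv integrable_kerY,
    partials_cylConv_kerG hh.reg0⟩

lemma Partials.hasFDerivAt {h h₁ h₂ : ℝ × ℝ → ℝ} (hp : Partials h h₁ h₂)
    (c1 : Continuous h₁) (c2 : Continuous h₂) (p : ℝ × ℝ) :
    HasFDerivAt h (h₁ p • ContinuousLinearMap.fst ℝ ℝ ℝ +
      h₂ p • ContinuousLinearMap.snd ℝ ℝ ℝ) p := by
  have := hasStrictFDerivAt_uncurry_coprod (𝕜 := ℝ) (u := p) (f := fun x y => h (x, y))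
    (f₁ := fun x y => ContinuousLinearMap.toSpanSingleton ℝ (h₁ (x, y)))
    (f₂ := fun x y => ContinuousLinearMap.toSpanSingleton ℝ (h₂ (x, y)))
    (Eventually.of_forall fun v => (hp v.1 v.2).1.hasFDerivAt)
    (Eventually.of_forall fun v => (hp v.1 v.2).2.hasFDerivAt)
    ((ContinuousLinearMap.toSpanSingletonCLE (𝕜 := ℝ) (E := ℝ)).continuous.comp c1).continuousAt
    ((ContinuousLinearMap.toSpanSingletonCLE (𝕜 := ℝ) (E := ℝ)).continuous.comp c2).continuousAt
  refine this.hasFDerivAt.congr_fderiv ?_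
  ext <;> simp [Function.HasUncurry.uncurry]

lemma Reg.contDiff {n : ℕ} {h : ℝ × ℝ → ℝ} (hh : Reg n h) : ContDiff ℝ n h := by
  induction n generalizing h with
  | zero => exact contDiff_zero.2 (Reg.reg0 hh).cont
  | succ n ih =>
    obtain ⟨h0, h1, h2, r1, r2, hp⟩ := hh
    have : ((n + 1 : ℕ) : WithTop ℕ∞) = (n : WithTop ℕ∞) + 1 := by norm_cast
    rw [this, contDiff_succ_iff_hasFDerivAt]
    exact ⟨_, ((ih r1).smul contDiff_const).add ((ih r2).smul contDiff_const),
      hp.hasFDerivAt r1.reg0.cont r2.reg0.cont⟩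

lemma hasDerivAt_intervalIntegral_param {F F' : ℝ → ℝ → ℝ} {a b s₀ r : ℝ} (hr : 0 < r)
    (hF : ∀ s ∈ Metric.closedBall s₀ r, Continuous (F s))
    (hF' : ContinuousOn (fun q : ℝ × ℝ => F' q.1 q.2) (Metric.closedBall s₀ r ×ˢ univ))
    (hd : ∀ s ∈ Metric.closedBall s₀ r, ∀ t, HasDerivAt (fun s => F s t) (F' s t) s) :
    HasDerivAt (fun s => ∫ t in a..b, F s t) (∫ t in a..b, F' s₀ t) s₀ := by
  obtain ⟨C, hC⟩ := ((isCompact_closedBall s₀ r).prod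
    (isCompact_uIcc (a := a) (b := b))).exists_bound_of_continuousOn
    (hF'.mono (prod_mono_right (subset_univ _)))
  have h0 : s₀ ∈ Metric.closedBall s₀ r := Metric.mem_closedBall_self hr.le
  have hc : Continuous (F' s₀) := by
    have := hF'.comp_continuous (f := fun t => (s₀, t)) (by fun_prop) fun t => ⟨h0, mem_univ _⟩
    exact this
  refine (intervalIntegral.hasDerivAt_integral_of_dominated_loc_of_deriv_le
    (bound := fun _ => C) (Metric.closedBall_mem_nhds s₀ hr) ?_
    ((hF s₀ h0).intervalIntegrable _ _) hc.aestronglyMeasurable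
    (ae_of_all _ fun t ht s hs => hC (s, t) ⟨hs, uIoc_subset_uIcc ht⟩) (by simp)
    (ae_of_all _ fun t _ s hs => hd s hs t)).2
  filter_upwards [Metric.closedBall_mem_nhds s₀ hr] with s hs
  exact (hF s hs).aestronglyMeasurable

lemma Partials.lipschitz {h h₁ h₂ : ℝ × ℝ → ℝ} (hp : Partials h h₁ h₂) {L : ℝ}
    (h1 : ∀ p, |h₁ p| ≤ L) (h2 : ∀ p, |h₂ p| ≤ L) (x y x' y' : ℝ) :
    |h (x, y) - h (x', y')| ≤ L * (|x - x'| + |y - y'|) := by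
  have e1 : |h (x, y) - h (x', y)| ≤ L * |x - x'| :=
    convex_univ.norm_image_sub_le_of_norm_hasDerivWithin_le
      (fun s _ => (hp s y).1.hasDerivWithinAt) (fun s _ => h1 (s, y)) (mem_univ x') (mem_univ x)
  have e2 : |h (x', y) - h (x', y')| ≤ L * |y - y'| :=
    convex_univ.norm_image_sub_le_of_norm_hasDerivWithin_le
      (fun s _ => (hp x' s).2.hasDerivWithinAt) (fun s _ => h2 (x', s)) (mem_univ y') (mem_univ y)
  calc _ = |(h (x, y) - h (x', y)) + (h (x', y) - h (x', y'))| := by ring_nf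
    _ ≤ _ := (abs_add_le _ _).trans (by linarith)

/-- The Poisson-type kernel `sinh s / (cosh s - cos t)`. -/
noncomputable def kerS (q : ℝ × ℝ) : ℝ := sinh q.1 / cylDen q

lemma kerX_eq {s : ℝ} (hs : s ≠ 0) (t : ℝ) : kerX (s, t) = tanh s - kerS (s, t) := by
  have h1 := (cylDen_pos hs t).ne'
  have h2 := (cosh_pos s).ne'
  simp only [kerX, kerS, tanh_eq_sinh_div_cosh]
  rw [div_sub_div _ _ h2 h1]
  congr 1
  simp only [cylDen]; ring

lemma continuous_kerS_snd {s : ℝ} (hs : s ≠ 0) : Continuous fun t => kerS (s, t) :=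
  Continuous.div (by fun_prop) (continuous_cylDen_snd s) fun t => (cylDen_pos hs t).ne'

lemma continuous_kerX_snd {s : ℝ} (hs : s ≠ 0) : Continuous fun t => kerX (s, t) := by
  simp only [kerX_eq hs]
  exact continuous_const.sub (continuous_kerS_snd hs)

lemma integral_kerS {s : ℝ} (hs : 0 < s) : ∫ t in (-π)..π, kerS (s, t) = 2 * π := by
  have hr0 := exp_pos (-s)
  have hr1 : exp (-s) < 1 := exp_lt_one_iff.2 (by linarith)
  set r := exp (-s) with hr
  have hpos : ∀ t, 0 < 1 - r * cos t := fun t => by nlinarith [cos_le_one t]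
  have hd : ∀ t, HasDerivAt (fun t => t + 2 * arctan (r * sin t / (1 - r * cos t)))
      (kerS (s, t)) t := fun t => by
    have h1 : HasDerivAt (fun t => r * sin t / (1 - r * cos t))
        ((r * cos t * (1 - r * cos t) - r * sin t * (r * sin t)) / (1 - r * cos t) ^ 2) t := by
      have := ((hasDerivAt_sin t).const_mul r).div (((hasDerivAt_cos t).const_mul r).const_sub 1)
        (hpos t).ne'
      refine this.congr_deriv ?_
      congr 1; ring
    refine ((hasDerivAt_id t).add (h1.arctan.const_mul 2)).congr_deriv ?_
    have hden := cylDen_pos hs.ne' t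
    have e1 : sinh s = (1 - r ^ 2) / (2 * r) := by
      rw [sinh_eq, ← hr]
      have : exp s = r⁻¹ := by rw [hr, exp_neg, inv_inv]
      rw [this]; field_simp
    have e2 : cylDen (s, t) = (1 - 2 * r * cos t + r ^ 2) / (2 * r) := by
      simp only [cylDen]
      rw [cosh_eq, ← hr]
      have : exp s = r⁻¹ := by rw [hr, exp_neg, inv_inv]
      rw [this]; field_simp; ring
    have hD : 0 < 1 - 2 * r * cos t + r ^ 2 := by
      rw [e2, div_pos_iff_of_pos_right (by positivity)] at hden; exact hden
    have hp := hpos t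
    have e3 : 1 + (r * sin t / (1 - r * cos t)) ^ 2 =
        (1 - 2 * r * cos t + r ^ 2) / (1 - r * cos t) ^ 2 := by
      rw [div_pow]
      field_simp
      nlinarith [sin_sq_add_cos_sq t]
    simp only [kerS]
    rw [e1, e2, e3]
    field_simp
    nlinarith [sin_sq_add_cos_sq t]
  rw [intervalIntegral.integral_eq_sub_of_hasDerivAt (fun t _ => hd t)
    ((continuous_kerS_snd hs.ne').intervalIntegrable _ _)]
  simp; ring

lemma kerS_mul_le {s t : ℝ} (hs : s ∈ Ioc 0 1) (ht : t ∈ Icc (-π) π) :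
    kerS (s, t) * (|s| + |t|) ≤ cosh 1 * (2 + π) := by
  have hs0 : 0 < s := hs.1
  have hA : s ≤ 2 * sinh (s / 2) := by
    have := self_le_sinh_iff.2 (by linarith : 0 ≤ s / 2)
    linarith
  have hB : |t| ≤ π * |sin (t / 2)| := by
    have h1 : 2 / π * (|t| / 2) ≤ sin (|t| / 2) :=
      mul_le_sin (by positivity) (by have := abs_le.2 ht; linarith)
    have h2 : sin (|t| / 2) ≤ |sin (t / 2)| := by
      rcases abs_cases t with ⟨h, _⟩ | ⟨h, _⟩ <;> rw [h]
      · exact le_abs_self _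
      · rw [neg_div, sin_neg]; exact neg_le_abs _
    have h3 : 2 / π * (|t| / 2) = |t| / π := by ring
    rw [h3, div_le_iff₀ pi_pos] at h1
    nlinarith [pi_pos]
  have hsh : sinh s ≤ 2 * sinh (s / 2) * cosh 1 := by
    have h := abs_sinh_le_mul_cosh s
    have hp : 0 < sinh (s / 2) := by linarith
    rw [abs_of_pos (sinh_pos_iff.2 hs0), abs_of_pos hp] at h
    have : cosh s ≤ cosh 1 := by
      rw [cosh_le_cosh, abs_of_pos hs0, abs_one]; exact hs.2
    nlinarith
  have hden := cylDen_pos hs0.ne' t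
  simp only [kerS]
  rw [div_mul_eq_mul_div, div_le_iff₀ hden, abs_of_pos hs0]
  have hp : 0 < sinh (s / 2) := by linarith
  have hst : s + |t| ≤ 2 * sinh (s / 2) + π * |sin (t / 2)| := by linarith
  have h1 : sinh s * (s + |t|) ≤
      (2 * sinh (s / 2) * cosh 1) * (2 * sinh (s / 2) + π * |sin (t / 2)|) := by
    apply mul_le_mul hsh hst (by positivity)
    have := cosh_pos 1
    positivity
  refine h1.trans ?_
  rw [cylDen_eq, ← sq_abs (sin (t / 2))]
  have h2 : sinh (s / 2) * (2 * sinh (s / 2) + π * |sin (t / 2)|) ≤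
      (2 + π) * (sinh (s / 2) ^ 2 + |sin (t / 2)| ^ 2) := by
    nlinarith [sq_nonneg (sinh (s / 2) - |sin (t / 2)|), pi_pos, sq_nonneg (sin (t / 2)),
      mul_nonneg pi_pos.le (sq_nonneg (sinh (s / 2) - |sin (t / 2)|)), sq_nonneg (|sin (t / 2)|),
      mul_nonneg pi_pos.le (sq_nonneg (sinh (s / 2))),
      mul_nonneg pi_pos.le (sq_nonneg (|sin (t / 2)|))]
  nlinarith [cosh_pos 1]

section
variable {φ φ₁ φ₂ : ℝ × ℝ → ℝ}

lemma tendsto_integral_kerS (hφ : Reg0 φ) (hφ₁ : Reg0 φ₁) (hφ₂ : Reg0 φ₂)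
    (hp : Partials φ φ₁ φ₂) :
    Tendsto (fun s => ∫ t in (-π)..π, kerS (s, t) * φ (s, t)) (𝓝[>] 0) (𝓝 (2 * π * φ (0, 0))) := by
  obtain ⟨L, hL0, h1, h2⟩ : ∃ L, 0 ≤ L ∧ (∀ p, |φ₁ p| ≤ L) ∧ ∀ p, |φ₂ p| ≤ L := by
    obtain ⟨L, hL⟩ := hφ₁.bdd
    obtain ⟨L', hL'⟩ := hφ₂.bdd
    exact ⟨max L L', le_max_of_le_left ((abs_nonneg _).trans (hL 0)),
      fun p => (hL p).trans (le_max_left _ _), fun p => (hL' p).trans (le_max_right _ _)⟩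
  have hc := hφ.cont
  have key : Tendsto (fun s => ∫ t in (-π)..π, kerS (s, t) * (φ (s, t) - φ (0, 0))) (𝓝[>] 0)
      (𝓝 (∫ t in (-π)..π, (0 : ℝ))) := by
    refine intervalIntegral.tendsto_integral_filter_of_dominated_convergence
      (fun _ => L * (cosh 1 * (2 + π))) ?_ ?_ (by simp) ?_
    · filter_upwards [self_mem_nhdsWithin] with s hs
      have := continuous_kerS_snd (ne_of_gt hs)
      exact (this.mul (by fun_prop)).aestronglyMeasurable
    · filter_upwards [Ioc_mem_nhdsGT one_pos] with s hs
      refine ae_of_all _ fun t ht => ?_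
      rw [uIoc_of_le (by linarith [pi_pos])] at ht
      have hk := kerS_mul_le hs ⟨ht.1.le, ht.2⟩
      have hl := hp.lipschitz h1 h2 s t 0 0
      simp only [sub_zero] at hl
      have hk0 : 0 ≤ kerS (s, t) :=
        div_nonneg (sinh_nonneg_iff.2 hs.1.le) (cylDen_pos hs.1.ne' t).le
      rw [norm_mul, norm_eq_abs, norm_eq_abs, abs_of_nonneg hk0]
      calc kerS (s, t) * |φ (s, t) - φ (0, 0)| ≤ kerS (s, t) * (L * (|s| + |t|)) := by gcongr
        _ = L * (kerS (s, t) * (|s| + |t|)) := by ring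
        _ ≤ _ := by gcongr
    · have h0 : ∀ᵐ t : ℝ, t ≠ 0 := by simp [ae_iff]
      filter_upwards [h0] with t ht htm
      rw [uIoc_of_le (by linarith [pi_pos])] at htm
      have hsin : sin (t / 2) ≠ 0 := by
        rw [ne_eq, sin_eq_zero_iff_of_lt_of_lt (by linarith [htm.1, pi_pos])
          (by linarith [htm.2, pi_pos])]
        simpa using ht
      have hd := (cylDen_pos' 0 hsin).ne'
      have : ContinuousAt (fun s => kerS (s, t) * (φ (s, t) - φ (0, 0))) 0 := by
        have c1 : Continuous fun s => cylDen (s, t) := by unfold cylDen; fun_prop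
        have c2 : Continuous fun s => φ (s, t) - φ (0, 0) := by fun_prop
        exact (continuous_sinh.continuousAt.div c1.continuousAt hd).mul c2.continuousAt
      have h3 := this.tendsto
      simp only [kerS, sinh_zero, zero_div, zero_mul] at h3
      exact h3.mono_left nhdsWithin_le_nhds
  rw [intervalIntegral.integral_zero] at key
  have := key.add_const (2 * π * φ (0, 0))
  rw [zero_add] at this
  refine this.congr' ?_
  filter_upwards [self_mem_nhdsWithin] with s hs
  have hs' : (0 : ℝ) < s := hs
  have ck := continuous_kerS_snd hs'.ne'
  rw [← integral_kerS hs', ← intervalIntegral.integral_mul_const,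
    ← intervalIntegral.integral_add]
  · congr 1 with t; ring
  · exact (ck.mul (by fun_prop)).intervalIntegrable _ _
  · exact (ck.mul_const _).intervalIntegrable _ _

lemma integral_kerX_eq (hφ : Reg0 φ) {s : ℝ} (hs : s ≠ 0)
    (hm : ∫ t in (-π)..π, φ (s, t) = 0) :
    ∫ t in (-π)..π, kerX (s, t) * φ (s, t) = -∫ t in (-π)..π, kerS (s, t) * φ (s, t) := by
  have hc := hφ.cont
  have ck := continuous_kerS_snd hs
  simp only [kerX_eq hs, sub_mul]
  rw [intervalIntegral.integral_sub, intervalIntegral.integral_const_mul, hm, mul_zero, zero_sub]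
  · apply Continuous.intervalIntegrable; fun_prop
  · exact (ck.mul (by fun_prop)).intervalIntegrable _ _

lemma tendsto_integral_kerS_atTop (hφ : Reg0 φ) (hm : ∀ s, ∫ t in (-π)..π, φ (s, t) = 0) :
    Tendsto (fun s => ∫ t in (-π)..π, kerS (s, t) * φ (s, t)) atTop (𝓝 0) := by
  obtain ⟨M, hM⟩ := hφ.bdd
  have hM0 : 0 ≤ M := (abs_nonneg _).trans (hM 0)
  have hl : Tendsto (fun s : ℝ => (s / 2)⁻¹ * M * |π - -π|) atTop (𝓝 0) := by
    have : Tendsto (fun s : ℝ => (s / 2)⁻¹) atTop (𝓝 0) :=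
      tendsto_inv_atTop_zero.comp (tendsto_id.atTop_div_const two_pos)
    simpa using (this.mul_const M).mul_const |π - -π|
  refine squeeze_zero_norm' ?_ hl
  filter_upwards [eventually_gt_atTop 0] with s hs
  have := integral_kerX_eq hφ hs.ne' (hm s)
  rw [← norm_neg, ← this]
  refine intervalIntegral.norm_integral_le_of_norm_le_const fun t _ => ?_
  rw [norm_mul, norm_eq_abs, norm_eq_abs]
  refine mul_le_mul ?_ (hM _) (abs_nonneg _) (by positivity)
  have h1 : s / 2 ≤ sinh (s / 2) := self_le_sinh_iff.2 (by linarith)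
  refine (abs_kerX_le' s t).trans ?_
  rw [abs_of_pos (by linarith)]
  have h2 : 0 < sinh (s / 2) := by linarith
  rw [div_le_iff₀ (by positivity), inv_mul_eq_div, le_div_iff₀ (by positivity)]
  nlinarith [sq_nonneg |sin (t / 2)|]

/-- Derivative of `-kerY` in the second variable, and of `-kerS` in the first. -/
noncomputable def kerD (q : ℝ × ℝ) : ℝ := (cosh q.1 * cos q.2 - 1) / cylDen q ^ 2

lemma hasDerivAt_kerS_fst {s : ℝ} (hs : s ≠ 0) (t : ℝ) :
    HasDerivAt (fun s => kerS (s, t)) (-kerD (s, t)) s := by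
  have h2 : HasDerivAt (fun s => cylDen (s, t)) (sinh s) s :=
    (hasDerivAt_cosh s).sub_const (cos t)
  refine ((hasDerivAt_sinh s).div h2 (cylDen_pos hs t).ne').congr_deriv ?_
  rw [kerD, ← neg_div]
  congr 1
  simp only [cylDen]
  nlinarith [cosh_sq s]

lemma hasDerivAt_kerY_snd {s : ℝ} (hs : s ≠ 0) (t : ℝ) :
    HasDerivAt (fun t => kerY (s, t)) (-kerD (s, t)) t := by
  have h2 : HasDerivAt (fun t => cylDen (s, t)) (sin t) t :=
    ((hasDerivAt_cos t).const_sub (cosh s)).congr_deriv (by ring)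
  refine ((hasDerivAt_sin t).neg.div h2 (cylDen_pos hs t).ne').congr_deriv ?_
  rw [kerD, ← neg_div]
  congr 1
  simp only [cylDen, Pi.neg_apply]
  nlinarith [sin_sq_add_cos_sq t]

lemma continuousOn_kerD : ContinuousOn kerD ({0}ᶜ ×ˢ univ) := by
  have c1 : Continuous cylDen := by unfold cylDen; fun_prop
  refine ContinuousOn.div (by fun_prop) (by fun_prop) fun q hq => ?_
  exact pow_ne_zero _ (cylDen_pos hq.1 q.2).ne'

lemma continuousOn_kerS : ContinuousOn kerS ({0}ᶜ ×ˢ univ) := by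
  have c1 : Continuous cylDen := by unfold cylDen; fun_prop
  refine ContinuousOn.div (by fun_prop) (by fun_prop) fun q hq => ?_
  exact (cylDen_pos hq.1 q.2).ne'

lemma hasDerivAt_integral_kerS (hφ : Reg0 φ) (hφ₁ : Reg0 φ₁) (hφ₂ : Reg0 φ₂)
    (hp : Partials φ φ₁ φ₂) (hm₁ : ∀ s, ∫ t in (-π)..π, φ₁ (s, t) = 0) {s : ℝ} (hs : s ≠ 0) :
    HasDerivAt (fun s => ∫ t in (-π)..π, kerS (s, t) * φ (s, t))
      (-∫ t in (-π)..π, (kerX (s, t) * φ₁ (s, t) + kerY (s, t) * φ₂ (s, t))) s := by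
  have hc := hφ.cont
  have hc₁ := hφ₁.cont
  have hc₂ := hφ₂.cont
  have cS := continuous_kerS_snd hs
  have cX := continuous_kerX_snd hs
  have cY := continuous_kerY_snd hs
  have cD : Continuous fun t => kerD (s, t) :=
    continuousOn_kerD.comp_continuous (by fun_prop) fun t => ⟨hs, mem_univ _⟩
  have hball : ∀ s' ∈ Metric.closedBall s (|s| / 2), s' ≠ 0 := by
    rintro s' hs' rfl
    rw [Metric.mem_closedBall, dist_zero_left, norm_eq_abs] at hs'
    have := abs_pos.2 hs
    linarith
  have hsub : Metric.closedBall s (|s| / 2) ×ˢ univ ⊆ ({0}ᶜ ×ˢ univ : Set (ℝ × ℝ)) :=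
    prod_mono_left hball
  have h := hasDerivAt_intervalIntegral_param (a := -π) (b := π) (s₀ := s) (r := |s| / 2)
    (F := fun s t => kerS (s, t) * φ (s, t))
    (F' := fun s t => -kerD (s, t) * φ (s, t) + kerS (s, t) * φ₁ (s, t))
    (by have := abs_pos.2 hs; positivity)
    (fun s' hs' => (continuous_kerS_snd (hball s' hs')).mul (by fun_prop))
    (((continuousOn_kerD.mono hsub).neg.mul hc.continuousOn).add
      ((continuousOn_kerS.mono hsub).mul hc₁.continuousOn))
    (fun s' hs' t => (hasDerivAt_kerS_fst (hball s' hs') t).mul (hp s' t).1)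
  refine h.congr_deriv ?_
  have parts := intervalIntegral.integral_mul_deriv_eq_deriv_mul (a := -π) (b := π)
    (u := fun t => kerY (s, t)) (u' := fun t => -kerD (s, t)) (v := fun t => φ (s, t))
    (v' := fun t => φ₂ (s, t)) (fun t _ => hasDerivAt_kerY_snd hs t) (fun t _ => (hp s t).2)
    (cD.neg.intervalIntegrable _ _) (by apply Continuous.intervalIntegrable; fun_prop)
  have z1 : kerY (s, π) = 0 := by simp [kerY]
  have z2 : kerY (s, -π) = 0 := by simp [kerY]
  rw [z1, z2] at parts
  rw [intervalIntegral.integral_add, intervalIntegral.integral_add, parts,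
    integral_kerX_eq hφ₁ hs (hm₁ s)]
  · ring
  · exact (cX.mul (by fun_prop)).intervalIntegrable _ _
  · exact (cY.mul (by fun_prop)).intervalIntegrable _ _
  · exact (cD.neg.mul (by fun_prop)).intervalIntegrable _ _
  · exact (cS.mul (by fun_prop)).intervalIntegrable _ _

lemma integral_Ioi_ker (hφ : Reg0 φ) (hφ₁ : Reg0 φ₁) (hφ₂ : Reg0 φ₂)
    (hp : Partials φ φ₁ φ₂) (hm : ∀ s, ∫ t in (-π)..π, φ (s, t) = 0)
    (hm₁ : ∀ s, ∫ t in (-π)..π, φ₁ (s, t) = 0)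
    (hi : IntegrableOn (fun s => ∫ t in (-π)..π,
      (kerX (s, t) * φ₁ (s, t) + kerY (s, t) * φ₂ (s, t))) (Ioi 0)) :
    ∫ s in Ioi 0, ∫ t in (-π)..π, (kerX (s, t) * φ₁ (s, t) + kerY (s, t) * φ₂ (s, t)) =
      2 * π * φ (0, 0) := by
  set I := fun s => ∫ t in (-π)..π, kerS (s, t) * φ (s, t) with hI
  have h := integral_Ioi_of_hasDerivAt_of_tendsto (a := 0) (m := 0)
    (f := Function.update I 0 (2 * π * φ (0, 0)))
    (f' := fun s => -∫ t in (-π)..π, (kerX (s, t) * φ₁ (s, t) + kerY (s, t) * φ₂ (s, t)))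
    (by
      rw [continuousWithinAt_update_same, Ici_sdiff_left]
      exact tendsto_integral_kerS hφ hφ₁ hφ₂ hp)
    (fun s hs => by
      refine (hasDerivAt_integral_kerS hφ hφ₁ hφ₂ hp hm₁ (ne_of_gt hs)).congr_of_eventuallyEq ?_
      filter_upwards [Ioi_mem_nhds hs] with s' hs'
      exact Function.update_of_ne (ne_of_gt hs') _ _)
    hi.neg
    (by
      refine (tendsto_integral_kerS_atTop hφ hm).congr' ?_
      filter_upwards [eventually_gt_atTop 0] with s' hs'
      exact (Function.update_of_ne (ne_of_gt hs') (2 * π * φ (0, 0)) I).symm)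
  rw [integral_neg, Function.update_self] at h
  linarith

lemma integral_cyl_ker (hφ : Reg0 φ) (hφ₁ : Reg0 φ₁) (hφ₂ : Reg0 φ₂)
    (hp : Partials φ φ₁ φ₂) (hm : ∀ s, ∫ t in (-π)..π, φ (s, t) = 0)
    (hm₁ : ∀ s, ∫ t in (-π)..π, φ₁ (s, t) = 0)
    (hi : Integrable (fun s => ∫ t in (-π)..π,
      (kerX (s, t) * φ₁ (s, t) + kerY (s, t) * φ₂ (s, t)))) :
    ∫ s, ∫ t in (-π)..π, (kerX (s, t) * φ₁ (s, t) + kerY (s, t) * φ₂ (s, t)) =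
      4 * π * φ (0, 0) := by
  have c := hφ.cont
  have c₁ := hφ₁.cont
  have c₂ := hφ₂.cont
  have r : ∀ {ψ : ℝ × ℝ → ℝ}, Reg0 ψ → Reg0 fun p => ψ (-p.1, p.2) := fun {ψ} h =>
    ⟨by have := h.cont; fun_prop, h.bdd.imp fun M hM p => hM _, fun x y => h.per _ _⟩
  have e : ∀ s, (∫ t in (-π)..π, (kerX (s, t) * -φ₁ (-s, t) + kerY (s, t) * φ₂ (-s, t))) =
      ∫ t in (-π)..π, (kerX (-s, t) * φ₁ (-s, t) + kerY (-s, t) * φ₂ (-s, t)) := fun s => by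
    congr 1 with t
    have e1 : kerX (-s, t) = -kerX (s, t) := by simp [kerX, cylDen, neg_div]
    have e2 : kerY (-s, t) = kerY (s, t) := by simp [kerY, cylDen]
    rw [e1, e2]; ring
  have h1 := integral_Ioi_ker hφ hφ₁ hφ₂ hp hm hm₁ hi.integrableOn
  have h2 := integral_Ioi_ker (φ := fun p => φ (-p.1, p.2)) (φ₁ := fun p => -φ₁ (-p.1, p.2))
    (φ₂ := fun p => φ₂ (-p.1, p.2)) (r hφ) (r hφ₁).neg (r hφ₂)
    (fun x y => ⟨by
      have h := (hp (-x) y).1.comp x (hasDerivAt_neg x)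
      rw [mul_neg, mul_one] at h
      exact h, (hp (-x) y).2⟩)
    (fun s => hm (-s)) (fun s => by simp [hm₁]) (by
      simp only [e]
      exact hi.comp_neg.integrableOn)
  simp only [e, neg_zero] at h2
  rw [integral_comp_neg_Ioi (f := fun s => ∫ t in (-π)..π,
    (kerX (s, t) * φ₁ (s, t) + kerY (s, t) * φ₂ (s, t)))] at h2
  rw [neg_zero] at h2
  rw [← intervalIntegral.integral_Iic_add_Ioi hi.integrableOn hi.integrableOn, h1, h2]
  ring

end

lemma integral_period_odd {g : ℝ → ℝ} (hp : ∀ t, g (t + 2 * π) = g t) (ho : ∀ t, g (-t) = -g t)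
    (y : ℝ) : ∫ t in (-π)..π, g (y - t) = 0 := by
  rw [intervalIntegral.integral_comp_sub_left (fun t => g t) y]
  have h1 := Function.Periodic.intervalIntegral_add_eq (f := g) (T := 2 * π) hp (y - π) (-π)
  rw [show y - π + 2 * π = y - -π by ring, show -π + 2 * π = π by ring] at h1
  rw [h1]
  have h2 := intervalIntegral.integral_comp_neg (a := -π) (b := π) g
  simp only [ho, intervalIntegral.integral_neg, neg_neg] at h2
  linarith

lemma odd_partial_fst {h h₁ h₂ : ℝ × ℝ → ℝ} (hp : Partials h h₁ h₂)
    (ho : ∀ x y, h (x, -y) = -h (x, y)) (x y : ℝ) : h₁ (x, -y) = -h₁ (x, y) := by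
  have h1 := (hp x (-y)).1
  simp only [ho] at h1
  exact h1.unique (hp x y).1.neg

theorem cylConv_laplacian {h h₁ h₂ : ℝ × ℝ → ℝ} (hh : Reg0 h) (hh₁ : Reg0 h₁) (hh₂ : Reg0 h₂)
    (hp : Partials h h₁ h₂) (ho : ∀ x y, h (x, -y) = -h (x, y)) (p : ℝ × ℝ) :
    cylConv kerX h₁ p + cylConv kerY h₂ p = -h p := by
  obtain ⟨x, y⟩ := p
  have r : ∀ {ψ : ℝ × ℝ → ℝ}, Reg0 ψ → Reg0 fun p => ψ (x - p.1, y - p.2) := fun {ψ} h =>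
    ⟨by have := h.cont; fun_prop, h.bdd.imp fun M hM p => hM _, fun s t => by
      change ψ (x - s, y - (t + 2 * π)) = ψ (x - s, y - t)
      rw [← h.per _ (y - (t + 2 * π))]; congr 2; ring⟩
  have ho₁ := odd_partial_fst hp ho
  have e : ∀ s, s ≠ 0 → (∫ t in (-π)..π, (kerX (s, t) * -h₁ (x - s, y - t) +
      kerY (s, t) * -h₂ (x - s, y - t))) = -((∫ t in (-π)..π, kerX (s, t) * h₁ (x - s, y - t)) +
      ∫ t in (-π)..π, kerY (s, t) * h₂ (x - s, y - t)) := fun s hs => by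
    have c1 := hh₁.cont
    have c2 := hh₂.cont
    have k1 := continuous_kerX_snd hs
    have k2 := continuous_kerY_snd hs
    rw [← intervalIntegral.integral_add, ← intervalIntegral.integral_neg]
    · congr 1 with t; ring
    · exact (k1.mul (by fun_prop)).intervalIntegrable _ _
    · exact (k2.mul (by fun_prop)).intervalIntegrable _ _
  have i1 := integrable_inner integrable_kerX hh₁ x y
  have i2 := integrable_inner integrable_kerY hh₂ x y
  have h0 : ∀ᵐ s : ℝ, s ≠ 0 := by simp [ae_iff]
  have ae : (fun s => ∫ t in (-π)..π, (kerX (s, t) * -h₁ (x - s, y - t) +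
      kerY (s, t) * -h₂ (x - s, y - t))) =ᵐ[volume] fun s =>
      -((∫ t in (-π)..π, kerX (s, t) * h₁ (x - s, y - t)) +
      ∫ t in (-π)..π, kerY (s, t) * h₂ (x - s, y - t)) := by
    filter_upwards [h0] with s hs using e s hs
  have key := integral_cyl_ker (φ := fun p => h (x - p.1, y - p.2))
    (φ₁ := fun p => -h₁ (x - p.1, y - p.2)) (φ₂ := fun p => -h₂ (x - p.1, y - p.2))
    (r hh) (r hh₁).neg (r hh₂).neg
    (fun s t => ⟨(hp (x - s) (y - t)).1.comp_const_sub x s,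
      (hp (x - s) (y - t)).2.comp_const_sub y t⟩)
    (fun s => integral_period_odd (g := fun t => h (x - s, t)) (hh.per _) (ho _) y)
    (fun s => by
      simp only [intervalIntegral.integral_neg]
      rw [integral_period_odd (g := fun t => h₁ (x - s, t)) (hh₁.per _) (ho₁ _) y, neg_zero])
    ((i1.add i2).neg.congr ae.symm)
  rw [integral_congr_ae ae, integral_neg, integral_add i1 i2] at key
  rw [cylConv_eq integrable_kerX hh₁, cylConv_eq integrable_kerY hh₂, ← mul_add]
  simp only [sub_zero] at key
  have hpi := pi_pos
  field_simp
  linarith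

/-- A balanced nonlinearity on the strip: `P` is a one-dimensional profile of zero energy, no
one-dimensional solution has negative energy, and none has midpoint value `m`. -/
structure Bistable (f F P P' : ℝ → ℝ) (m : ℝ) : Prop where
  smooth : ContDiff ℝ (⊤ : ℕ∞) f
  odd : ∀ t, f (-t) = -f t
  primitive : ∀ t, HasDerivAt F (f t) t
  primitive_zero : F 0 = 0
  deriv_pos : ∀ t ∈ Icc 0 (P (π / 2)), 0 < deriv f t
  profile_odd : ∀ y, P (-y) = -P y
  profile_periodic : ∀ y, P (y + 2 * π) = P y
  profile_deriv : ∀ y, HasDerivAt P (P' y) y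
  profile_deriv_two : ∀ y, HasDerivAt P' (-f (P y)) y
  profile_nonneg : ∀ y ∈ Icc 0 π, 0 ≤ P y
  profile_le : ∀ y, P y ≤ P (π / 2)
  profile_energy : ∫ y in (0)..π, (P' y ^ 2 / 2 - F (P y)) = 0
  level_pos : 0 < m
  level_lt : m < P (π / 2)
  energy_nonneg : ∀ Q Q' : ℝ → ℝ, (∀ y, HasDerivAt Q (Q' y) y) →
    (∀ y, HasDerivAt Q' (-f (Q y)) y) → Q 0 = 0 → Q π = 0 →
    0 ≤ ∫ y in (0)..π, (Q' y ^ 2 / 2 - F (Q y))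
  level_ne : ∀ Q Q' : ℝ → ℝ, (∀ y, HasDerivAt Q (Q' y) y) →
    (∀ y, HasDerivAt Q' (-f (Q y)) y) → Q 0 = 0 → Q π = 0 → Q (π / 2) ≠ m

lemma exists_smooth_inverse {g g' : ℝ → ℝ} (hg : ContDiff ℝ (⊤ : ℕ∞) g)
    (hd : ∀ x, HasDerivAt g (g' x) x) {c : ℝ} (hc : 0 < c) (h : ∀ x, c ≤ g' x) :
    ∃ k : ℝ → ℝ, ContDiff ℝ (⊤ : ℕ∞) k ∧ StrictMono k ∧ (∀ x, k (g x) = x) ∧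
      (∀ x, g (k x) = x) ∧ ∀ x, HasDerivAt k (g' (k x))⁻¹ x := by
  have hm : StrictMono g := strictMono_of_hasDerivAt_pos hd fun x => hc.trans_le (h x)
  have hl : Monotone fun x => g x - c * x := monotone_of_hasDerivAt_nonneg
    (f' := fun x => g' x - c) (fun x => by
      exact ((hd x).sub ((hasDerivAt_id x).const_mul c)).congr_deriv (by simp)) fun x => sub_nonneg.2 (h x)
  have hs : Function.Surjective g := by
    refine hg.continuous.surjective ?_ ?_
    · refine tendsto_atTop_mono' atTop ?_
        (tendsto_atTop_add_const_left atTop (g 0) (tendsto_id.const_mul_atTop hc))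
      filter_upwards [eventually_ge_atTop 0] with x hx
      have := hl hx
      simp at this ⊢
      linarith
    · refine tendsto_atBot_mono' atBot ?_
        (tendsto_atBot_add_const_left atBot (g 0) (tendsto_id.const_mul_atBot hc))
      filter_upwards [eventually_le_atBot 0] with x hx
      have := hl hx
      simp at this ⊢
      linarith
  let e := (hm.orderIsoOfSurjective g hs)
  have e1 : ∀ x, e.symm (g x) = x := fun x => e.symm_apply_apply x
  have e2 : ∀ x, g (e.symm x) = x := fun x => e.apply_symm_apply x
  refine ⟨e.symm, ?_, e.symm.strictMono, e1, e2, fun x => ?_⟩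
  · exact e.toHomeomorph.contDiff_symm_deriv (fun x => (hc.trans_le (h x)).ne') hd hg
  · exact HasDerivAt.of_local_left_inverse e.symm.continuous.continuousAt (hd _)
      (hc.trans_le (h _)).ne' (Eventually.of_forall e2)

/-- Change of amplitude: the solutions below are `amp` composed with reparametrised sines. -/
noncomputable def amp (s : ℝ) : ℝ := 17 / 16 * s - s ^ 3 / 6 + s ^ 5 / 10

/-- The derivative of `amp`. -/
noncomputable def ampDeriv (s : ℝ) : ℝ := 17 / 16 - s ^ 2 / 2 + s ^ 4 / 2

lemma ampDeriv_ge (s : ℝ) : 15 / 16 ≤ ampDeriv s := by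
  unfold ampDeriv; nlinarith [sq_nonneg (s ^ 2 - 1 / 2)]

lemma ampDeriv_pos (s : ℝ) : 0 < ampDeriv s := by linarith [ampDeriv_ge s]

lemma hasDerivAt_amp (s : ℝ) : HasDerivAt amp (ampDeriv s) s := by
  unfold amp ampDeriv
  refine (((hasDerivAt_id s).const_mul (17 / 16)).sub ((hasDerivAt_pow 3 s).div_const 6)).add
    ((hasDerivAt_pow 5 s).div_const 10) |>.congr_deriv ?_
  norm_num; ring

lemma contDiff_amp : ContDiff ℝ (⊤ : ℕ∞) amp := by unfold amp; fun_prop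

lemma contDiff_ampDeriv : ContDiff ℝ (⊤ : ℕ∞) ampDeriv := by unfold ampDeriv; fun_prop

lemma amp_neg (s : ℝ) : amp (-s) = -amp s := by unfold amp; ring

lemma strictMono_amp : StrictMono amp :=
  strictMono_of_hasDerivAt_pos hasDerivAt_amp ampDeriv_pos

lemma ampDeriv_sin (t : ℝ) : ampDeriv (sin t) = 1 + cos (4 * t) / 16 := by
  have h : cos (4 * t) = 2 * cos (2 * t) ^ 2 - 1 := by rw [← cos_two_mul]; ring_nf
  rw [h, cos_two_mul, cos_sq']
  unfold ampDeriv; ring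

/-- The phase along the profile. -/
noncomputable def phase (t : ℝ) : ℝ := t + sin (4 * t) / 64

lemma hasDerivAt_phase (t : ℝ) : HasDerivAt phase (ampDeriv (sin t)) t := by
  rw [ampDeriv_sin]
  unfold phase
  refine (hasDerivAt_id t).add (((hasDerivAt_sin (4 * t)).comp t
    ((hasDerivAt_id t).const_mul 4)).div_const 64) |>.congr_deriv ?_
  simp; ring

lemma strictMono_phase : StrictMono phase :=
  strictMono_of_hasDerivAt_pos hasDerivAt_phase fun _ => ampDeriv_pos _

lemma contDiff_phase : ContDiff ℝ (⊤ : ℕ∞) phase := by unfold phase; fun_prop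

lemma phase_pi_div_two : phase (π / 2) = π / 2 := by
  have : 4 * (π / 2) = 2 * π := by ring
  simp [phase, this]

/-- Solutions of the profile equation in the amplitude and velocity variables. -/
structure AmpOrbit (s p : ℝ → ℝ) : Prop where
  amp : ∀ y, HasDerivAt s (p y / ampDeriv (s y)) y
  vel : ∀ y, HasDerivAt p (-(s y / ampDeriv (s y))) y

/-- The speed of the rectified phase at energy `z`. -/
noncomputable def speed (z : ℝ) : ℝ := 1 + (1 - z) * (1 - 3 * z) / 16

lemma speed_gt (z : ℝ) : 1 / 2 < speed z := by
  unfold speed; nlinarith [sq_nonneg (z - 2 / 3)]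

lemma ampDeriv_eq_speed {z s p : ℝ} (h : p ^ 2 + s ^ 2 = z) :
    ampDeriv s = speed z + (1 - z) * (p ^ 2 - s ^ 2) / 4 + (z ^ 2 - 8 * s ^ 2 * p ^ 2) / 16 := by
  subst h; unfold ampDeriv speed; ring

/-- The rectified phase along a trajectory of energy `z`. -/
noncomputable def rectPhase (z y s p : ℝ) : ℝ :=
  y - ((1 - z) * (s * p) / 4 + s * p * (p ^ 2 - s ^ 2) / 16)

namespace AmpOrbit

variable {s p : ℝ → ℝ}

lemma sq_add_sq (h : AmpOrbit s p) (y : ℝ) : p y ^ 2 + s y ^ 2 = p 0 ^ 2 + s 0 ^ 2 := by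
  have hd : ∀ y, HasDerivAt (fun y => p y ^ 2 + s y ^ 2) 0 y := fun y => by
    refine ((h.vel y).pow 2).add ((h.amp y).pow 2) |>.congr_deriv ?_
    have := (ampDeriv_pos (s y)).ne'
    simp; field_simp; ring
  exact is_const_of_deriv_eq_zero (fun y => (hd y).differentiableAt) (fun y => (hd y).deriv) y 0

lemma hasDerivAt_rectPhase (h : AmpOrbit s p) {z : ℝ} (hz : ∀ y, p y ^ 2 + s y ^ 2 = z) (y : ℝ) :
    HasDerivAt (fun y => rectPhase z y (s y) (p y)) (speed z / ampDeriv (s y)) y := by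
  have hs := h.amp y
  have hp := h.vel y
  unfold rectPhase
  refine (hasDerivAt_id y).sub ((((hs.mul hp).const_mul (1 - z)).div_const 4).add
    (((hs.mul hp).mul ((hp.pow 2).sub (hs.pow 2))).div_const 16)) |>.congr_deriv ?_
  have h0 := (ampDeriv_pos (s y)).ne'
  have h1 := ampDeriv_eq_speed (hz y)
  rw [show speed z = ampDeriv (s y) - (1 - z) * (p y ^ 2 - s y ^ 2) / 4 -
    (z ^ 2 - 8 * s y ^ 2 * p y ^ 2) / 16 by linarith]
  rw [← hz y]
  simp
  field_simp
  ring

lemma rotation (h : AmpOrbit s p) {z : ℝ} (hz : ∀ y, p y ^ 2 + s y ^ 2 = z) (h0 : s 0 = 0)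
    (y : ℝ) : s y * cos (rectPhase z y (s y) (p y) / speed z) =
        p y * sin (rectPhase z y (s y) (p y) / speed z) ∧
      p y * cos (rectPhase z y (s y) (p y) / speed z) +
        s y * sin (rectPhase z y (s y) (p y) / speed z) = p 0 := by
  have hc : speed z ≠ 0 := by linarith [speed_gt z]
  have hA := fun y => (h.hasDerivAt_rectPhase hz y).div_const (speed z)
  have hA0 : rectPhase z 0 (s 0) (p 0) = 0 := by simp [rectPhase, h0]
  set A := fun y => rectPhase z y (s y) (p y) / speed z with hAd
  have d1 : ∀ y, HasDerivAt (fun y => s y * cos (A y) - p y * sin (A y)) 0 y := fun y => by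
    refine ((h.amp y).mul (hA y).cos).sub ((h.vel y).mul (hA y).sin) |>.congr_deriv ?_
    have := (ampDeriv_pos (s y)).ne'
    simp only [hAd]; field_simp; ring
  have d2 : ∀ y, HasDerivAt (fun y => p y * cos (A y) + s y * sin (A y)) 0 y := fun y => by
    refine ((h.vel y).mul (hA y).cos).add ((h.amp y).mul (hA y).sin) |>.congr_deriv ?_
    have := (ampDeriv_pos (s y)).ne'
    simp only [hAd]; field_simp; ring
  have e1 := is_const_of_deriv_eq_zero (fun y => (d1 y).differentiableAt)
    (fun y => (d1 y).deriv) y 0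
  have e2 := is_const_of_deriv_eq_zero (fun y => (d2 y).differentiableAt)
    (fun y => (d2 y).deriv) y 0
  have hA0' : A 0 = 0 := by simp only [hAd, hA0, zero_div]
  simp only [hA0', h0, cos_zero, sin_zero] at e1 e2
  constructor <;> linarith

lemma resonance (h : AmpOrbit s p) (h0 : s 0 = 0) (hpi : s π = 0) :
    p 0 = 0 ∨ p 0 ^ 2 = 1 ∨ p 0 ^ 2 = 1 / 3 := by
  have hz : ∀ y, p y ^ 2 + s y ^ 2 = p 0 ^ 2 := fun y => by rw [h.sq_add_sq, h0]; ring
  obtain ⟨h1, h2⟩ := h.rotation hz h0 π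
  rw [hpi, show rectPhase (p 0 ^ 2) π 0 (p π) = π by simp [rectPhase]] at h1 h2
  set c := speed (p 0 ^ 2) with hc
  have hc1 : 1 / 2 < c := speed_gt _
  rcases eq_or_ne (p π) 0 with hp | hp
  · left; rw [← h2, hp]; ring
  have hs : sin (π / c) = 0 := by simpa [hp] using h1.symm
  obtain ⟨n, hn⟩ := sin_eq_zero_iff.1 hs
  have hn1 : (n : ℝ) * c = 1 := by
    have := pi_pos
    have : (n : ℝ) * c * π = 1 * π := by
      rw [eq_div_iff (by linarith)] at hn; linarith
    exact mul_right_cancel₀ pi_ne_zero this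
  have hn2 : 0 < n := by
    have : (0 : ℝ) < n := by by_contra hcon; nlinarith
    exact_mod_cast this
  have hn3 : n < 2 := by
    have : (n : ℝ) < 2 := by nlinarith
    exact_mod_cast this
  obtain rfl : n = 1 := by omega
  have : (1 - p 0 ^ 2) * (1 - 3 * p 0 ^ 2) = 0 := by
    simp only [hc, speed] at hn1; push_cast at hn1; linarith
  rcases mul_eq_zero.1 this with h | h
  · right; left; linarith
  · right; right; linarith

lemma integral_energy (h : AmpOrbit s p) (h0 : s 0 = 0) (hpi : s π = 0) :
    ∫ y in (0)..π, (p y ^ 2 / 2 - s y ^ 2 / 2) =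
      (p 0 ^ 2) ^ 2 * (1 - p 0 ^ 2) / 16 * (π / speed (p 0 ^ 2)) := by
  have hz : ∀ y, p y ^ 2 + s y ^ 2 = p 0 ^ 2 := fun y => by rw [h.sq_add_sq, h0]; ring
  set z := p 0 ^ 2 with hzd
  have hc : speed z ≠ 0 := by linarith [speed_gt z]
  rw [intervalIntegral.integral_eq_sub_of_hasDerivAt
    (f := fun y => z ^ 2 * (1 - z) / 16 * (rectPhase z y (s y) (p y) / speed z) +
      speed z / 2 * (s y * p y) + (1 - z) / 16 * (s y * p y * (p y ^ 2 - s y ^ 2)) +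
      z ^ 2 / 32 * (s y * p y) - 1 / 12 * (s y * p y) ^ 3) (fun y _ => ?deriv) ?int]
  case deriv =>
    have hs := h.amp y
    have hp := h.vel y
    refine (((((((h.hasDerivAt_rectPhase hz y).div_const _).const_mul _).add
      ((hs.mul hp).const_mul _)).add (((hs.mul hp).mul
      ((hp.pow 2).sub (hs.pow 2))).const_mul _)).add ((hs.mul hp).const_mul _)).sub
      (((hs.mul hp).pow 3).const_mul _)) |>.congr_deriv ?_
    have h2 := (ampDeriv_pos (s y)).ne'
    have h1 := ampDeriv_eq_speed (hz y)
    have h3 : speed z = ampDeriv (s y) - (1 - z) * (p y ^ 2 - s y ^ 2) / 4 -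
      (z ^ 2 - 8 * s y ^ 2 * p y ^ 2) / 16 := by linarith
    have h4 : speed z / ampDeriv (s y) / speed z = 1 / ampDeriv (s y) := by field_simp
    simp only [h4]
    rw [h3, ← hz y]
    simp
    field_simp
    ring
  case int =>
    refine Continuous.intervalIntegrable ?_ _ _
    have c1 : Continuous s := continuous_iff_continuousAt.2 fun y => (h.amp y).continuousAt
    have c2 : Continuous p := continuous_iff_continuousAt.2 fun y => (h.vel y).continuousAt
    fun_prop
  simp [rectPhase, h0, hpi]

lemma mid_ne (h : AmpOrbit s p) (h0 : s 0 = 0) (hpi : s π = 0) : s (π / 2) ≠ 3 / 4 := by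
  intro hm
  have hz : ∀ y, p y ^ 2 + s y ^ 2 = p 0 ^ 2 := fun y => by rw [h.sq_add_sq, h0]; ring
  have hz2 := hz (π / 2)
  rw [hm] at hz2
  rcases h.resonance h0 hpi with hp | hp | hp
  · rw [hp] at hz2; nlinarith
  · rw [hp] at hz hz2
    obtain ⟨h1, h2⟩ := h.rotation hz h0 (π / 2)
    have hc : speed 1 = 1 := by simp [speed]
    rw [hc, div_one] at h1 h2
    set A := rectPhase 1 (π / 2) (s (π / 2)) (p (π / 2)) with hA
    have e1 : s (π / 2) = p 0 * sin A := by
      linear_combination sin A * h2 + cos A * h1 - s (π / 2) * sin_sq_add_cos_sq A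
    have e2 : p (π / 2) = p 0 * cos A := by
      linear_combination cos A * h2 - sin A * h1 - p (π / 2) * sin_sq_add_cos_sq A
    have e3 : phase A = phase (π / 2) := by
      rw [phase_pi_div_two, phase, show 4 * A = 2 * (2 * A) by ring, sin_two_mul, sin_two_mul,
        cos_two_mul']
      have : A = π / 2 - p 0 ^ 4 * (sin A * cos A * (cos A ^ 2 - sin A ^ 2)) / 16 := by
        conv_lhs => rw [hA, rectPhase, e1, e2]
        ring
      rw [show p 0 ^ 4 = (p 0 ^ 2) ^ 2 by ring, hp] at this
      linarith
    rw [strictMono_phase.injective e3, sin_pi_div_two, mul_one, hm] at e1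
    rw [← e1] at hp
    norm_num at hp
  · rw [hp] at hz2; nlinarith [sq_nonneg (p (π / 2))]

end AmpOrbit

/-- The model nonlinearity. -/
lemma exists_bistable : ∃ f F P P' : ℝ → ℝ, ∃ m : ℝ, Bistable f F P P' m := by
  obtain ⟨k, hk, hkm, hk1, hk2, hkd⟩ := exists_smooth_inverse contDiff_amp hasDerivAt_amp
    (by norm_num : (0 : ℝ) < 15 / 16) ampDeriv_ge
  obtain ⟨θ, hθ, hθm, hθ1, hθ2, hθd⟩ := exists_smooth_inverse contDiff_phase hasDerivAt_phase
    (by norm_num : (0 : ℝ) < 15 / 16) fun t => ampDeriv_ge _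
  have k0 : k 0 = 0 := by simpa [amp] using hk1 0
  have kn : ∀ t, k (-t) = -k t := fun t => strictMono_amp.injective (by rw [amp_neg, hk2, hk2])
  have t0 : θ 0 = 0 := by simpa [phase] using hθ1 0
  have tp : ∀ y, θ (y + 2 * π) = θ y + 2 * π := fun y => strictMono_phase.injective (by
    rw [hθ2]
    conv_lhs => rw [← hθ2 y]
    simp only [phase]
    rw [show 4 * (θ y + 2 * π) = 4 * θ y + (4 : ℕ) * (2 * π) by push_cast; ring,
      sin_add_nat_mul_two_pi]
    ring)
  have tn : ∀ y, θ (-y) = -θ y := fun y => strictMono_phase.injective (by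
    rw [hθ2]
    conv_lhs => rw [← hθ2 y]
    simp only [phase, mul_neg, sin_neg]; ring)
  have th : θ (π / 2) = π / 2 := by conv_lhs => rw [← phase_pi_div_two, hθ1]
  have tpi : θ π = π := strictMono_phase.injective (by
    rw [hθ2, phase, show 4 * π = (4 : ℕ) * π by push_cast; ring, sin_nat_mul_pi]
    ring)
  have orb : ∀ Q Q' : ℝ → ℝ, (∀ y, HasDerivAt Q (Q' y) y) →
      (∀ y, HasDerivAt Q' (-(k (Q y) / ampDeriv (k (Q y)))) y) →
      AmpOrbit (fun y => k (Q y)) Q' := fun Q Q' h1 h2 =>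
    ⟨fun y => ((hkd _).comp y (h1 y)).congr_deriv (by rw [div_eq_inv_mul]), h2⟩
  have prof : ∀ y, HasDerivAt (fun y => amp (sin (θ y))) (cos (θ y)) y := fun y => by
    refine ((hasDerivAt_amp _).comp y (hθd y).sin).congr_deriv ?_
    have := (ampDeriv_pos (sin (θ y))).ne'
    field_simp
  have prof' : ∀ y, HasDerivAt (fun y => cos (θ y))
      (-(k (amp (sin (θ y))) / ampDeriv (k (amp (sin (θ y)))))) y := fun y => by
    refine (hθd y).cos.congr_deriv ?_
    rw [hk1]; ring
  refine ⟨fun t => k t / ampDeriv (k t), fun t => k t ^ 2 / 2, fun y => amp (sin (θ y)),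
    fun y => cos (θ y), amp (3 / 4), ?_, ?_, ?_, ?_, ?_, ?_, ?_, prof, prof', ?_, ?_, ?_, ?_, ?_,
    ?_, ?_⟩
  · exact hk.div (contDiff_ampDeriv.comp hk) fun t => (ampDeriv_pos _).ne'
  · intro t
    simp only [kn]
    rw [show ampDeriv (-k t) = ampDeriv (k t) by unfold ampDeriv; ring, neg_div]
  · exact fun t => (((hkd t).pow 2).div_const 2).congr_deriv (by simp; ring)
  · simp [k0]
  · intro t ht
    rw [th, sin_pi_div_two] at ht
    have a0 : 0 ≤ k t := by simpa [k0] using hkm.monotone ht.1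
    have a1 : k t ≤ 1 := by simpa [hk1] using hkm.monotone ht.2
    have hd : HasDerivAt ampDeriv (-k t + 2 * k t ^ 3) (k t) := by
      unfold ampDeriv
      refine ((((hasDerivAt_pow 2 (k t)).div_const 2).const_sub (17 / 16)).add
        ((hasDerivAt_pow 4 (k t)).div_const 2)).congr_deriv ?_
      norm_num; ring
    have h1 := (hkd t).div (hd.comp t (hkd t)) (ampDeriv_pos (k t)).ne'
    have h2 : deriv (fun t => k t / ampDeriv (k t)) t = _ := h1.deriv
    rw [h2]
    refine div_pos ?_ (by have := ampDeriv_pos (k t); positivity)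
    have h3 : 0 < ampDeriv (k t) - k t * (-k t + 2 * k t ^ 3) := by
      unfold ampDeriv
      have : k t ^ 2 ≤ 1 := by nlinarith
      nlinarith [sq_nonneg (k t)]
    have h4 := mul_pos h3 (inv_pos.2 (ampDeriv_pos (k t)))
    simp only [Function.comp]
    linarith
  · exact fun y => by simp only [tn, sin_neg, amp_neg]
  · exact fun y => by simp only [tp, sin_add_two_pi]
  · intro y hy
    have : 0 ≤ sin (θ y) := sin_nonneg_of_nonneg_of_le_pi
      (by simpa [t0] using hθm.monotone hy.1) (by simpa [tpi] using hθm.monotone hy.2)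
    have h := strictMono_amp.monotone this
    simpa [amp] using h
  · intro y
    simp only [th, sin_pi_div_two]
    exact strictMono_amp.monotone (sin_le_one _)
  · have h := (orb _ _ prof prof').integral_energy (by simp [t0, amp, k0])
      (by simp [tpi, amp, k0])
    rw [h]
    simp [t0]
  · norm_num [amp]
  · simp only [th, sin_pi_div_two]
    exact strictMono_amp (by norm_num)
  · intro Q Q' h1 h2 q0 qpi
    have h := orb Q Q' h1 h2
    rw [h.integral_energy (by simp [q0, k0]) (by simp [qpi, k0])]
    have hc := speed_gt (Q' 0 ^ 2)
    have h4 : 0 ≤ 1 - Q' 0 ^ 2 := by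
      rcases h.resonance (by simp [q0, k0]) (by simp [qpi, k0]) with h | h | h <;> rw [h] <;>
        norm_num
    have := pi_pos
    have : 0 ≤ π / speed (Q' 0 ^ 2) := div_nonneg pi_pos.le (by linarith)
    positivity
  · intro Q Q' h1 h2 q0 qpi hm
    refine (orb Q Q' h1 h2).mid_ne (by simp [q0, k0]) (by simp [qpi, k0]) ?_
    simp [hm, hk1]

lemma exists_strip (y : ℝ) : ∃ y' ∈ Icc 0 π, ∃ ε : ℝ, |ε| = 1 ∧ ∀ g : ℝ → ℝ,
    (∀ t, g (t + 2 * π) = g t) → (∀ t, g (-t) = -g t) → g y = ε * g y' := by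
  have hp : (0 : ℝ) < 2 * π := by positivity
  obtain ⟨n, hn, -⟩ := existsUnique_add_zsmul_mem_Ioc hp y (-π)
  have key : ∀ g : ℝ → ℝ, (∀ t, g (t + 2 * π) = g t) → g (y + n • (2 * π)) = g y :=
    fun g hg => (Function.Periodic.zsmul hg n) y
  rcases le_total 0 (y + n • (2 * π)) with h | h
  · exact ⟨_, ⟨h, by linarith [hn.2]⟩, 1, abs_one, fun g hg _ => by rw [key g hg, one_mul]⟩
  · exact ⟨-(y + n • (2 * π)), ⟨by linarith, by linarith [hn.1]⟩, -1, by simp,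
      fun g hg ho => by rw [ho, key g hg]; ring⟩

lemma odd_zero {g : ℝ → ℝ} (ho : ∀ t, g (-t) = -g t) : g 0 = 0 := by
  have := ho 0; rw [neg_zero] at this; linarith

lemma odd_periodic_pi {g : ℝ → ℝ} (hp : ∀ t, g (t + 2 * π) = g t) (ho : ∀ t, g (-t) = -g t) :
    g π = 0 := by
  have h1 := hp (-π); have h2 := ho π
  rw [show -π + 2 * π = π by ring] at h1; linarith

lemma cylConv_zero (k : ℝ × ℝ → ℝ) (p : ℝ × ℝ) : cylConv k (fun _ => 0) p = 0 := by
  simp [cylConv]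

/-- Sources depending only on the second variable. -/
lemma cylConv_snd {g g' : ℝ → ℝ} (hg : ∀ y, HasDerivAt g (g' y) y) (hc : Continuous g')
    (hp : ∀ y, g (y + 2 * π) = g y) (ho : ∀ y, g (-y) = -g y)
    (hb : ∃ M, ∀ y, |g y| ≤ M) (hb' : ∃ M, ∀ y, |g' y| ≤ M) (x y : ℝ) :
    cylConv kerX (fun p => g p.2) (x, y) = 0 ∧
    HasDerivAt (fun t => cylConv kerG (fun p => g p.2) (x, t))
      (cylConv kerY (fun p => g p.2) (x, y)) y ∧
    HasDerivAt (fun t => cylConv kerY (fun p => g p.2) (x, t)) (-g y) y := by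
  have gc : Continuous g := continuous_iff_continuousAt.2 fun y => (hg y).continuousAt
  have hp' : ∀ y, g' (y + 2 * π) = g' y := fun y => by
    refine HasDerivAt.unique ?_ (hg y)
    have := (hg (y + 2 * π)).comp_add_const y (2 * π)
    simpa only [hp] using this
  have h0 : Reg0 fun p => g p.2 := ⟨by fun_prop, hb.imp fun M hM p => hM _, fun x y => hp y⟩
  have h2 : Reg0 fun p => g' p.2 := ⟨by fun_prop, hb'.imp fun M hM p => hM _, fun x y => hp' y⟩
  have h1 := Reg0.const 0
  have hpart : Partials (fun p => g p.2) (fun _ => 0) fun p => g' p.2 :=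
    fun x y => ⟨hasDerivAt_const x (g y), hg y⟩
  refine ⟨?_, (partials_cylConv_kerG h0 x y).2, ?_⟩
  · rw [← cylConv_kerG_fst h0 h1 fun x y => (hpart x y).1, cylConv_zero]
  · have := hasDerivAt_cylConv_snd integrable_kerY h0 h2 (fun x y => (hpart x y).2) x y
    have hl := cylConv_laplacian h0 h1 h2 hpart (fun x y => ho y) (x, y)
    rw [cylConv_zero, zero_add] at hl
    rwa [hl] at this

lemma exists_abs_bound (g : ℝ → ℝ) (hg : Continuous g) (c : ℝ) :
    ∃ M, 0 ≤ M ∧ ∀ t, |t| ≤ c → |g t| ≤ M := by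
  obtain ⟨M, hM⟩ := isCompact_Icc.exists_bound_of_continuousOn (s := Icc (-c) c) hg.continuousOn
  exact ⟨|M|, abs_nonneg _, fun t ht => (hM t (abs_le.1 ht)).trans (le_abs_self M)⟩

section

variable {f F P P' : ℝ → ℝ} {m : ℝ}

namespace Bistable

lemma continuous_f (B : Bistable f F P P' m) : Continuous f := B.smooth.continuous

lemma f_zero (B : Bistable f F P P' m) : f 0 = 0 := odd_zero B.odd

lemma continuous_profile (B : Bistable f F P P' m) : Continuous P :=
  continuous_iff_continuousAt.2 fun y => (B.profile_deriv y).continuousAt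

lemma continuous_profile_deriv (B : Bistable f F P P' m) : Continuous P' :=
  continuous_iff_continuousAt.2 fun y => (B.profile_deriv_two y).continuousAt

lemma continuous_primitive (B : Bistable f F P P' m) : Continuous F :=
  continuous_iff_continuousAt.2 fun y => (B.primitive y).continuousAt

lemma hasDerivAt_f (B : Bistable f F P P' m) (t : ℝ) : HasDerivAt f (deriv f t) t :=
  (B.smooth.differentiable (by simp) t).hasDerivAt

lemma continuous_deriv_f (B : Bistable f F P P' m) : Continuous (deriv f) :=
  B.smooth.continuous_deriv (by simp)

lemma abs_profile_le (B : Bistable f F P P' m) (y : ℝ) : |P y| ≤ P (π / 2) := by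
  refine abs_le.2 ⟨?_, B.profile_le y⟩
  have := B.profile_le (-y)
  rw [B.profile_odd] at this; linarith

lemma max_pos (B : Bistable f F P P' m) : 0 < P (π / 2) := B.level_pos.trans B.level_lt

lemma strictMonoOn_f (B : Bistable f F P P' m) : StrictMonoOn f (Icc 0 (P (π / 2))) :=
  strictMonoOn_of_deriv_pos (convex_Icc _ _) B.continuous_f.continuousOn fun t ht =>
    B.deriv_pos t (interior_subset ht)

lemma abs_f_le (B : Bistable f F P P' m) {t : ℝ} (ht : |t| ≤ P (π / 2)) :
    |f t| ≤ f (P (π / 2)) := by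
  have h : ∀ s ∈ Icc 0 (P (π / 2)), |f s| ≤ f (P (π / 2)) := fun s hs => by
    have h1 := B.strictMonoOn_f.monotoneOn (left_mem_Icc.2 B.max_pos.le) hs hs.1
    rw [B.f_zero] at h1
    rw [abs_of_nonneg h1]
    exact B.strictMonoOn_f.monotoneOn hs (right_mem_Icc.2 B.max_pos.le) hs.2
  rcases le_total 0 t with h0 | h0
  · exact h t ⟨h0, (le_abs_self t).trans ht⟩
  · rw [← abs_neg, ← B.odd]
    exact h (-t) ⟨by linarith, (neg_le_abs t).trans ht⟩

lemma profile_deriv_periodic (B : Bistable f F P P' m) (y : ℝ) : P' (y + 2 * π) = P' y := by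
  refine HasDerivAt.unique ?_ (B.profile_deriv y)
  have := (B.profile_deriv (y + 2 * π)).comp_add_const y (2 * π)
  simpa only [B.profile_periodic] using this

lemma abs_profile_deriv_le (B : Bistable f F P P' m) : ∃ M, ∀ y, |P' y| ≤ M := by
  obtain ⟨M, hM⟩ := isCompact_Icc.exists_bound_of_continuousOn (s := Icc 0 (2 * π))
    B.continuous_profile_deriv.continuousOn
  refine ⟨M, fun y => ?_⟩
  obtain ⟨z, hz, e⟩ := Function.Periodic.exists_mem_Ico₀ B.profile_deriv_periodic
    (by positivity : (0 : ℝ) < 2 * π) y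
  rw [e]
  exact hM z (Ico_subset_Icc_self hz)

lemma reg_profile (B : Bistable f F P P' m) : Reg 1 fun p => P p.2 :=
  ⟨⟨by have := B.continuous_profile; fun_prop, ⟨_, fun p => B.abs_profile_le _⟩,
    fun x y => B.profile_periodic y⟩, fun _ => 0, fun p => P' p.2, Reg0.const 0,
    ⟨by have := B.continuous_profile_deriv; fun_prop, B.abs_profile_deriv_le.imp fun M hM p => hM _,
      fun x y => B.profile_deriv_periodic y⟩,
    fun x y => ⟨hasDerivAt_const x (P y), B.profile_deriv y⟩⟩

/-- The profile is the potential of its own source. -/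
lemma cylConv_profile (B : Bistable f F P P' m) (p : ℝ × ℝ) :
    cylConv kerG (fun p => f (P p.2)) p = P p.2 := by
  obtain ⟨x, y⟩ := p
  obtain ⟨M, hM0, hM⟩ := exists_abs_bound _ B.continuous_deriv_f (P (π / 2))
  obtain ⟨M', hM'⟩ := B.abs_profile_deriv_le
  have hs := cylConv_snd (g := fun y => f (P y)) (g' := fun y => deriv f (P y) * P' y)
    (fun y => (B.hasDerivAt_f _).comp y (B.profile_deriv y))
    (by have := B.continuous_profile; have := B.continuous_profile_deriv
        have := B.continuous_deriv_f; fun_prop)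
    (fun y => by simp only [B.profile_periodic]) (fun y => by simp only [B.profile_odd, B.odd])
    ⟨_, fun y => B.abs_f_le (B.abs_profile_le y)⟩
    ⟨M * M', fun y => by
      rw [abs_mul]
      exact mul_le_mul (hM _ (B.abs_profile_le y)) (hM' y) (abs_nonneg _) hM0⟩
  have h0 : Reg0 fun p : ℝ × ℝ => f (P p.2) := B.reg_profile.reg0.comp B.continuous_f
  set w := fun t => cylConv kerG (fun p => f (P p.2)) (x, t) - P t with hw
  set w' := fun t => cylConv kerY (fun p => f (P p.2)) (x, t) - P' t with hw'
  have d1 : ∀ t, HasDerivAt w (w' t) t := fun t => (hs x t).2.1.sub (B.profile_deriv t)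
  have d2 : ∀ t, HasDerivAt w' 0 t := fun t =>
    ((hs x t).2.2.sub (B.profile_deriv_two t)).congr_deriv (by ring)
  have c : ∀ t, w' t = w' 0 := fun t => is_const_of_deriv_eq_zero
    (fun t => (d2 t).differentiableAt) (fun t => (d2 t).deriv) t 0
  have d3 : ∀ t, HasDerivAt (fun t => w t - w' 0 * t) 0 t := fun t =>
    ((d1 t).sub ((hasDerivAt_id t).const_mul (w' 0))).congr_deriv (by rw [c t]; ring)
  have c3 : ∀ t, w t - w' 0 * t = w 0 - w' 0 * 0 := fun t => is_const_of_deriv_eq_zero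
    (fun t => (d3 t).differentiableAt) (fun t => (d3 t).deriv) t 0
  have w0 : w 0 = 0 := odd_zero fun t => by
    simp only [hw, B.profile_odd]
    rw [cylConv_odd integrable_kerG h0 kerG_even fun x y => by simp only [B.profile_odd, B.odd]]
    ring
  have w2 : w (2 * π) = w 0 := by
    have := (h0.cylConv integrable_kerG).per x 0
    have h2 := B.profile_periodic 0
    rw [zero_add] at this h2
    simp only [hw, this, h2]
  have := c3 (2 * π)
  rw [w2, w0] at this
  have w1 : w' 0 = 0 := by
    have := pi_pos; have h : w' 0 * (2 * π) = 0 := by linarith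
    exact (mul_eq_zero.1 h).resolve_right (by positivity)
  have := c3 y
  rw [w1, w0] at this
  simp only [hw] at this
  linarith

end Bistable

end

lemma cylConv_kerG_mono {h g : ℝ × ℝ → ℝ} (hh : Reg0 h) (hg : Reg0 g)
    (ho : ∀ x y, h (x, -y) = -h (x, y)) (go : ∀ x y, g (x, -y) = -g (x, y))
    (hle : ∀ x, ∀ y ∈ Icc 0 π, h (x, y) ≤ g (x, y)) (x : ℝ) {y : ℝ} (hy : y ∈ Icc 0 π) :
    cylConv kerG h (x, y) ≤ cylConv kerG g (x, y) := by
  have := cylConv_kerG_nonneg (hg.sub hh) (fun x y => by simp only [ho, go]; ring)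
    (fun x y hy => sub_nonneg.2 (hle x y hy)) x hy
  rw [cylConv_sub integrable_kerG hg hh] at this
  linarith

/-- Source term interpolating between `f u` and the source of the profile. -/
def stripSrc (f P a b : ℝ → ℝ) (u : ℝ × ℝ → ℝ) (p : ℝ × ℝ) : ℝ :=
  a p.1 * f (u p) + b p.1 * f (P p.2)

/-- Admissible interpolation weights. -/
structure Weights (a b : ℝ → ℝ) : Prop where
  cont_left : Continuous a
  cont_right : Continuous b
  left_nonneg : ∀ x, 0 ≤ a x
  right_nonneg : ∀ x, 0 ≤ b x
  add_le : ∀ x, a x + b x ≤ 1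
  right_mono : Monotone b
  add_mono : Monotone fun x => a x + b x

lemma Weights.translate {a b : ℝ → ℝ} (w : Weights a b) (t : ℝ) :
    Weights (fun x => a (x + t)) fun x => b (x + t) :=
  ⟨by have := w.cont_left; fun_prop, by have := w.cont_right; fun_prop,
    fun _ => w.left_nonneg _, fun _ => w.right_nonneg _, fun _ => w.add_le _,
    fun _ _ h => w.right_mono (by linarith), fun x z h => w.add_mono (by linarith : x + t ≤ z + t)⟩

/-- Functions on the strip that are nondecreasing in the first variable, lie between `0` and `P`,
and have a fixed Lipschitz constant. -/
structure Front (f P : ℝ → ℝ) (u : ℝ × ℝ → ℝ) : Prop where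
  lip : ∀ x y x' y', |u (x, y) - u (x', y')| ≤
    (kerNorm kerX + kerNorm kerY) * f (P (π / 2)) * (|x - x'| + |y - y'|)
  per : ∀ x y, u (x, y + 2 * π) = u (x, y)
  odd : ∀ x y, u (x, -y) = -u (x, y)
  nonneg : ∀ x, ∀ y ∈ Icc 0 π, 0 ≤ u (x, y)
  le : ∀ x, ∀ y ∈ Icc 0 π, u (x, y) ≤ P y
  mono : ∀ x x', x ≤ x' → ∀ y ∈ Icc 0 π, u (x, y) ≤ u (x', y)

section

variable {f F P P' : ℝ → ℝ} {m : ℝ} {a b : ℝ → ℝ} {u v : ℝ × ℝ → ℝ}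

namespace Front

lemma continuous (h : Front f P u) : Continuous u := by
  refine continuous_iff_continuousAt.2 fun p => ?_
  obtain ⟨x, y⟩ := p
  have h1 : Tendsto (fun q : ℝ × ℝ => (kerNorm kerX + kerNorm kerY) * f (P (π / 2)) *
      (|q.1 - x| + |q.2 - y|)) (𝓝 (x, y)) (𝓝 0) := by
    have : Continuous fun q : ℝ × ℝ => (kerNorm kerX + kerNorm kerY) * f (P (π / 2)) *
      (|q.1 - x| + |q.2 - y|) := by fun_prop
    simpa using this.tendsto (x, y)
  exact tendsto_iff_dist_tendsto_zero.2 (squeeze_zero (fun _ => dist_nonneg)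
    (fun q => h.lip q.1 q.2 x y) h1)

lemma abs_le (h : Front f P u) (B : Bistable f F P P' m) (p : ℝ × ℝ) : |u p| ≤ P (π / 2) := by
  obtain ⟨x, y⟩ := p
  obtain ⟨y', hy', ε, hε, hg⟩ := exists_strip y
  rw [hg (fun t => u (x, t)) (h.per x) (h.odd x), abs_mul, hε, one_mul,
    abs_of_nonneg (h.nonneg x y' hy')]
  exact (h.le x y' hy').trans (B.profile_le y')

lemma reg0 (h : Front f P u) (B : Bistable f F P P' m) : Reg0 u :=
  ⟨h.continuous, ⟨_, h.abs_le B⟩, h.per⟩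

lemma mem (h : Front f P u) (B : Bistable f F P P' m) (x : ℝ) {y : ℝ} (hy : y ∈ Icc 0 π) :
    u (x, y) ∈ Icc 0 (P (π / 2)) := ⟨h.nonneg x y hy, (h.le x y hy).trans (B.profile_le y)⟩

lemma of_tendsto {U : ℕ → ℝ × ℝ → ℝ} (hU : ∀ n, Front f P (U n))
    (hl : ∀ p, Tendsto (fun n => U n p) atTop (𝓝 (u p))) : Front f P u where
  lip x y x' y' := le_of_tendsto ((hl _).sub (hl _)).abs
    (Eventually.of_forall fun n => (hU n).lip x y x' y')
  per x y := tendsto_nhds_unique (hl _) ((hl (x, y)).congr fun n => ((hU n).per x y).symm)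
  odd x y := tendsto_nhds_unique (hl _) ((hl (x, y)).neg.congr fun n => ((hU n).odd x y).symm)
  nonneg x y hy := ge_of_tendsto' (hl _) fun n => (hU n).nonneg x y hy
  le x y hy := le_of_tendsto' (hl _) fun n => (hU n).le x y hy
  mono x x' hx y hy := le_of_tendsto_of_tendsto' (hl _) (hl _) fun n => (hU n).mono x x' hx y hy

lemma translate (h : Front f P u) (t : ℝ) : Front f P fun p => u (p.1 + t, p.2) where
  lip x y x' y' := by simpa using h.lip (x + t) y (x' + t) y'
  per x y := h.per _ _
  odd x y := h.odd _ _
  nonneg x y hy := h.nonneg _ y hy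
  le x y hy := h.le _ y hy
  mono x x' hx y hy := h.mono _ _ (by simpa using hx) y hy

lemma zero (B : Bistable f F P P' m) : Front f P fun _ => 0 where
  lip x y x' y' := by
    have h1 := kerNorm_nonneg kerX
    have h2 := kerNorm_nonneg kerY
    have h3 := (abs_nonneg _).trans (B.abs_f_le (B.abs_profile_le 0))
    simp only [sub_self, abs_zero]
    positivity
  per x y := rfl
  odd x y := by simp
  nonneg x y hy := le_rfl
  le x y hy := B.profile_nonneg y hy
  mono x x' hx y hy := le_rfl

end Front

lemma Weights.abs_stripSrc_le (w : Weights a b) (B : Bistable f F P P' m) (h : Front f P u)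
    (p : ℝ × ℝ) : |stripSrc f P a b u p| ≤ f (P (π / 2)) := by
  have h1 := B.abs_f_le (h.abs_le B p)
  have h2 := B.abs_f_le (B.abs_profile_le p.2)
  refine (abs_add_le _ _).trans ?_
  rw [abs_mul, abs_mul, abs_of_nonneg (w.left_nonneg _), abs_of_nonneg (w.right_nonneg _)]
  have h3 := (abs_nonneg _).trans h1
  nlinarith [w.left_nonneg p.1, w.right_nonneg p.1, w.add_le p.1]

lemma Weights.reg0_stripSrc (w : Weights a b) (B : Bistable f F P P' m) (h : Front f P u) :
    Reg0 (stripSrc f P a b u) where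
  cont := by
    have := w.cont_left; have := w.cont_right; have := B.continuous_f
    have := B.continuous_profile; have := h.continuous
    unfold stripSrc; fun_prop
  bdd := ⟨_, w.abs_stripSrc_le B h⟩
  per x y := by simp only [stripSrc, h.per, B.profile_periodic]

lemma stripSrc_odd (B : Bistable f F P P' m) (h : Front f P u) (x y : ℝ) :
    stripSrc f P a b u (x, -y) = -stripSrc f P a b u (x, y) := by
  simp only [stripSrc, h.odd, B.profile_odd, B.odd]; ring

lemma Weights.stripSrc_mono (w : Weights a b) (B : Bistable f F P P' m) (hu : Front f P u)
    (hv : Front f P v) {x x' : ℝ} (hx : x ≤ x') {y : ℝ} (hy : y ∈ Icc 0 π)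
    (hle : u (x, y) ≤ v (x', y)) :
    stripSrc f P a b u (x, y) ≤ stripSrc f P a b v (x', y) := by
  have h1 := B.strictMonoOn_f.monotoneOn (hu.mem B x hy) (hv.mem B x' hy) hle
  have h2 := B.strictMonoOn_f.monotoneOn (hu.mem B x hy)
    ⟨B.profile_nonneg y hy, B.profile_le y⟩ (hu.le x y hy)
  have h3 := B.strictMonoOn_f.monotoneOn (left_mem_Icc.2 B.max_pos.le) (hu.mem B x hy)
    (hu.nonneg x y hy)
  rw [B.f_zero] at h3
  have h4 := w.right_mono hx
  have h5 := w.add_mono hx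
  simp only [stripSrc] at *
  nlinarith [mul_nonneg (w.left_nonneg x') (sub_nonneg.2 h1), mul_nonneg (sub_nonneg.2 h5) h3,
    mul_nonneg (sub_nonneg.2 h4) (sub_nonneg.2 h2)]

lemma Weights.stripSrc_nonneg (w : Weights a b) (B : Bistable f F P P' m) (h : Front f P u)
    (x : ℝ) {y : ℝ} (hy : y ∈ Icc 0 π) : 0 ≤ stripSrc f P a b u (x, y) := by
  have h1 := B.strictMonoOn_f.monotoneOn (left_mem_Icc.2 B.max_pos.le) (h.mem B x hy)
    (h.nonneg x y hy)
  have h2 := B.strictMonoOn_f.monotoneOn (left_mem_Icc.2 B.max_pos.le)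
    ⟨B.profile_nonneg y hy, B.profile_le y⟩ (B.profile_nonneg y hy)
  rw [B.f_zero] at h1 h2
  exact add_nonneg (mul_nonneg (w.left_nonneg _) h1) (mul_nonneg (w.right_nonneg _) h2)

lemma Weights.stripSrc_le (w : Weights a b) (B : Bistable f F P P' m) (h : Front f P u)
    (x : ℝ) {y : ℝ} (hy : y ∈ Icc 0 π) : stripSrc f P a b u (x, y) ≤ f (P y) := by
  have h1 := B.strictMonoOn_f.monotoneOn (h.mem B x hy)
    ⟨B.profile_nonneg y hy, B.profile_le y⟩ (h.le x y hy)
  have h2 := B.strictMonoOn_f.monotoneOn (left_mem_Icc.2 B.max_pos.le)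
    ⟨B.profile_nonneg y hy, B.profile_le y⟩ (B.profile_nonneg y hy)
  rw [B.f_zero] at h2
  simp only [stripSrc]
  nlinarith [mul_nonneg (w.left_nonneg x) (sub_nonneg.2 h1),
    mul_nonneg (sub_nonneg.2 (w.add_le x)) h2]

/-- The solution operator preserves fronts. -/
lemma Weights.front_cylConv (w : Weights a b) (B : Bistable f F P P' m) (h : Front f P u) :
    Front f P (cylConv kerG (stripSrc f P a b u)) where
  lip x y x' y' := by
    have r := w.reg0_stripSrc B h
    have bd := w.abs_stripSrc_le B h
    have h0 : 0 ≤ f (P (π / 2)) := (abs_nonneg _).trans (B.abs_f_le (B.abs_profile_le 0))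
    refine (partials_cylConv_kerG r).lipschitz (fun p => ?_) (fun p => ?_) x y x' y'
    · refine (abs_cylConv_le integrable_kerX bd p).trans ?_
      exact mul_le_mul_of_nonneg_right (le_add_of_nonneg_right (kerNorm_nonneg _)) h0
    · refine (abs_cylConv_le integrable_kerY bd p).trans ?_
      exact mul_le_mul_of_nonneg_right (le_add_of_nonneg_left (kerNorm_nonneg _)) h0
  per := ((w.reg0_stripSrc B h).cylConv integrable_kerG).per
  odd := cylConv_odd integrable_kerG (w.reg0_stripSrc B h) kerG_even (stripSrc_odd B h)
  nonneg x y hy := cylConv_kerG_nonneg (w.reg0_stripSrc B h) (stripSrc_odd B h)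
    (fun x y hy => w.stripSrc_nonneg B h x hy) x hy
  le x y hy := by
    rw [← B.cylConv_profile (x, y)]
    exact cylConv_kerG_mono (w.reg0_stripSrc B h) (B.reg_profile.reg0.comp B.continuous_f)
      (stripSrc_odd B h) (fun x y => by simp only [B.profile_odd, B.odd])
      (fun x y hy => w.stripSrc_le B h x hy) x hy
  mono x x' hx y hy := by
    have r := w.reg0_stripSrc B h
    have e : (x', y) = (x, y) + (x' - x, 0) := by simp
    rw [e, ← cylConv_translate]
    refine cylConv_kerG_mono r ⟨by have := r.cont; fun_prop,
      r.bdd.imp fun M hM p => hM _, fun s t => ?_⟩ (stripSrc_odd B h) (fun s t => ?_)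
      (fun s t ht => ?_) x hy
    · simpa using r.per (s + (x' - x)) t
    · simpa using stripSrc_odd B h (s + (x' - x)) t
    · simpa using w.stripSrc_mono B h h (by linarith : s ≤ s + (x' - x)) ht
        (h.mono _ _ (by linarith) t ht)

/-- Passage to the limit in the fixed point equation, along possibly moving base points. -/
lemma tendsto_cylConv_stripSrc {k : ℝ × ℝ → ℝ} (hk : Integrable k cylMeasure)
    (B : Bistable f F P P' m) {A A' : ℕ → ℝ → ℝ}
    {U : ℕ → ℝ × ℝ → ℝ} (w : ∀ n, Weights (A n) (A' n)) (hU : ∀ n, Front f P (U n))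
    (ha : ∀ x, Tendsto (fun n => A n x) atTop (𝓝 (a x)))
    (hb : ∀ x, Tendsto (fun n => A' n x) atTop (𝓝 (b x)))
    (hu : ∀ p, Tendsto (fun n => U n p) atTop (𝓝 (u p))) (p : ℝ × ℝ) :
    Tendsto (fun n => cylConv k (stripSrc f P (A n) (A' n) (U n)) p) atTop
      (𝓝 (cylConv k (stripSrc f P a b u) p)) := by
  refine tendsto_cylConv hk (fun n => ((w n).reg0_stripSrc B (hU n)).cont)
    (fun n => (w n).abs_stripSrc_le B (hU n)) (P := fun _ => p) fun q => ?_
  exact ((ha _).mul ((B.continuous_f.tendsto _).comp (hu _))).add ((hb _).mul_const _)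

lemma exists_tendsto_of_strip {U : ℕ → ℝ × ℝ → ℝ} (hU : ∀ n, Front f P (U n))
    (h : ∀ x, ∀ y ∈ Icc 0 π, ∃ l, Tendsto (fun n => U n (x, y)) atTop (𝓝 l)) :
    ∃ u : ℝ × ℝ → ℝ, ∀ p, Tendsto (fun n => U n p) atTop (𝓝 (u p)) := by
  have : ∀ p : ℝ × ℝ, ∃ l, Tendsto (fun n => U n p) atTop (𝓝 l) := fun ⟨x, y⟩ => by
    obtain ⟨y', hy', ε, -, hg⟩ := exists_strip y
    obtain ⟨l, hl⟩ := h x y' hy'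
    exact ⟨ε * l, (hl.const_mul ε).congr fun n =>
      (hg (fun t => U n (x, t)) ((hU n).per x) ((hU n).odd x)).symm⟩
  choose u hu using this
  exact ⟨u, hu⟩

/-- Existence of fronts by monotone iteration. -/
lemma Weights.exists_front (w : Weights a b) (B : Bistable f F P P' m) :
    ∃ u, Front f P u ∧ ∀ p, u p = cylConv kerG (stripSrc f P a b u) p := by
  let U : ℕ → ℝ × ℝ → ℝ := fun n => (fun u => cylConv kerG (stripSrc f P a b u))^[n] fun _ => 0
  have hs : ∀ n, U (n + 1) = cylConv kerG (stripSrc f P a b (U n)) := fun n =>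
    Function.iterate_succ_apply' _ _ _
  have hU : ∀ n, Front f P (U n) := fun n => by
    induction n with
    | zero => exact Front.zero B
    | succ n ih => rw [hs]; exact w.front_cylConv B ih
  have hm : ∀ n x, ∀ y ∈ Icc 0 π, U n (x, y) ≤ U (n + 1) (x, y) := fun n => by
    induction n with
    | zero => exact fun x y hy => (hU 1).nonneg x y hy
    | succ n ih =>
      intro x y hy
      rw [hs, hs]
      exact cylConv_kerG_mono (w.reg0_stripSrc B (hU _)) (w.reg0_stripSrc B (hU _))
        (stripSrc_odd B (hU _)) (stripSrc_odd B (hU _)) (fun x y hy =>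
          w.stripSrc_mono B (hU _) (hU _) le_rfl hy (ih x y hy)) x hy
  obtain ⟨u, hu⟩ := exists_tendsto_of_strip hU fun x y hy =>
    ⟨_, tendsto_atTop_ciSup (monotone_nat_of_le_succ fun n => hm n x y hy)
      ⟨P (π / 2), by rintro _ ⟨n, rfl⟩; exact ((hU n).mem B x hy).2⟩⟩
  refine ⟨u, Front.of_tendsto hU hu, fun p => ?_⟩
  have h1 := tendsto_cylConv_stripSrc integrable_kerG B (fun _ => w) hU
    (fun x => tendsto_const_nhds) (fun x => tendsto_const_nhds) hu p
  refine tendsto_nhds_unique ((tendsto_add_atTop_iff_nat 1).2 (hu p)) (h1.congr fun n => ?_)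
  rw [hs]

end

section

variable {f F P P' : ℝ → ℝ} {m : ℝ} {a b : ℝ → ℝ} {u v : ℝ × ℝ → ℝ}

/-- Fronts solving the interpolated equation. -/
structure StripSol (f P a b : ℝ → ℝ) (u : ℝ × ℝ → ℝ) : Prop where
  weights : Weights a b
  front : Front f P u
  fixed : ∀ p, u p = cylConv kerG (stripSrc f P a b u) p

namespace StripSol

lemma translate (S : StripSol f P a b u) (t : ℝ) :
    StripSol f P (fun x => a (x + t)) (fun x => b (x + t)) fun p => u (p.1 + t, p.2) where
  weights := S.weights.translate t
  front := S.front.translate t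
  fixed p := by
    have e : ∀ q : ℝ × ℝ, q + (t, 0) = (q.1 + t, q.2) := fun q => by ext <;> simp
    rw [S.fixed, ← e p, ← cylConv_translate]
    simp only [e]; rfl

lemma of_tendsto (B : Bistable f F P P' m) {A A' : ℕ → ℝ → ℝ}
    {U : ℕ → ℝ × ℝ → ℝ} (S : ∀ n, StripSol f P (A n) (A' n) (U n)) (w : Weights a b)
    (ha : ∀ x, Tendsto (fun n => A n x) atTop (𝓝 (a x)))
    (hb : ∀ x, Tendsto (fun n => A' n x) atTop (𝓝 (b x)))
    (hu : ∀ p, Tendsto (fun n => U n p) atTop (𝓝 (u p))) : StripSol f P a b u where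
  weights := w
  front := Front.of_tendsto (fun n => (S n).front) hu
  fixed p := tendsto_nhds_unique (hu p) ((tendsto_cylConv_stripSrc integrable_kerG B
    (fun n => (S n).weights) (fun n => (S n).front) ha hb hu p).congr fun n =>
      ((S n).fixed p).symm)

lemma eq_zero (S : StripSol f P (fun _ => 0) (fun _ => 0) u) (p : ℝ × ℝ) : u p = 0 := by
  rw [S.fixed, show stripSrc f P (fun _ => 0) (fun _ => 0) u = fun _ => 0 by
    ext; simp [stripSrc], cylConv_zero]

lemma eq_profile (S : StripSol f P (fun _ => 0) (fun _ => 1) u) (B : Bistable f F P P' m)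
    (p : ℝ × ℝ) : u p = P p.2 := by
  rw [S.fixed, show stripSrc f P (fun _ => 0) (fun _ => 1) u = fun p => f (P p.2) by
    ext; simp [stripSrc], B.cylConv_profile]

end StripSol

lemma Front.exists_tendsto_atTop (h : Front f P u) (B : Bistable f F P P' m) :
    ∃ Q : ℝ → ℝ, ∀ y, Tendsto (fun x => u (x, y)) atTop (𝓝 (Q y)) := by
  have : ∀ y, ∃ l, Tendsto (fun x => u (x, y)) atTop (𝓝 l) := fun y => by
    obtain ⟨y', hy', ε, -, hg⟩ := exists_strip y
    have h1 := tendsto_atTop_ciSup (f := fun x => u (x, y'))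
      (fun x x' hx => h.mono x x' hx y' hy')
      ⟨P (π / 2), by rintro _ ⟨x, rfl⟩; exact (h.mem B x hy').2⟩
    exact ⟨_, (h1.const_mul ε).congr fun x =>
      (hg (fun t => u (x, t)) (h.per x) (h.odd x)).symm⟩
  exact ⟨_, fun y => (this y).choose_spec⟩

lemma Front.exists_tendsto_atBot (h : Front f P u) :
    ∃ Q : ℝ → ℝ, ∀ y, Tendsto (fun x => u (x, y)) atBot (𝓝 (Q y)) := by
  have : ∀ y, ∃ l, Tendsto (fun x => u (x, y)) atBot (𝓝 l) := fun y => by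
    obtain ⟨y', hy', ε, -, hg⟩ := exists_strip y
    have h1 := tendsto_atBot_ciInf (f := fun x => u (x, y'))
      (fun x x' hx => h.mono x x' hx y' hy')
      ⟨0, by rintro _ ⟨x, rfl⟩; exact h.nonneg x y' hy'⟩
    exact ⟨_, (h1.const_mul ε).congr fun x =>
      (hg (fun t => u (x, t)) (h.per x) (h.odd x)).symm⟩
  exact ⟨_, fun y => (this y).choose_spec⟩

/-- The state reached at infinity, as a solution of the limiting one-dimensional problem. -/
lemma StripSol.at_infinity (S : StripSol f P a b u) (B : Bistable f F P P' m) {l : Filter ℝ}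
    {x : ℕ → ℝ} (hx : ∀ s, Tendsto (fun n => s + x n) atTop l) {A A' : ℝ}
    (ha : Tendsto a l (𝓝 A)) (hb : Tendsto b l (𝓝 A')) {Q : ℝ → ℝ}
    (hQ : ∀ y, Tendsto (fun s => u (s, y)) l (𝓝 (Q y))) :
    StripSol f P (fun _ => A) (fun _ => A') (fun p => Q p.2) ∧
    ∀ k, Integrable k cylMeasure → ∀ y,
      Tendsto (fun n => cylConv k (stripSrc f P a b u) (x n, y)) atTop
        (𝓝 (cylConv k (stripSrc f P (fun _ => A) (fun _ => A') fun p => Q p.2) (0, y))) := by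
  have hw : Weights (fun _ => A) fun _ => A' := by
    have := S.weights
    have h1 := ha.comp (hx 0)
    have h2 := hb.comp (hx 0)
    exact ⟨continuous_const, continuous_const, fun _ => ge_of_tendsto' h1 fun n =>
      this.left_nonneg _, fun _ => ge_of_tendsto' h2 fun n => this.right_nonneg _,
      fun _ => le_of_tendsto' (h1.add h2) fun n => this.add_le _, monotone_const, monotone_const⟩
  refine ⟨StripSol.of_tendsto B (fun n => S.translate (x n)) hw (fun s => ha.comp (hx s))
    (fun s => hb.comp (hx s)) fun p => (hQ _).comp (hx _), fun k hk y => ?_⟩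
  refine tendsto_cylConv hk (fun n => (S.weights.reg0_stripSrc B S.front).cont)
    (fun n => S.weights.abs_stripSrc_le B S.front) fun q => ?_
  have e : ∀ n, (x n, y) - q = (-q.1 + x n, y - q.2) := fun n => by ext <;> simp; ring
  simp only [stripSrc, e]
  exact ((ha.comp (hx _)).mul ((B.continuous_f.tendsto _).comp ((hQ _).comp (hx _)))).add
    ((hb.comp (hx _)).mul_const _)

lemma StripSol.ode {A A' : ℝ} {Q : ℝ → ℝ}
    (S : StripSol f P (fun _ => A) (fun _ => A') fun p => Q p.2) (B : Bistable f F P P' m) :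
    ∃ Q' : ℝ → ℝ, (∀ y, HasDerivAt Q (Q' y) y) ∧
      (∀ y, HasDerivAt Q' (-(A * f (Q y) + A' * f (P y))) y) ∧ Q 0 = 0 ∧ Q π = 0 ∧ ∀ y,
      cylConv kerX (stripSrc f P (fun _ => A) (fun _ => A') fun p => Q p.2) (0, y) = 0 ∧
      cylConv kerY (stripSrc f P (fun _ => A) (fun _ => A') fun p => Q p.2) (0, y) = Q' y := by
  have r := S.weights.reg0_stripSrc B S.front
  set s := stripSrc f P (fun _ => A) (fun _ => A') fun p => Q p.2 with hs
  have hQ : ∀ y, HasDerivAt Q (cylConv kerY s (0, y)) y := fun y =>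
    ((partials_cylConv_kerG r 0 y).2).congr_of_eventuallyEq
      (Eventually.of_forall fun t => S.fixed (0, t))
  have rY := r.cylConv integrable_kerY
  have cP := B.continuous_profile
  have cP' := B.continuous_profile_deriv
  have cf := B.continuous_deriv_f
  have cQ : Continuous Q := continuous_iff_continuousAt.2 fun y => (hQ y).continuousAt
  have cQ' : Continuous fun y => cylConv kerY s (0, y) := by have := rY.cont; fun_prop
  obtain ⟨M, hM0, hM⟩ := exists_abs_bound _ B.continuous_deriv_f (P (π / 2))
  obtain ⟨M1, hM1⟩ := B.abs_profile_deriv_le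
  obtain ⟨M2, hM2⟩ := rY.bdd
  have key := cylConv_snd (g := fun y => A * f (Q y) + A' * f (P y))
    (g' := fun y => A * (deriv f (Q y) * cylConv kerY s (0, y)) + A' * (deriv f (P y) * P' y))
    (fun y => (((B.hasDerivAt_f _).comp y (hQ y)).const_mul A).add
      (((B.hasDerivAt_f _).comp y (B.profile_deriv y)).const_mul A'))
    (by fun_prop) (fun y => by
      have := S.front.per 0 y
      simp only at this
      simp only [B.profile_periodic, this])
    (fun y => by
      have := S.front.odd 0 y
      simp only at this
      simp only [B.profile_odd, this, B.odd]; ring)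
    ⟨_, fun y => S.weights.abs_stripSrc_le B S.front (0, y)⟩
    ⟨|A| * (M * M2) + |A'| * (M * M1), fun y => by
      refine (abs_add_le _ _).trans (add_le_add ?_ ?_)
      · rw [abs_mul, abs_mul]
        exact mul_le_mul_of_nonneg_left (mul_le_mul (hM _ (S.front.abs_le B (0, y))) (hM2 _)
          (abs_nonneg _) hM0) (abs_nonneg _)
      · rw [abs_mul, abs_mul]
        exact mul_le_mul_of_nonneg_left (mul_le_mul (hM _ (B.abs_profile_le y)) (hM1 _)
          (abs_nonneg _) hM0) (abs_nonneg _)⟩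
  exact ⟨_, hQ, fun y => (key 0 y).2.2, odd_zero (S.front.odd 0),
    odd_periodic_pi (S.front.per 0) (S.front.odd 0), fun y => ⟨(key 0 y).1, rfl⟩⟩

lemma tendsto_subseq_trichotomy (t : ℕ → ℝ) : ∃ φ : ℕ → ℕ, StrictMono φ ∧
    (Tendsto (t ∘ φ) atTop atBot ∨ (∃ l, Tendsto (t ∘ φ) atTop (𝓝 l)) ∨
      Tendsto (t ∘ φ) atTop atTop) := by
  obtain ⟨l, φ, hφ, h⟩ := CompactSpace.tendsto_subseq fun n => (t n : EReal)
  refine ⟨φ, hφ, ?_⟩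
  induction l with
  | bot => exact Or.inl (EReal.tendsto_coe_nhds_bot_iff.1 h)
  | coe l => exact Or.inr (Or.inl ⟨l, EReal.tendsto_coe.1 h⟩)
  | top => exact Or.inr (Or.inr (EReal.tendsto_coe_nhds_top_iff.1 h))

lemma Front.exists_subseq (B : Bistable f F P P' m) {U : ℕ → ℝ × ℝ → ℝ}
    (hU : ∀ n, Front f P (U n)) : ∃ φ : ℕ → ℕ, StrictMono φ ∧ ∃ u : ℝ × ℝ → ℝ,
      ∀ p, Tendsto (fun n => U (φ n) p) atTop (𝓝 (u p)) := by
  let d := TopologicalSpace.denseSeq (ℝ × ℝ)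
  have hd : DenseRange d := TopologicalSpace.denseRange_denseSeq _
  obtain ⟨l, φ, hφ, h⟩ := CompactSpace.tendsto_subseq
    fun n => (fun i => ⟨U n (d i), _root_.abs_le.1 ((hU n).abs_le B (d i))⟩ :
      ℕ → Icc (-P (π / 2)) (P (π / 2)))
  have h' : ∀ i, Tendsto (fun n => U (φ n) (d i)) atTop (𝓝 (l i : ℝ)) := fun i =>
    (continuous_subtype_val.tendsto _).comp (tendsto_pi_nhds.1 h i)
  refine ⟨φ, hφ, ?_⟩
  have : ∀ p : ℝ × ℝ, ∃ l, Tendsto (fun n => U (φ n) p) atTop (𝓝 l) := fun p => by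
    refine cauchySeq_tendsto_of_complete (Metric.cauchySeq_iff'.2 fun ε hε => ?_)
    set L := (kerNorm kerX + kerNorm kerY) * f (P (π / 2)) with hL
    have hc : Continuous fun q : ℝ × ℝ => L * (|p.1 - q.1| + |p.2 - q.2|) := by fun_prop
    have ho : IsOpen {q : ℝ × ℝ | L * (|p.1 - q.1| + |p.2 - q.2|) < ε / 3} :=
      isOpen_lt hc continuous_const
    obtain ⟨i, hi⟩ := hd.exists_mem_open ho
      ⟨p, by simpa using hε⟩
    obtain ⟨N, hN⟩ := Metric.cauchySeq_iff'.1 (h' i).cauchySeq (ε / 3) (by positivity)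
    refine ⟨N, fun n hn => ?_⟩
    have e1 := (hU (φ n)).lip p.1 p.2 (d i).1 (d i).2
    have e2 := (hU (φ N)).lip p.1 p.2 (d i).1 (d i).2
    have e3 := hN n hn
    simp only [Set.mem_ofPred_eq] at hi
    rw [Real.dist_eq] at e3 ⊢
    have : U (φ n) p - U (φ N) p = (U (φ n) p - U (φ n) (d i)) +
      (U (φ n) (d i) - U (φ N) (d i)) - (U (φ N) p - U (φ N) (d i)) := by ring
    rw [this]
    refine (abs_sub _ _).trans_lt ?_
    have := abs_add_le (U (φ n) p - U (φ n) (d i)) (U (φ n) (d i) - U (φ N) (d i))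
    simp only [Prod.mk.eta] at e1 e2
    linarith
  exact ⟨_, fun p => (this p).choose_spec⟩

end

/-- A smooth increasing transition from `0` to `1`. -/
noncomputable def ramp (x : ℝ) : ℝ := 1 / 2 + arctan x / π

lemma ramp_pos (x : ℝ) : 0 < ramp x := by
  have := neg_pi_div_two_lt_arctan x
  have h : -(1 / 2) < arctan x / π := by rw [lt_div_iff₀ pi_pos]; linarith
  unfold ramp; linarith

lemma ramp_lt_one (x : ℝ) : ramp x < 1 := by
  have := arctan_lt_pi_div_two x
  have h : arctan x / π < 1 / 2 := by rw [div_lt_iff₀ pi_pos]; linarith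
  unfold ramp; linarith

lemma continuous_ramp : Continuous ramp := by
  have := continuous_arctan
  unfold ramp; fun_prop

lemma monotone_ramp : Monotone ramp := fun x y h => by
  unfold ramp
  have := arctan_strictMono.monotone h
  have := pi_pos
  gcongr

lemma tendsto_ramp_atTop : Tendsto ramp atTop (𝓝 1) := by
  have h : Tendsto arctan atTop (𝓝 (π / 2)) := tendsto_arctan_atTop.mono_right nhdsWithin_le_nhds
  have e : 1 / 2 + π / 2 / π = 1 := by field_simp; norm_num
  exact e ▸ (h.div_const π).const_add (1 / 2)

lemma tendsto_ramp_atBot : Tendsto ramp atBot (𝓝 0) := by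
  have h : Tendsto arctan atBot (𝓝 (-(π / 2))) :=
    tendsto_arctan_atBot.mono_right nhdsWithin_le_nhds
  have e : 1 / 2 + -(π / 2) / π = 0 := by field_simp; norm_num
  exact e ▸ (h.div_const π).const_add (1 / 2)

lemma hasDerivAt_ramp (x : ℝ) : HasDerivAt ramp ((1 + x ^ 2)⁻¹ / π) x := by
  unfold ramp
  simpa using ((hasDerivAt_arctan x).div_const π).const_add (1 / 2)

lemma weights_mul {α β : ℝ → ℝ} (hα : Continuous α) (hβ : Continuous β) (mα : Monotone α)
    (mβ : Monotone β) (α0 : ∀ x, 0 ≤ α x) (β0 : ∀ x, 0 ≤ β x) (α1 : ∀ x, α x ≤ 1)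
    (β1 : ∀ x, β x ≤ 1) : Weights (fun x => α x * (1 - β x)) fun x => α x * β x where
  cont_left := by fun_prop
  cont_right := by fun_prop
  left_nonneg x := mul_nonneg (α0 x) (sub_nonneg.2 (β1 x))
  right_nonneg x := mul_nonneg (α0 x) (β0 x)
  add_le x := by linarith [α1 x]
  right_mono x y h := mul_le_mul (mα h) (mβ h) (β0 x) (α0 y)
  add_mono x y h := by simp only; linarith [mα h]

/-- Continuous nondecreasing functions with values in the unit interval. -/
structure Cutoff (α : ℝ → ℝ) : Prop where
  cont : Continuous α
  mono : Monotone α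
  nonneg : ∀ x, 0 ≤ α x
  le_one : ∀ x, α x ≤ 1

lemma Cutoff.const {c : ℝ} (h0 : 0 ≤ c) (h1 : c ≤ 1) : Cutoff fun _ => c :=
  ⟨continuous_const, monotone_const, fun _ => h0, fun _ => h1⟩

lemma cutoff_ramp (t : ℝ) : Cutoff fun x => ramp (x + t) :=
  ⟨by have := continuous_ramp; fun_prop, fun x y h => monotone_ramp (by linarith),
    fun x => (ramp_pos _).le, fun x => (ramp_lt_one _).le⟩

lemma Cutoff.weights {α β : ℝ → ℝ} (hα : Cutoff α) (hβ : Cutoff β) :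
    Weights (fun x => α x * (1 - β x)) fun x => α x * β x :=
  weights_mul hα.cont hβ.cont hα.mono hβ.mono hα.nonneg hβ.nonneg hα.le_one hβ.le_one

section

variable {f F P P' : ℝ → ℝ} {m : ℝ}

/-- Solutions on a long but finite transition window, centred at level `m`. -/
lemma exists_centered (B : Bistable f F P P' m) (n : ℕ) : ∃ x : ℝ, ∃ u : ℝ × ℝ → ℝ,
    StripSol f P (fun s => ramp (s + (x + n)) * (1 - ramp (s + (x - n))))
      (fun s => ramp (s + (x + n)) * ramp (s + (x - n))) u ∧ u (0, π / 2) = m := by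
  have w := (cutoff_ramp n).weights (cutoff_ramp (-n))
  obtain ⟨u, hu, hfix⟩ := w.exists_front B
  have S : StripSol f P _ _ u := ⟨w, hu, hfix⟩
  have top : ∀ t : ℝ, Tendsto (fun x => ramp (x + t)) atTop (𝓝 1) := fun t =>
    tendsto_ramp_atTop.comp (tendsto_atTop_add_const_right _ t tendsto_id)
  have bot : ∀ t : ℝ, Tendsto (fun x => ramp (x + t)) atBot (𝓝 0) := fun t =>
    tendsto_ramp_atBot.comp (tendsto_atBot_add_const_right _ t tendsto_id)
  obtain ⟨Q, hQ⟩ := hu.exists_tendsto_atTop B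
  obtain ⟨R, hR⟩ := hu.exists_tendsto_atBot
  have S1 := (S.at_infinity B (x := fun n => n)
    (fun s => tendsto_atTop_add_const_left _ s tendsto_natCast_atTop_atTop)
    ((top n).mul ((top (-n)).const_sub 1)) ((top n).mul (top (-n))) hQ).1
  have S2 := (S.at_infinity B (x := fun n => -n)
    (fun s => tendsto_atBot_add_const_left _ s
      (tendsto_neg_atTop_atBot.comp tendsto_natCast_atTop_atTop))
    ((bot n).mul ((bot (-n)).const_sub 1)) ((bot n).mul (bot (-n))) hR).1
  norm_num at S1 S2
  have q := S1.eq_profile B (0, π / 2)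
  have r := S2.eq_zero (0, π / 2)
  simp only at q r
  have c : Continuous fun x => u (x, π / 2) := by have := hu.continuous; fun_prop
  obtain ⟨x1, h1⟩ := ((hQ (π / 2)).eventually_const_le (q ▸ B.level_lt)).exists
  obtain ⟨x2, h2⟩ := ((hR (π / 2)).eventually_le_const (r ▸ B.level_pos)).exists
  obtain ⟨x, hx⟩ := mem_range_of_exists_le_of_exists_ge c ⟨x2, h2⟩ ⟨x1, h1⟩
  refine ⟨x, fun p => u (p.1 + x, p.2), ?_, by simpa using hx⟩
  have := S.translate x
  simpa only [add_assoc, sub_eq_add_neg] using this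

/-- The possible limits of centred solutions as the window becomes infinite. -/
lemma exists_stripSol (B : Bistable f F P P' m) : ∃ u : ℝ × ℝ → ℝ, u (0, π / 2) = m ∧
    (StripSol f P (fun _ => 1) (fun _ => 0) u ∨
      (∃ t, StripSol f P (fun x => ramp (x + t)) (fun _ => 0) u) ∨
      ∃ t, StripSol f P (fun x => 1 - ramp (x + t)) (fun x => ramp (x + t)) u) := by
  choose x U S hm using exists_centered B
  obtain ⟨φ₁, h₁, t₁⟩ := tendsto_subseq_trichotomy fun n => x n + n
  obtain ⟨φ₂, h₂, t₂⟩ := tendsto_subseq_trichotomy ((fun n => x n - n) ∘ φ₁)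
  obtain ⟨φ₃, h₃, u, hu⟩ := Front.exists_subseq B fun n => (S (φ₁ (φ₂ n))).front
  set ψ := φ₁ ∘ φ₂ ∘ φ₃ with hψ
  have tψ : Tendsto ψ atTop atTop := (h₁.comp (h₂.comp h₃)).tendsto_atTop
  have hu : ∀ p, Tendsto (fun n => U (ψ n) p) atTop (𝓝 (u p)) := hu
  have r₁ : ∀ {l}, Tendsto ((fun n => x n + n) ∘ φ₁) atTop l →
      Tendsto (fun n => x (ψ n) + ψ n) atTop l := fun h => h.comp (h₂.comp h₃).tendsto_atTop
  have r₂ : ∀ {l}, Tendsto (((fun n => x n - n) ∘ φ₁) ∘ φ₂) atTop l →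
      Tendsto (fun n => x (ψ n) - ψ n) atTop l := fun h => h.comp h₃.tendsto_atTop
  have top : ∀ {t : ℕ → ℝ}, Tendsto t atTop atTop → ∀ s,
      Tendsto (fun n => ramp (s + t n)) atTop (𝓝 1) := fun h s =>
    tendsto_ramp_atTop.comp (tendsto_atTop_add_const_left _ s h)
  have bot : ∀ {t : ℕ → ℝ}, Tendsto t atTop atBot → ∀ s,
      Tendsto (fun n => ramp (s + t n)) atTop (𝓝 0) := fun h s =>
    tendsto_ramp_atBot.comp (tendsto_atBot_add_const_left _ s h)
  have mid : ∀ {t : ℕ → ℝ} {l : ℝ}, Tendsto t atTop (𝓝 l) → ∀ s,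
      Tendsto (fun n => ramp (s + t n)) atTop (𝓝 (ramp (s + l))) := fun h s =>
    (continuous_ramp.tendsto _).comp (h.const_add s)
  have lim : ∀ {α β : ℝ → ℝ}, Cutoff α → Cutoff β →
      (∀ s, Tendsto (fun n => ramp (s + (x (ψ n) + ψ n))) atTop (𝓝 (α s))) →
      (∀ s, Tendsto (fun n => ramp (s + (x (ψ n) - ψ n))) atTop (𝓝 (β s))) →
      StripSol f P (fun s => α s * (1 - β s)) (fun s => α s * β s) u := fun hα hβ ta tb =>
    StripSol.of_tendsto B (fun n => S (ψ n)) (hα.weights hβ)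
      (fun s => (ta s).mul ((tb s).const_sub 1)) (fun s => (ta s).mul (tb s)) hu
  have c0 := Cutoff.const (c := 0) le_rfl zero_le_one
  have c1 := Cutoff.const (c := 1) zero_le_one le_rfl
  have hum : u (0, π / 2) = m :=
    tendsto_nhds_unique (hu _) (tendsto_const_nhds.congr fun n => (hm _).symm)
  have nn : Tendsto (fun n => -(2 * (ψ n : ℝ))) atTop atBot :=
    tendsto_neg_atTop_atBot.comp ((tendsto_natCast_atTop_atTop.comp tψ).const_mul_atTop two_pos)
  have hdiff : ∀ n, x (ψ n) - ψ n = x (ψ n) + ψ n + -(2 * (ψ n : ℝ)) := fun n => by ring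
  refine ⟨u, hum, ?_⟩
  rcases t₁ with t₁ | ⟨l, t₁⟩ | t₁
  · have t : Tendsto (fun n => x (ψ n) - ψ n) atTop atBot :=
      (Filter.Tendsto.atBot_add_atBot (r₁ t₁) nn).congr fun n => (hdiff n).symm
    have := lim c0 c0 (bot (r₁ t₁)) (bot t)
    norm_num at this
    exact absurd (hum.symm.trans (this.eq_zero _)) B.level_pos.ne'
  · have t : Tendsto (fun n => x (ψ n) - ψ n) atTop atBot :=
      (Filter.Tendsto.add_atBot (r₁ t₁) nn).congr fun n => (hdiff n).symm
    have := lim (cutoff_ramp l) c0 (mid (r₁ t₁)) (bot t)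
    norm_num at this
    exact Or.inr (Or.inl ⟨l, this⟩)
  · rcases t₂ with t₂ | ⟨l, t₂⟩ | t₂
    · have := lim c1 c0 (top (r₁ t₁)) (bot (r₂ t₂))
      norm_num at this
      exact Or.inl this
    · have := lim c1 (cutoff_ramp l) (top (r₁ t₁)) (mid (r₂ t₂))
      simp only [one_mul] at this
      exact Or.inr (Or.inr ⟨l, this⟩)
    · have := lim c1 c1 (top (r₁ t₁)) (top (r₂ t₂))
      norm_num at this
      exact absurd (hum.symm.trans (this.eq_profile B _)) B.level_lt.ne

end

lemma eq_zero_of_monotone_limits {H H' : ℝ → ℝ} (hd : ∀ x, HasDerivAt H (H' x) x)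
    (h0 : ∀ x, 0 ≤ H' x) {l r : ℝ} (hl : Tendsto (fun n : ℕ => H (-n)) atTop (𝓝 l))
    (hr : Tendsto (fun n : ℕ => H n) atTop (𝓝 r)) (hlr : r ≤ l) (x : ℝ) : H' x = 0 := by
  have mono : Monotone H := monotone_of_deriv_nonneg (fun x => (hd x).differentiableAt)
    fun x => (hd x).deriv ▸ h0 x
  have key : ∀ x, H x = l := fun x => by
    apply le_antisymm
    · refine (ge_of_tendsto hr ?_).trans hlr
      filter_upwards [tendsto_natCast_atTop_atTop.eventually_ge_atTop x] with n hn using mono hn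
    · refine le_of_tendsto hl ?_
      filter_upwards [tendsto_natCast_atTop_atTop.eventually_ge_atTop (-x)] with n hn
      exact mono (by linarith)
  have := hd x
  rw [funext key] at this
  exact this.unique (hasDerivAt_const x l)

/-- The tangent line of `F` at `P y`, evaluated at `v`. -/
def tangent (f F P : ℝ → ℝ) (y v : ℝ) : ℝ := f (P y) * (v - P y) + F (P y)

section

variable {f F P P' : ℝ → ℝ} {m : ℝ} {a b a' b' : ℝ → ℝ} {u : ℝ × ℝ → ℝ}

namespace Bistable

lemma tangent_lt (B : Bistable f F P P' m) {v w : ℝ} (hv : v ∈ Icc 0 (P (π / 2)))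
    (hw : w ∈ Icc 0 (P (π / 2))) (h : v ≠ w) : f w * (v - w) + F w < F v := by
  have hc : ∀ s : Set ℝ, ContinuousOn F s := fun s => B.continuous_primitive.continuousOn
  rcases h.lt_or_gt with h | h
  · obtain ⟨z, hz, e⟩ := exists_hasDerivAt_eq_slope F f h (hc _) fun t _ => B.primitive t
    have := B.strictMonoOn_f ⟨hv.1.trans hz.1.le, hz.2.le.trans hw.2⟩ hw hz.2
    rw [e, div_lt_iff₀ (by linarith)] at this
    linarith
  · obtain ⟨z, hz, e⟩ := exists_hasDerivAt_eq_slope F f h (hc _) fun t _ => B.primitive t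
    have := B.strictMonoOn_f hw ⟨hw.1.trans hz.1.le, hz.2.le.trans hv.2⟩ hz.1
    rw [e, lt_div_iff₀ (by linarith)] at this
    linarith

lemma primitive_pos (B : Bistable f F P P' m) {v : ℝ} (hv : v ∈ Icc 0 (P (π / 2)))
    (h : v ≠ 0) : 0 < F v := by
  simpa [B.f_zero, B.primitive_zero] using B.tangent_lt hv ⟨le_rfl, B.max_pos.le⟩ h

lemma primitive_nonneg (B : Bistable f F P P' m) {v : ℝ} (hv : v ∈ Icc 0 (P (π / 2))) :
    0 ≤ F v := by
  rcases eq_or_ne v 0 with rfl | h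
  · exact B.primitive_zero.ge
  · exact (B.primitive_pos hv h).le

lemma tangent_le (B : Bistable f F P P' m) {v w : ℝ} (hv : v ∈ Icc 0 (P (π / 2)))
    (hw : w ∈ Icc 0 (P (π / 2))) : f w * (v - w) + F w ≤ F v := by
  rcases eq_or_ne v w with rfl | h
  · simp
  · exact (B.tangent_lt hv hw h).le

end Bistable

lemma Weights.reg_fst (hc : Continuous a) (h0 : ∃ M, ∀ x, |a x| ≤ M)
    (hd : ∀ x, HasDerivAt a (a' x) x) (hc' : Continuous a') (h1 : ∃ M, ∀ x, |a' x| ≤ M) :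
    Reg 1 fun p => a p.1 := by
  obtain ⟨M, hM⟩ := h0
  obtain ⟨M', hM'⟩ := h1
  exact ⟨⟨by fun_prop, ⟨M, fun p => hM _⟩, fun _ _ => rfl⟩, fun p => a' p.1, fun _ => 0,
    ⟨by fun_prop, ⟨M', fun p => hM' _⟩, fun _ _ => rfl⟩, Reg0.const 0,
    fun x y => ⟨hd x, hasDerivAt_const y (a x)⟩⟩

namespace StripSol

lemma reg_one (S : StripSol f P a b u) (B : Bistable f F P P' m) : Reg 1 u := by
  rw [funext S.fixed]
  exact Reg.cylConv_kerG (n := 0) (S.weights.reg0_stripSrc B S.front)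

lemma partials (S : StripSol f P a b u) (B : Bistable f F P P' m) :
    Partials u (cylConv kerX (stripSrc f P a b u)) (cylConv kerY (stripSrc f P a b u)) := by
  have := partials_cylConv_kerG (S.weights.reg0_stripSrc B S.front)
  rwa [← funext S.fixed] at this

lemma left_le_one (S : StripSol f P a b u) (x : ℝ) : |a x| ≤ 1 := by
  rw [abs_of_nonneg (S.weights.left_nonneg x)]
  linarith [S.weights.add_le x, S.weights.right_nonneg x]

lemma right_le_one (S : StripSol f P a b u) (x : ℝ) : |b x| ≤ 1 := by
  rw [abs_of_nonneg (S.weights.right_nonneg x)]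
  linarith [S.weights.add_le x, S.weights.left_nonneg x]

lemma reg_src (S : StripSol f P a b u) (B : Bistable f F P P' m) (ra : Reg 1 fun p => a p.1)
    (rb : Reg 1 fun p => b p.1) : Reg 1 (stripSrc f P a b u) :=
  (ra.mul ((S.reg_one B).comp B.smooth)).add (rb.mul (B.reg_profile.comp B.smooth))

lemma deriv_fst_boundary (S : StripSol f P a b u) (B : Bistable f F P P' m) (x : ℝ) :
    cylConv kerX (stripSrc f P a b u) (x, 0) = 0 ∧
      cylConv kerX (stripSrc f P a b u) (x, π) = 0 := by
  have ho : ∀ y, _ := fun y => odd_partial_fst (S.partials B) S.front.odd x y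
  have hp := ((S.weights.reg0_stripSrc B S.front).cylConv integrable_kerX).per x
  exact ⟨odd_zero (g := fun y => cylConv kerX (stripSrc f P a b u) (x, y)) ho,
    odd_periodic_pi (g := fun y => cylConv kerX (stripSrc f P a b u) (x, y)) hp ho⟩

end StripSol

/-- Density of the spatial Hamiltonian in the direction of the strip. -/
noncomputable def hamDensity (f F P a b : ℝ → ℝ) (u : ℝ × ℝ → ℝ) (x y : ℝ) : ℝ :=
  cylConv kerX (stripSrc f P a b u) (x, y) ^ 2 / 2 -
    cylConv kerY (stripSrc f P a b u) (x, y) ^ 2 / 2 +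
    (a x * F (u (x, y)) + b x * tangent f F P y (u (x, y)))

namespace StripSol

lemma continuous_hamDensity (S : StripSol f P a b u) (B : Bistable f F P P' m) :
    Continuous fun q : ℝ × ℝ => hamDensity f F P a b u q.1 q.2 := by
  have r := S.weights.reg0_stripSrc B S.front
  have c1 := (r.cylConv integrable_kerX).cont
  have c2 := (r.cylConv integrable_kerY).cont
  have := S.front.continuous
  have := S.weights.cont_left
  have := S.weights.cont_right
  have := B.continuous_f
  have := B.continuous_primitive
  have := B.continuous_profile
  unfold hamDensity tangent
  fun_prop

lemma hasDerivAt_ham (S : StripSol f P a b u) (B : Bistable f F P P' m)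
    (ha : ∀ x, HasDerivAt a (a' x) x) (hb : ∀ x, HasDerivAt b (b' x) x)
    (ca : Continuous a') (cb : Continuous b') (ba : ∃ M, ∀ x, |a' x| ≤ M)
    (bb : ∃ M, ∀ x, |b' x| ≤ M) (x : ℝ) :
    HasDerivAt (fun x => ∫ y in (0)..π, hamDensity f F P a b u x y)
      (∫ y in (0)..π, (a' x * F (u (x, y)) + b' x * tangent f F P y (u (x, y)))) x := by
  have r := S.weights.reg0_stripSrc B S.front
  have bd := S.deriv_fst_boundary B x
  have pu := S.partials B
  obtain ⟨-, s₁, s₂, r₁, r₂, ps⟩ := S.reg_src B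
    (Weights.reg_fst S.weights.cont_left ⟨1, S.left_le_one⟩ ha ca ba)
    (Weights.reg_fst S.weights.cont_right ⟨1, S.right_le_one⟩ hb cb bb)
  have lap := cylConv_laplacian r r₁ r₂ ps (stripSrc_odd B S.front)
  have den : hamDensity f F P a b u = fun x y =>
      cylConv kerX (stripSrc f P a b u) (x, y) ^ 2 / 2 -
        cylConv kerY (stripSrc f P a b u) (x, y) ^ 2 / 2 +
        (a x * F (u (x, y)) + b x * tangent f F P y (u (x, y))) := rfl
  have p1 : Partials (cylConv kerX (stripSrc f P a b u)) (cylConv kerX s₁) (cylConv kerY s₁) := by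
    rw [← funext (cylConv_kerG_fst r r₁ fun x y => (ps x y).1)]
    exact partials_cylConv_kerG r₁
  have p2 : Partials (cylConv kerY (stripSrc f P a b u)) (cylConv kerX s₂) (cylConv kerY s₂) := by
    rw [← funext (cylConv_kerG_snd r r₂ fun x y => (ps x y).2)]
    exact partials_cylConv_kerG r₂
  have p12 := hasDerivAt_cylConv_fst integrable_kerY r r₁ fun x y => (ps x y).1
  have src : ∀ p, stripSrc f P a b u p = a p.1 * f (u p) + b p.1 * f (P p.2) := fun _ => rfl
  have hc := S.continuous_hamDensity B
  have c1 := (r.cylConv integrable_kerX).cont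
  have c2 := (r.cylConv integrable_kerY).cont
  have c12 := (r₁.cylConv integrable_kerY).cont
  have c22 := (r₂.cylConv integrable_kerY).cont
  have := S.front.continuous
  have := B.continuous_f
  have := B.continuous_primitive
  have := B.continuous_profile
  generalize cylConv kerX (stripSrc f P a b u) = u₁ at *
  generalize cylConv kerY (stripSrc f P a b u) = u₂ at *
  generalize cylConv kerX s₁ = u₁₁ at *
  generalize cylConv kerY s₁ = u₁₂ at *
  generalize cylConv kerY s₂ = u₂₂ at *
  have := hasDerivAt_intervalIntegral_param (a := 0) (b := π) (s₀ := x) one_pos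
    (F := hamDensity f F P a b u)
    (F' := fun x y => -(u₁₂ (x, y) * u₂ (x, y) + u₁ (x, y) * u₂₂ (x, y)) +
      (a' x * F (u (x, y)) + b' x * tangent f F P y (u (x, y))))
    (fun s _ => by fun_prop) (by unfold tangent; fun_prop) (fun s _ t => by
      have hF := (B.primitive (u (s, t))).comp s (pu s t).1
      have hT := (((pu s t).1.sub_const (P t)).const_mul (f (P t))).add_const (F (P t))
      have := ((((p1 s t).1.pow 2).div_const 2).sub (((p12 s t).pow 2).div_const 2)).add
        (((ha s).mul hF).add ((hb s).mul hT))
      rw [den]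
      refine this.congr_deriv ?_
      have l := lap (s, t)
      rw [src] at l
      simp only [tangent, Function.comp]
      linear_combination u₁ (s, t) * l)
  refine this.congr_deriv ?_
  rw [intervalIntegral.integral_add (Continuous.intervalIntegrable (by fun_prop) _ _)
    (Continuous.intervalIntegrable (by unfold tangent; fun_prop) _ _),
    intervalIntegral.integral_neg, intervalIntegral.integral_eq_sub_of_hasDerivAt
      (f := fun y => u₁ (x, y) * u₂ (x, y)) (fun y _ => (p1 x y).2.mul (p2 x y).2)
      (Continuous.intervalIntegrable (by fun_prop) _ _)]
  simp [bd.1, bd.2]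

lemma exists_hamDensity_bound (S : StripSol f P a b u) (B : Bistable f F P P' m) :
    ∃ M, ∀ x y, |hamDensity f F P a b u x y| ≤ M := by
  have hs := S.weights.abs_stripSrc_le B S.front
  obtain ⟨MF, h0, hF⟩ := exists_abs_bound F B.continuous_primitive (P (π / 2))
  set c := P (π / 2) with hc
  set K := kerNorm kerX * f c
  set L := kerNorm kerY * f c
  refine ⟨K ^ 2 / 2 + L ^ 2 / 2 + (1 * MF + 1 * (f c * (c + c) + MF)), fun x y => ?_⟩
  have h1 := abs_cylConv_le integrable_kerX hs (x, y)
  have h2 := abs_cylConv_le integrable_kerY hs (x, y)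
  have hu := S.front.abs_le B (x, y)
  have hP := B.abs_profile_le y
  have fP := B.abs_f_le hP
  have hT : |tangent f F P y (u (x, y))| ≤ f c * (c + c) + MF := by
    refine (abs_add_le _ _).trans (add_le_add ?_ (hF _ hP))
    rw [abs_mul]
    exact mul_le_mul fP ((abs_sub _ _).trans (add_le_add hu hP)) (abs_nonneg _)
      ((abs_nonneg _).trans fP)
  refine (abs_add_le _ _).trans (add_le_add ((abs_sub _ _).trans (add_le_add ?_ ?_))
    ((abs_add_le _ _).trans (add_le_add ?_ ?_)))
  · rw [abs_of_nonneg (by positivity)]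
    have := sq_le_sq.2 (h1.trans (le_abs_self _))
    linarith
  · rw [abs_of_nonneg (by positivity)]
    have := sq_le_sq.2 (h2.trans (le_abs_self _))
    linarith
  · rw [abs_mul]
    exact mul_le_mul (S.left_le_one x) (hF _ hu) (abs_nonneg _) zero_le_one
  · rw [abs_mul]
    exact mul_le_mul (S.right_le_one x) hT (abs_nonneg _) zero_le_one

lemma tendsto_ham (S : StripSol f P a b u) (B : Bistable f F P P' m) {l : Filter ℝ} [l.NeBot]
    {x : ℕ → ℝ} (hx : ∀ s, Tendsto (fun n => s + x n) atTop l) {A A' : ℝ}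
    (ha : Tendsto a l (𝓝 A)) (hb : Tendsto b l (𝓝 A')) {Q : ℝ → ℝ}
    (hQ : ∀ y, Tendsto (fun s => u (s, y)) l (𝓝 (Q y))) :
    ∃ Q' : ℝ → ℝ, (∀ y, HasDerivAt Q (Q' y) y) ∧
      (∀ y, HasDerivAt Q' (-(A * f (Q y) + A' * f (P y))) y) ∧ Q 0 = 0 ∧ Q π = 0 ∧
      Tendsto (fun n => ∫ y in (0)..π, hamDensity f F P a b u (x n) y) atTop
        (𝓝 (∫ y in (0)..π,
          (-(Q' y ^ 2 / 2) + (A * F (Q y) + A' * tangent f F P y (Q y))))) := by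
  obtain ⟨S', lim⟩ := S.at_infinity B hx ha hb hQ
  obtain ⟨Q', d, d', q0, qpi, der⟩ := S'.ode B
  refine ⟨Q', d, d', q0, qpi, ?_⟩
  obtain ⟨M, hM⟩ := S.exists_hamDensity_bound B
  have hc := S.continuous_hamDensity B
  have hx0 : Tendsto x atTop l := by simpa using hx 0
  refine intervalIntegral.tendsto_integral_filter_of_dominated_convergence (fun _ => M)
    (Eventually.of_forall fun n => Continuous.aestronglyMeasurable (by fun_prop))
    (Eventually.of_forall fun n => Eventually.of_forall fun y _ => hM _ _)
    intervalIntegrable_const (Eventually.of_forall fun y _ => ?_)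
  have t1 := lim kerX integrable_kerX y
  have t2 := lim kerY integrable_kerY y
  rw [(der y).1] at t1
  rw [(der y).2] at t2
  have tu := (hQ y).comp hx0
  have tF := (B.continuous_primitive.tendsto (Q y)).comp tu
  have tT := ((tu.sub_const (P y)).const_mul (f (P y))).add_const (F (P y))
  have := (((t1.pow 2).div_const 2).sub ((t2.pow 2).div_const 2)).add
    (((ha.comp hx0).mul tF).add ((hb.comp hx0).mul tT))
  simpa [hamDensity, tangent, Function.comp_def] using this

end StripSol

end

lemma tendsto_const_add_natCast (s : ℝ) : Tendsto (fun n : ℕ => s + (n : ℝ)) atTop atTop :=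
  tendsto_atTop_add_const_left _ s tendsto_natCast_atTop_atTop

lemma tendsto_const_sub_natCast (s : ℝ) : Tendsto (fun n : ℕ => s + -(n : ℝ)) atTop atBot :=
  tendsto_atBot_add_const_left _ s (tendsto_neg_atTop_atBot.comp tendsto_natCast_atTop_atTop)

lemma tendsto_ramp_add_atTop (t : ℝ) : Tendsto (fun x => ramp (x + t)) atTop (𝓝 1) :=
  tendsto_ramp_atTop.comp (tendsto_atTop_add_const_right _ t tendsto_id)

lemma tendsto_ramp_add_atBot (t : ℝ) : Tendsto (fun x => ramp (x + t)) atBot (𝓝 0) :=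
  tendsto_ramp_atBot.comp (tendsto_atBot_add_const_right _ t tendsto_id)

lemma hasDerivAt_ramp_add (t x : ℝ) :
    HasDerivAt (fun x => ramp (x + t)) ((1 + (x + t) ^ 2)⁻¹ / π) x :=
  (hasDerivAt_ramp (x + t)).comp_add_const x t

lemma ramp_deriv_pos (t x : ℝ) : 0 < (1 + (x + t) ^ 2)⁻¹ / π := by positivity

lemma continuous_ramp_deriv (t : ℝ) : Continuous fun x : ℝ => (1 + (x + t) ^ 2)⁻¹ / π := by
  have : ∀ x : ℝ, 1 + (x + t) ^ 2 ≠ 0 := fun x => by positivity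
  fun_prop (disch := assumption)

lemma abs_ramp_deriv_le (t x : ℝ) : |(1 + (x + t) ^ 2)⁻¹ / π| ≤ 1 / π := by
  rw [abs_of_pos (ramp_deriv_pos t x)]
  gcongr
  exact inv_le_one_of_one_le₀ (by nlinarith [sq_nonneg (x + t)])

section

variable {f F P P' : ℝ → ℝ} {m : ℝ} {u : ℝ × ℝ → ℝ}

lemma eq_zero_of_integral_strip {g : ℝ → ℝ} (hg : Continuous g) (h0 : ∀ y ∈ Icc 0 π, 0 ≤ g y)
    (hi : ∫ y in (0)..π, g y = 0) : g (π / 2) = 0 := by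
  by_contra h
  have mid : π / 2 ∈ Icc 0 π := ⟨by positivity, by linarith [pi_pos]⟩
  exact (intervalIntegral.integral_pos pi_pos hg.continuousOn
    (fun y hy => h0 y (Ioc_subset_Icc_self hy)) ⟨_, mid, (h0 _ mid).lt_of_ne' h⟩).ne' hi

/-- A front cannot be trapped at the onset of the nonlinearity. -/
lemma not_stripSol_left (B : Bistable f F P P' m) (hm : u (0, π / 2) = m) {t : ℝ}
    (S : StripSol f P (fun x => ramp (x + t)) (fun _ => 0) u) : False := by
  have hd := S.hasDerivAt_ham B (hasDerivAt_ramp_add t) (fun x => hasDerivAt_const x 0)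
    (continuous_ramp_deriv t) continuous_const ⟨_, abs_ramp_deriv_le t⟩ ⟨0, by simp⟩
  obtain ⟨Q, hQ⟩ := S.front.exists_tendsto_atTop B
  obtain ⟨R, hR⟩ := S.front.exists_tendsto_atBot
  obtain ⟨Q', q1, q2, q3, q4, hr⟩ := S.tendsto_ham B (x := fun n => n) tendsto_const_add_natCast
    (tendsto_ramp_add_atTop t) tendsto_const_nhds hQ
  obtain ⟨R', r1, -, -, -, hl⟩ := S.tendsto_ham B (x := fun n => -n) tendsto_const_sub_natCast
    (tendsto_ramp_add_atBot t) tendsto_const_nhds hR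
  have hR0 : ∀ y, R y = 0 := fun y =>
    (S.at_infinity B (x := fun n => -n) tendsto_const_sub_natCast
      (tendsto_ramp_add_atBot t) tendsto_const_nhds hR).1.eq_zero (0, y)
  have hR' : ∀ y, R' y = 0 := fun y => by
    have := r1 y
    rw [funext hR0] at this
    exact this.unique (hasDerivAt_const y 0)
  have hF : ∀ x, ∀ y ∈ Icc 0 π, 0 ≤ F (u (x, y)) := fun x y hy =>
    B.primitive_nonneg (S.front.mem B x hy)
  have key := eq_zero_of_monotone_limits hd (fun x => by
    refine intervalIntegral.integral_nonneg pi_pos.le fun y hy => ?_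
    have := mul_nonneg (ramp_deriv_pos t x).le (hF x y hy)
    linarith) hl hr (by
    have e := B.energy_nonneg Q Q' q1 (fun y => by simpa using q2 y) q3 q4
    have : ∫ y in (0)..π, (-(Q' y ^ 2 / 2) + (1 * F (Q y) + 0 * tangent f F P y (Q y))) =
        -∫ y in (0)..π, (Q' y ^ 2 / 2 - F (Q y)) := by
      rw [← intervalIntegral.integral_neg]
      congr 1 with y
      ring
    rw [this]
    simp only [hR', zero_mul, add_zero]
    norm_num
    exact e) 0
  have := eq_zero_of_integral_strip (by
    have := S.front.continuous
    have := B.continuous_primitive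
    have := B.continuous_profile
    have := B.continuous_f
    unfold tangent
    fun_prop) (fun y hy => by
      have := mul_nonneg (ramp_deriv_pos t 0).le (hF 0 y hy)
      linarith) key
  simp only [zero_mul, add_zero, hm] at this
  refine (mul_pos (ramp_deriv_pos t 0)
    (B.primitive_pos ⟨B.level_pos.le, B.level_lt.le⟩ B.level_pos.ne')).ne ?_
  exact this.symm

/-- A front cannot be trapped at the transition to the tangent problem. -/
lemma not_stripSol_right (B : Bistable f F P P' m) (hm : u (0, π / 2) = m) {t : ℝ}
    (S : StripSol f P (fun x => 1 - ramp (x + t)) (fun x => ramp (x + t)) u) : False := by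
  have hd := S.hasDerivAt_ham B (fun x => (hasDerivAt_ramp_add t x).const_sub 1)
    (hasDerivAt_ramp_add t) (continuous_ramp_deriv t).neg (continuous_ramp_deriv t)
    ⟨_, fun x => (abs_neg _).trans_le (abs_ramp_deriv_le t x)⟩ ⟨_, abs_ramp_deriv_le t⟩
  obtain ⟨Q, hQ⟩ := S.front.exists_tendsto_atTop B
  obtain ⟨R, hR⟩ := S.front.exists_tendsto_atBot
  have ta := (tendsto_ramp_add_atTop t).const_sub 1
  have tb := (tendsto_ramp_add_atBot t).const_sub 1
  rw [sub_self] at ta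
  rw [sub_zero] at tb
  obtain ⟨Q', q1, -, -, -, hr⟩ := S.tendsto_ham B (x := fun n => n) tendsto_const_add_natCast
    ta (tendsto_ramp_add_atTop t) hQ
  obtain ⟨R', r1, r2, r3, r4, hl⟩ := S.tendsto_ham B (x := fun n => -n)
    tendsto_const_sub_natCast tb (tendsto_ramp_add_atBot t) hR
  have hQP : ∀ y, Q y = P y := fun y =>
    (S.at_infinity B (x := fun n => n) tendsto_const_add_natCast ta
      (tendsto_ramp_add_atTop t) hQ).1.eq_profile B (0, y)
  have hQ' : ∀ y, Q' y = P' y := fun y => by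
    have := q1 y
    rw [funext hQP] at this
    exact this.unique (B.profile_deriv y)
  have hT : ∀ x, ∀ y ∈ Icc 0 π, 0 ≤ F (u (x, y)) - tangent f F P y (u (x, y)) := fun x y hy =>
    sub_nonneg.2 (B.tangent_le (S.front.mem B x hy) ⟨B.profile_nonneg y hy, B.profile_le y⟩)
  have split : ∀ x y, -(-((1 + (x + t) ^ 2)⁻¹ / π) * F (u (x, y)) +
      (1 + (x + t) ^ 2)⁻¹ / π * tangent f F P y (u (x, y))) =
      (1 + (x + t) ^ 2)⁻¹ / π * (F (u (x, y)) - tangent f F P y (u (x, y))) := fun x y => by ring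
  have key := eq_zero_of_monotone_limits (fun x => (hd x).neg) (fun x => by
    rw [← intervalIntegral.integral_neg]
    refine intervalIntegral.integral_nonneg pi_pos.le fun y hy => ?_
    rw [split]
    exact mul_nonneg (ramp_deriv_pos t x).le (hT x y hy)) hl.neg hr.neg (by
    have e := B.energy_nonneg R R' r1 (fun y => by simpa using r2 y) r3 r4
    have h1 : ∫ y in (0)..π, (-(R' y ^ 2 / 2) + (1 * F (R y) + 0 * tangent f F P y (R y))) =
        -∫ y in (0)..π, (R' y ^ 2 / 2 - F (R y)) := by
      rw [← intervalIntegral.integral_neg]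
      congr 1 with y
      ring
    have h2 : ∫ y in (0)..π, (-(Q' y ^ 2 / 2) + (0 * F (Q y) + 1 * tangent f F P y (Q y))) =
        -∫ y in (0)..π, (P' y ^ 2 / 2 - F (P y)) := by
      rw [← intervalIntegral.integral_neg]
      congr 1 with y
      rw [hQ', hQP, tangent]
      ring
    rw [h1, h2, B.profile_energy]
    linarith) 0
  rw [← intervalIntegral.integral_neg] at key
  simp only [split] at key
  have := eq_zero_of_integral_strip (by
    have := S.front.continuous
    have := B.continuous_primitive
    have := B.continuous_profile
    have := B.continuous_f
    unfold tangent
    fun_prop) (fun y hy => mul_nonneg (ramp_deriv_pos t 0).le (hT 0 y hy)) key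
  simp only [hm] at this
  exact (mul_pos (ramp_deriv_pos t 0) (sub_pos.2 (B.tangent_lt
    ⟨B.level_pos.le, B.level_lt.le⟩ ⟨B.max_pos.le, le_rfl⟩ B.level_lt.ne))).ne' this

lemma exists_entire_stripSol (B : Bistable f F P P' m) :
    ∃ u : ℝ × ℝ → ℝ, u (0, π / 2) = m ∧ StripSol f P (fun _ => 1) (fun _ => 0) u := by
  obtain ⟨u, hm, h | ⟨t, h⟩ | ⟨t, h⟩⟩ := exists_stripSol B
  · exact ⟨u, hm, h⟩
  · exact (not_stripSol_left B hm h).elim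
  · exact (not_stripSol_right B hm h).elim

end

lemma Partials.pd1 {h h₁ h₂ : ℝ × ℝ → ℝ} (hp : Partials h h₁ h₂)
    (c1 : Continuous h₁) (c2 : Continuous h₂) : pd1 h = h₁ := by
  funext p
  rw [_root_.pd1, (hp.hasFDerivAt c1 c2 p).fderiv]
  simp

lemma Partials.pd2 {h h₁ h₂ : ℝ × ℝ → ℝ} (hp : Partials h h₁ h₂)
    (c1 : Continuous h₁) (c2 : Continuous h₂) : pd2 h = h₂ := by
  funext p
  rw [_root_.pd2, (hp.hasFDerivAt c1 c2 p).fderiv]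
  simp

lemma Partials.exists_small {h h₁ h₂ : ℝ × ℝ → ℝ} (hp : Partials h h₁ h₂) (hc : Continuous h)
    {M : ℝ} (hM : ∀ p, |h p| ≤ M) {ε : ℝ} (hε : 0 < ε) : ∃ p, |h₁ p| ≤ ε ∧ |h₂ p| ≤ ε := by
  have hM0 : 0 ≤ M := (abs_nonneg _).trans (hM (0, 0))
  set δ := ε ^ 2 / (8 * M + 1) with hδ
  have δ0 : 0 < δ := by positivity
  have δM : 8 * δ * M ≤ ε ^ 2 := by
    have : δ * (8 * M + 1) = ε ^ 2 := by rw [hδ]; field_simp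
    nlinarith
  obtain ⟨z, hz⟩ := Continuous.exists_forall_ge'
    (f := fun p : ℝ × ℝ => h p - δ * (p.1 ^ 2 + p.2 ^ 2)) (by fun_prop) (0, 0) (by
      have ev := (tendsto_norm_cocompact_atTop (E := ℝ × ℝ)).eventually_ge_atTop
        (2 * M / δ + 1)
      filter_upwards [ev] with p hpn
      have h1 := abs_le.1 (hM p)
      have h2 := abs_le.1 (hM (0, 0))
      have hn : ‖p‖ ^ 2 ≤ p.1 ^ 2 + p.2 ^ 2 := by
        rcases max_choice ‖p.1‖ ‖p.2‖ with e | e <;>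
          rw [Prod.norm_def, e, norm_eq_abs, sq_abs] <;> nlinarith [sq_nonneg p.1, sq_nonneg p.2]
      have hq : 0 ≤ 2 * M / δ := by positivity
      have : 2 * M ≤ δ * (p.1 ^ 2 + p.2 ^ 2) := by
        rw [← div_le_iff₀' δ0]
        nlinarith
      norm_num
      linarith)
  have hz2 : δ * (z.1 ^ 2 + z.2 ^ 2) ≤ 2 * M := by
    have := hz (0, 0)
    have h1 := abs_le.1 (hM z)
    have h2 := abs_le.1 (hM (0, 0))
    simp only at this
    nlinarith
  have small : ∀ t : ℝ, δ * t ^ 2 ≤ 2 * M → |2 * δ * t| ≤ ε := fun t ht => by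
    refine abs_le_of_sq_le_sq ?_ hε.le
    nlinarith
  obtain ⟨x, y⟩ := z
  have e1 : h₁ (x, y) = 2 * δ * x := by
    have d := (hp x y).1.sub ((((hasDerivAt_id x).pow 2).add_const (y ^ 2)).const_mul δ)
    have := IsLocalMax.hasDerivAt_eq_zero (Eventually.of_forall fun s => hz (s, y)) d
    simp at this
    linarith
  have e2 : h₂ (x, y) = 2 * δ * y := by
    have d := (hp x y).2.sub ((((hasDerivAt_id y).pow 2).const_add (x ^ 2)).const_mul δ)
    have := IsLocalMax.hasDerivAt_eq_zero (Eventually.of_forall fun s => hz (x, s)) d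
    simp at this
    linarith
  refine ⟨(x, y), ?_, ?_⟩
  · rw [e1]
    exact small x (by nlinarith [sq_nonneg y])
  · rw [e2]
    exact small y (by nlinarith [sq_nonneg x])

section

variable {f F P P' : ℝ → ℝ} {m : ℝ} {u : ℝ × ℝ → ℝ}

lemma stripSrc_one_zero : stripSrc f P (fun _ => 1) (fun _ => 0) u = fun p => f (u p) := by
  funext p
  simp [stripSrc]

namespace StripSol

lemma reg (S : StripSol f P (fun _ => 1) (fun _ => 0) u) (B : Bistable f F P P' m) (n : ℕ) :
    Reg n u := by
  induction n with
  | zero => exact S.front.reg0 B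
  | succ n ih =>
    rw [funext S.fixed, stripSrc_one_zero]
    exact (ih.comp B.smooth).cylConv_kerG

lemma deriv_fst_nonneg {a b : ℝ → ℝ} (S : StripSol f P a b u) (B : Bistable f F P P' m) (x : ℝ)
    {y : ℝ} (hy : y ∈ Icc 0 π) : 0 ≤ cylConv kerX (stripSrc f P a b u) (x, y) := by
  have mono : Monotone fun s => u (s, y) := fun s t h => S.front.mono s t h y hy
  exact (S.partials B x y).1.deriv ▸ mono.deriv_nonneg

lemma exists_deriv_fst_pos (S : StripSol f P (fun _ => 1) (fun _ => 0) u)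
    (B : Bistable f F P P' m) (hm : u (0, π / 2) = m) : ∃ x, ∃ y ∈ Ioo 0 π,
      0 < cylConv kerX (stripSrc f P (fun _ => 1) (fun _ => 0) u) (x, y) := by
  by_contra! h
  have pu := S.partials B
  have bd := S.deriv_fst_boundary B
  have nn := fun x y hy => S.deriv_fst_nonneg B x (y := y) hy
  have per := ((S.weights.reg0_stripSrc B S.front).cylConv integrable_kerX).per
  have odd := odd_partial_fst pu S.front.odd
  have zero : ∀ x y, cylConv kerX (stripSrc f P (fun _ => 1) (fun _ => 0) u) (x, y) = 0 := by
    intro x y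
    obtain ⟨y', hy', ε, -, e⟩ := exists_strip y
    rw [e (fun y => cylConv kerX _ (x, y)) (per x) (odd x)]
    have : cylConv kerX (stripSrc f P (fun _ => 1) (fun _ => 0) u) (x, y') = 0 := by
      rcases eq_endpoints_or_mem_Ioo_of_mem_Icc hy' with rfl | rfl | hy''
      · exact (bd x).1
      · exact (bd x).2
      · exact le_antisymm (h x y' hy'') (nn x y' hy')
    rw [this, mul_zero]
  have const : u = fun p => u (0, p.2) := by
    funext ⟨x, y⟩
    refine is_const_of_deriv_eq_zero (f := fun s => u (s, y))
      (fun s => (pu s y).1.differentiableAt) (fun s => ?_) x 0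
    rw [(pu s y).1.deriv, zero]
  have S' := S
  rw [const] at S'
  obtain ⟨Q', d, d', q0, qpi, -⟩ := ode (Q := fun y => u (0, y)) S' B
  exact B.level_ne _ Q' d (fun y => by simpa using d' y) q0 qpi hm

lemma deriv_fst_pos (S : StripSol f P (fun _ => 1) (fun _ => 0) u)
    (B : Bistable f F P P' m) (hm : u (0, π / 2) = m) (x : ℝ) {y : ℝ} (hy : y ∈ Ioo 0 π) :
    0 < cylConv kerX (stripSrc f P (fun _ => 1) (fun _ => 0) u) (x, y) := by
  obtain ⟨x₀, y₀, hy₀, h₀⟩ := S.exists_deriv_fst_pos B hm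
  have r := S.weights.reg0_stripSrc B S.front
  have odd := stripSrc_odd (a := fun _ => 1) (b := fun _ => 0) B S.front
  have pu := S.partials B
  have nn := fun x y hy => S.deriv_fst_nonneg B x (y := y) hy
  obtain ⟨-, s₁, s₂, r₁, r₂, ps⟩ := S.reg_src B (Weights.reg_fst (a' := fun _ => 0)
      continuous_const ⟨1, S.left_le_one⟩ (fun x => hasDerivAt_const x 1) continuous_const
      ⟨0, by simp⟩)
    (Weights.reg_fst (a' := fun _ => 0) continuous_const ⟨1, S.right_le_one⟩
      (fun x => hasDerivAt_const x 0) continuous_const ⟨0, by simp⟩)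
  have chain : ∀ x y, s₁ (x, y) = deriv f (u (x, y)) *
      cylConv kerX (stripSrc f P (fun _ => 1) (fun _ => 0) u) (x, y) := fun x y => by
    refine (ps x y).1.unique (?_ : HasDerivAt _ _ _)
    have := (B.hasDerivAt_f (u (x, y))).comp x (pu x y).1
    simpa only [stripSrc_one_zero, Function.comp_def] using this
  have hf : ∀ x, ∀ y ∈ Icc 0 π, 0 < deriv f (u (x, y)) := fun x y hy =>
    B.deriv_pos _ (S.front.mem B x hy)
  rw [← cylConv_kerG_fst r r₁ fun x y => (ps x y).1]
  refine cylConv_kerG_pos r₁ (odd_partial_fst ps odd) (fun x y hy => ?_) hy₀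
    (?_ : 0 < s₁ (x₀, y₀)) x hy
  · rw [chain]
    exact mul_nonneg (hf x y hy).le (nn x y hy)
  · rw [chain]
    exact mul_pos (hf x₀ y₀ (Ioo_subset_Icc_self hy₀)) h₀

lemma gradient_ne_zero (S : StripSol f P (fun _ => 1) (fun _ => 0) u)
    (B : Bistable f F P P' m) (hm : u (0, π / 2) = m) (x y : ℝ)
    (h1 : cylConv kerX (stripSrc f P (fun _ => 1) (fun _ => 0) u) (x, y) = 0) :
    cylConv kerY (stripSrc f P (fun _ => 1) (fun _ => 0) u) (x, y) ≠ 0 := by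
  have r := S.weights.reg0_stripSrc B S.front
  have odd := stripSrc_odd (a := fun _ => 1) (b := fun _ => 0) B S.front
  have hpos := fun x y hy => S.weights.stripSrc_nonneg B S.front x (y := y) hy
  have mid : π / 2 ∈ Ioo 0 π := ⟨by positivity, by linarith [pi_pos]⟩
  have h₀ : 0 < stripSrc f P (fun _ => 1) (fun _ => 0) u (0, π / 2) := by
    rw [stripSrc_one_zero]
    simp only [hm]
    rw [← B.f_zero]
    exact B.strictMonoOn_f ⟨le_rfl, B.max_pos.le⟩ ⟨B.level_pos.le, B.level_lt.le⟩ B.level_pos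
  obtain ⟨y', hy', ε, hε, e⟩ := exists_strip y
  have e1 := e (fun y => cylConv kerX (stripSrc f P (fun _ => 1) (fun _ => 0) u) (x, y))
    ((r.cylConv integrable_kerX).per x) (odd_partial_fst (S.partials B) S.front.odd x)
  rw [h1, zero_eq_mul, or_iff_right (abs_pos.1 (hε ▸ one_pos))] at e1
  have hs : sin y = 0 := by
    rw [e sin sin_add_two_pi sin_neg]
    rcases eq_endpoints_or_mem_Ioo_of_mem_Icc hy' with rfl | rfl | hy''
    · simp
    · simp
    · exact absurd e1 (S.deriv_fst_pos B hm x hy'').ne'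
  have per : Function.Periodic
      (fun y => cylConv kerY (stripSrc f P (fun _ => 1) (fun _ => 0) u) (x, y)) (2 * π) :=
    (r.cylConv integrable_kerY).per x
  obtain ⟨n, rfl⟩ := sin_eq_zero_iff.1 hs
  obtain ⟨k, rfl | rfl⟩ := Int.even_or_odd' n
  · have := per.int_mul k 0
    rw [show (0 : ℝ) + k * (2 * π) = ((2 * k : ℤ) : ℝ) * π by push_cast; ring] at this
    exact this ▸ (cylConv_kerY_zero_pos r odd hpos mid h₀ x).ne'
  · have := per.int_mul k π
    rw [show π + k * (2 * π) = ((2 * k + 1 : ℤ) : ℝ) * π by push_cast; ring] at this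
    exact this ▸ (cylConv_kerY_pi_neg r odd hpos mid h₀ x).ne

lemma lap2_eq (S : StripSol f P (fun _ => 1) (fun _ => 0) u) (B : Bistable f F P P' m)
    (p : ℝ × ℝ) : -lap2 u p = f (u p) := by
  have r := S.weights.reg0_stripSrc B S.front
  have rs := (S.reg B 1).comp B.smooth
  rw [← stripSrc_one_zero (P := P)] at rs
  obtain ⟨-, s₁, s₂, r₁, r₂, ps⟩ := rs
  have p1 := partials_cylConv_kerG r₁
  have p2 := partials_cylConv_kerG r₂
  have c1 := (r.cylConv integrable_kerX).cont
  have c2 := (r.cylConv integrable_kerY).cont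
  have h1 : pd1 u = cylConv kerG s₁ := ((S.partials B).pd1 c1 c2).trans
    (funext (cylConv_kerG_fst r r₁ fun x y => (ps x y).1)).symm
  have h2 : pd2 u = cylConv kerG s₂ := ((S.partials B).pd2 c1 c2).trans
    (funext (cylConv_kerG_snd r r₂ fun x y => (ps x y).2)).symm
  have h11 := congrFun (p1.pd1 (r₁.cylConv integrable_kerX).cont
    (r₁.cylConv integrable_kerY).cont) p
  have h22 := congrFun (p2.pd2 (r₂.cylConv integrable_kerX).cont
    (r₂.cylConv integrable_kerY).cont) p
  have : lap2 u p = cylConv kerX s₁ p + cylConv kerY s₂ p := by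
    rw [← h11, ← h22, ← h1, ← h2]
    rfl
  rw [this, cylConv_laplacian r r₁ r₂ ps (stripSrc_odd B S.front), neg_neg, stripSrc_one_zero]

lemma grad2_eq {a b : ℝ → ℝ} (S : StripSol f P a b u) (B : Bistable f F P P' m) (p : ℝ × ℝ) :
    grad2 u p = (cylConv kerX (stripSrc f P a b u) p, cylConv kerY (stripSrc f P a b u) p) := by
  have r := S.weights.reg0_stripSrc B S.front
  have c1 := (r.cylConv integrable_kerX).cont
  have c2 := (r.cylConv integrable_kerY).cont
  rw [grad2, (S.partials B).pd1 c1 c2, (S.partials B).pd2 c1 c2]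

lemma iInf_norm_grad2 {a b : ℝ → ℝ} (S : StripSol f P a b u) (B : Bistable f F P P' m) :
    (⨅ p : ℝ × ℝ, ‖grad2 u p‖) = 0 := by
  refine le_antisymm (le_of_forall_pos_le_add fun ε hε => ?_)
    (Real.iInf_nonneg fun p => norm_nonneg _)
  obtain ⟨p, h1, h2⟩ := (S.partials B).exists_small S.front.continuous (S.front.abs_le B) hε
  refine (ciInf_le ⟨0, forall_mem_range.2 fun p => norm_nonneg _⟩ p).trans ?_
  rw [S.grad2_eq B, zero_add]
  exact max_le h1 h2

lemma not_one_dimensional (S : StripSol f P (fun _ => 1) (fun _ => 0) u)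
    (B : Bistable f F P P' m) (hm : u (0, π / 2) = m) :
    ¬ ∃ e : ℝ × ℝ, ‖e‖ = 1 ∧ ∃ g : ℝ → ℝ, ∀ p : ℝ × ℝ, u p = g (p.1 * e.1 + p.2 * e.2) := by
  rintro ⟨⟨e₁, e₂⟩, -, g, hg⟩
  rcases eq_or_ne e₁ 0 with rfl | he
  · have := S.deriv_fst_pos B hm 0 ⟨pi_div_two_pos, by linarith [pi_pos]⟩
    have d := (S.partials B 0 (π / 2)).1
    simp only [hg, mul_zero] at d
    exact this.ne' (d.unique (hasDerivAt_const _ _))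
  · have h1 := hg (π / 2 * e₂ / e₁, 0)
    have h2 := hg (0, π / 2)
    rw [odd_zero (g := fun y => u (_, y)) (S.front.odd _)] at h1
    simp only [zero_mul, add_zero, zero_add, div_mul_cancel₀ _ he] at h1 h2
    exact B.level_pos.ne' (hm.symm.trans (h2.trans h1.symm))

end StripSol

end

/-- there are a smooth odd `f` and a bounded entire smooth solution of
`-Δu = f(u)` in `ℝ²` with bounded and nowhere vanishing gradient, whose gradient has zero
infimum, and which is not one-dimensional. -/
theorem entire_solution_no_critical_points :
    ∃ f : ℝ → ℝ, ∃ u : ℝ × ℝ → ℝ,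
      ContDiff ℝ (⊤ : ℕ∞) f ∧ (∀ t : ℝ, f (-t) = -f t) ∧
      ContDiff ℝ (⊤ : ℕ∞) u ∧
      (∃ M : ℝ, ∀ p : ℝ × ℝ, |u p| ≤ M) ∧
      (∀ p : ℝ × ℝ, -lap2 u p = f (u p)) ∧
      (∃ M : ℝ, ∀ p : ℝ × ℝ, ‖grad2 u p‖ ≤ M) ∧
      (∀ p : ℝ × ℝ, grad2 u p ≠ 0) ∧
      (⨅ p : ℝ × ℝ, ‖grad2 u p‖) = 0 ∧
      ¬ ∃ e : ℝ × ℝ, ‖e‖ = 1 ∧ ∃ g : ℝ → ℝ,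
        ∀ p : ℝ × ℝ, u p = g (p.1 * e.1 + p.2 * e.2) := by
  obtain ⟨f, F, P, P', m, B⟩ := exists_bistable
  obtain ⟨u, hm, S⟩ := exists_entire_stripSol B
  have hs := S.weights.abs_stripSrc_le B S.front
  refine ⟨f, u, B.smooth, B.odd, contDiff_infty.2 fun n => (S.reg B n).contDiff,
    ⟨_, S.front.abs_le B⟩, S.lap2_eq B,
    ⟨max (kerNorm kerX * f (P (π / 2))) (kerNorm kerY * f (P (π / 2))), fun p => ?_⟩,
    fun p h => ?_, S.iInf_norm_grad2 B, S.not_one_dimensional B hm⟩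
  · rw [S.grad2_eq B]
    exact max_le_max (abs_cylConv_le integrable_kerX hs p) (abs_cylConv_le integrable_kerY hs p)
  · rw [S.grad2_eq B, Prod.mk_eq_zero] at h
    exact S.gradient_ne_zero B hm p.1 p.2 h.1 h.2
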